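/- Let G be a countable group with an enumerated generating sequence x : ℕ → G. Then G has a computable left order with respect to x if and only if there exist a finitely generated simple group H (with a surjection π from the free group on a finite set Y onto H) having a computable left order, and a computable embedding φ : G → H. -/

import Mathlib

-- The sign (−1, 0, or 1) of a group element relative to the identity,
-- with respect to a linear order `l`.
open Classical in
noncomputable def orderSign {H : Type*} [Group H] (l : LinearOrder H) (h : H) : ℤ :=
  if l.lt h 1 then -1 else if h = 1 then 0 else 1

/-- A group is left-orderable if it carries a left-invariant linear order. -/
def IsLeftOrderable (G : Type*) [Group G] : Prop :=
  ∃ l : LinearOrder G, ∀ a b c : G, l.le b c → l.le (a * b) (a * c)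

/-- A Frattini embedding: an injective homomorphism preserving and reflecting conjugacy. -/
def IsFrattini {G H : Type*} [Group G] [Group H] (φ : G →* H) : Prop :=
  Function.Injective φ ∧ ∀ a b : G, IsConj a b ↔ IsConj (φ a) (φ b)

/-- `X` is a (finite) generating set of the group. -/
def Generates {G : Type*} [Group G] (X : Finset G) : Prop :=
  Subgroup.closure (X : Set G) = ⊤

/-- Word length of `g` with respect to the finite set `X`: the least length of a word
over `X ∪ X⁻¹` representing `g`. -/
noncomputable def wordLength {G : Type*} [Group G] (X : Finset G) (g : G) : ℕ :=
  sInf {n | ∃ w : List G, w.length = n ∧ (∀ a ∈ w, a ∈ X ∨ a⁻¹ ∈ X) ∧ w.prod = g}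

/-- Quasi-isometric embedding with respect to finite generating sets `X` and `Y`. -/
noncomputable def IsQIEmbedding {G H : Type*} [Group G] [Group H]
    (X : Finset G) (Y : Finset H) (φ : G →* H) : Prop :=
  Function.Injective φ ∧ ∃ C k : ℝ, 0 < C ∧ 0 < k ∧ ∀ g : G,
    (1 / C) * (wordLength X g : ℝ) - k ≤ (wordLength Y (φ g) : ℝ) ∧
    (wordLength Y (φ g) : ℝ) ≤ C * (wordLength X g : ℝ) + k

/-- Evaluation of a formal word (list of pairs (index, sign)) over the
enumerated sequence `x : ℕ → G`. -/
def evalWord {G : Type*} [Group G] (x : ℕ → G) (w : List (ℕ × Bool)) : G :=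
  (w.map (fun p => if p.2 then x p.1 else (x p.1)⁻¹)).prod

/-- A computable left order on a countable group with respect to an enumerated
generating sequence `x : ℕ → G`. -/
def ComputableLeftOrderWrt {G : Type*} [Group G] (x : ℕ → G) : Prop :=
  ∃ l : LinearOrder G, (∀ a b c : G, l.le b c → l.le (a * b) (a * c)) ∧
    Computable (fun w : List (ℕ × Bool) => orderSign l (evalWord x w))

/-- A computable left order on a finitely generated group, presented by
a surjection `π` from a free group of finite rank. -/
def ComputableLeftOrderVia {H : Type*} [Group H] {m : ℕ}
    (π : FreeGroup (Fin m) →* H) : Prop :=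
  ∃ l : LinearOrder H, (∀ a b c : H, l.le b c → l.le (a * b) (a * c)) ∧
    Computable (fun w : List (Fin m × Bool) => orderSign l (π (FreeGroup.mk w)))

/-- The embedding `φ` is computable: one can compute, for each `i`, a word over the
generators of `H` representing `φ (x i)`. -/
def ComputableEmbedding {G H : Type*} [Group G] [Group H] (x : ℕ → G) {m : ℕ}
    (π : FreeGroup (Fin m) →* H) (φ : G →* H) : Prop :=
  ∃ f : ℕ → List (Fin m × Bool), Computable f ∧ ∀ i, π (FreeGroup.mk (f i)) = φ (x i)

/-- Decidable membership problem for the image of `φ` in `H`, presented via `π`. -/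
def DecidableMembership {G H : Type*} [Group G] [Group H] {m : ℕ}
    (π : FreeGroup (Fin m) →* H) (φ : G →* H) : Prop :=
  ComputablePred (fun w : List (Fin m × Bool) => π (FreeGroup.mk w) ∈ φ.range)

/-- Decidable word problem for `H`, presented via `π`. -/
def DecidableWordProblemVia {H : Type*} [Group H] {m : ℕ}
    (π : FreeGroup (Fin m) →* H) : Prop :=
  ComputablePred (fun w : List (Fin m × Bool) => π (FreeGroup.mk w) = 1)

/-- A group is finitely presented: quotient of a finite-rank free group by the
normal closure of finitely many relators. -/
def IsFinitelyPresented (K : Type*) [Group K] : Prop :=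
  ∃ (m : ℕ) (π : FreeGroup (Fin m) →* K) (R : Finset (FreeGroup (Fin m))),
    Function.Surjective π ∧ π.ker = Subgroup.normalClosure (R : Set (FreeGroup (Fin m)))

namespace LO

/-- Positions: integer nodes and the nodes of the binary trees hanging between them. -/
abbrev Pos := ℤ × Option (List Bool)

def dy : List Bool → ℚ
  | [] => 1/2
  | false :: u => dy u / 2
  | true :: u => (1 + dy u) / 2

lemma dy_pos (u : List Bool) : 0 < dy u := by
  induction u with
  | nil => norm_num [dy]
  | cons b u ih => cases b <;> simp only [dy] <;> linarith

lemma dy_lt (u : List Bool) : dy u < 1 := by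
  induction u with
  | nil => norm_num [dy]
  | cons b u ih => cases b <;> simp only [dy] <;> linarith

lemma dy_inj : ∀ u w : List Bool, dy u = dy w → u = w := by
  intro u
  induction u with
  | nil =>
    intro w h
    rcases w with _ | ⟨_ | _, w⟩
    · rfl
    · have := dy_lt w; simp only [dy] at h; linarith
    · have := dy_pos w; simp only [dy] at h; linarith
  | cons b u ih =>
    intro w h
    have h1 := dy_lt u
    have h2 := dy_pos u
    rcases w with _ | ⟨_ | _, w⟩ <;> cases b <;> simp only [dy] at h
    · linarith
    · linarith
    · rw [ih w (by linarith)]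
    · have := dy_lt w; linarith
    · have := dy_pos w; linarith
    · rw [ih w (by linarith)]

def fr : Option (List Bool) → ℚ
  | none => 0
  | some u => dy u

lemma fr_nonneg (c) : 0 ≤ fr c := by
  cases c
  · exact le_rfl
  · exact (dy_pos _).le

lemma fr_lt (c) : fr c < 1 := by
  cases c
  · simp [fr]
  · exact dy_lt _

lemma fr_inj {c c'} (h : fr c = fr c') : c = c' := by
  rcases c with _ | u <;> rcases c' with _ | w <;> simp only [fr] at h
  · rfl
  · have := dy_pos w; linarith
  · have := dy_pos u; linarith
  · rw [dy_inj _ _ h]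

def pval (q : Pos) : ℚ := q.1 + fr q.2

lemma pval_lt {q q' : Pos} : pval q < pval q' ↔ q.1 < q'.1 ∨ (q.1 = q'.1 ∧ fr q.2 < fr q'.2) := by
  obtain ⟨z, c⟩ := q
  obtain ⟨z', c'⟩ := q'
  simp only [pval]
  have h1 := fr_nonneg c
  have h2 := fr_nonneg c'
  have h3 := fr_lt c
  have h4 := fr_lt c'
  constructor
  · intro h
    rcases lt_trichotomy z z' with h5 | h5 | h5
    · exact Or.inl h5
    · subst h5; right; exact ⟨rfl, by linarith⟩
    · exfalso
      have : (z' : ℚ) + 1 ≤ z := by exact_mod_cast h5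
      linarith
  · rintro (h | ⟨h, h'⟩)
    · have : (z : ℚ) + 1 ≤ z' := by exact_mod_cast h
      linarith
    · subst h; linarith

lemma pval_inj : Function.Injective pval := by
  rintro ⟨z, c⟩ ⟨z', c'⟩ h
  have h1 : ¬ pval (z, c) < pval (z', c') := by rw [h]; exact lt_irrefl _
  have h2 : ¬ pval (z', c') < pval (z, c) := by rw [h]; exact lt_irrefl _
  rw [pval_lt] at h1 h2
  simp only [not_or, not_and, not_lt] at h1 h2
  have hz : z = z' := le_antisymm h2.1 h1.1
  subst hz
  have := fr_inj (le_antisymm (h2.2 rfl) (h1.2 rfl))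
  rw [this]

/-- No two consecutive elements. -/
def NC (S : Set ℤ) : Prop := ∀ z ∈ S, z + 1 ∉ S

open Classical in
noncomputable def Bf (S : Set ℤ) (q : Pos) : Pos :=
  if q.1 ∈ S then
    match q.2 with
    | none => q
    | some u => (q.1, some (false :: u))
  else if q.1 - 1 ∈ S then
    match q.2 with
    | none => (q.1 - 1, some [])
    | some [] => (q.1, none)
    | some (false :: u) => (q.1 - 1, some (true :: u))
    | some (true :: u) => (q.1, some u)
  else q

open Classical in
noncomputable def Bg (S : Set ℤ) (q : Pos) : Pos :=
  if q.1 ∈ S then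
    match q.2 with
    | none => q
    | some [] => (q.1 + 1, none)
    | some (false :: u) => (q.1, some u)
    | some (true :: u) => (q.1 + 1, some (false :: u))
  else if q.1 - 1 ∈ S then
    match q.2 with
    | none => (q.1, some [])
    | some u => (q.1, some (true :: u))
  else q

open Classical in
noncomputable def B (S : Set ℤ) : Equiv.Perm Pos :=
  if h : NC S then
    { toFun := Bf S
      invFun := Bg S
      left_inv := by
        rintro ⟨z, c⟩
        by_cases h1 : z ∈ S
        · rcases c with _ | u <;> simp [Bf, Bg, h1]
        · by_cases h2 : z - 1 ∈ S
          · rcases c with _ | _ | ⟨_ | _, u⟩ <;> simp [Bf, Bg, h1, h2]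
          · simp [Bf, Bg, h1, h2]
      right_inv := by
        rintro ⟨z, c⟩
        by_cases h1 : z ∈ S
        · have h3 := h z h1
          rcases c with _ | _ | ⟨_ | _, u⟩ <;> simp [Bf, Bg, h1, h3]
        · by_cases h2 : z - 1 ∈ S
          · rcases c with _ | _ | ⟨_ | _, u⟩ <;> simp [Bf, Bg, h1, h2]
          · simp [Bf, Bg, h1, h2] }
  else 1

section
variable {S : Set ℤ} (hS : NC S)
include hS

lemma B_apply (q : Pos) : B S q = Bf S q := by simp [B, hS]
lemma Bi_apply (q : Pos) : (B S)⁻¹ q = Bg S q := by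
  simp only [B, hS, dif_pos]; rfl

variable {z : ℤ} (hz : z ∈ S)
include hz
lemma B_none : B S (z, none) = (z, none) := by simp [B_apply hS, Bf, hz]
lemma B_some (u) : B S (z, some u) = (z, some (false :: u)) := by simp [B_apply hS, Bf, hz]
lemma B_none1 : B S (z + 1, none) = (z, some []) := by
  have := hS z hz
  simp [B_apply hS, Bf, hz, this]
lemma B_nil1 : B S (z + 1, some []) = (z + 1, none) := by
  have := hS z hz
  simp [B_apply hS, Bf, hz, this]
lemma B_false1 (u) : B S (z + 1, some (false :: u)) = (z, some (true :: u)) := by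
  have := hS z hz
  simp [B_apply hS, Bf, hz, this]
lemma B_true1 (u) : B S (z + 1, some (true :: u)) = (z + 1, some u) := by
  have := hS z hz
  simp [B_apply hS, Bf, hz, this]

lemma Bi_none : (B S)⁻¹ (z, none) = (z, none) := by simp [Bi_apply hS, Bg, hz]
lemma Bi_nil : (B S)⁻¹ (z, some []) = (z + 1, none) := by simp [Bi_apply hS, Bg, hz]
lemma Bi_false (u) : (B S)⁻¹ (z, some (false :: u)) = (z, some u) := by simp [Bi_apply hS, Bg, hz]
lemma Bi_true (u) : (B S)⁻¹ (z, some (true :: u)) = (z + 1, some (false :: u)) := by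
  simp [Bi_apply hS, Bg, hz]
lemma Bi_none1 : (B S)⁻¹ (z + 1, none) = (z + 1, some []) := by
  have := hS z hz
  simp [Bi_apply hS, Bg, hz, this]
lemma Bi_some1 (u) : (B S)⁻¹ (z + 1, some u) = (z + 1, some (true :: u)) := by
  have := hS z hz
  simp [Bi_apply hS, Bg, hz, this]
end

lemma B_fix {S : Set ℤ} (hS : NC S) {z : ℤ} (h1 : z ∉ S) (h2 : z - 1 ∉ S) (c) :
    B S (z, c) = (z, c) := by simp [B_apply hS, Bf, h1, h2]
lemma Bi_fix {S : Set ℤ} (hS : NC S) {z : ℤ} (h1 : z ∉ S) (h2 : z - 1 ∉ S) (c) :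
    (B S)⁻¹ (z, c) = (z, c) := by simp [Bi_apply hS, Bg, h1, h2]

open Classical in
lemma pval_B {S : Set ℤ} (hS : NC S) (z : ℤ) (c) : pval (B S (z, c)) =
    if z ∈ S then z + fr c / 2 else if z - 1 ∈ S then
      (if fr c ≤ 1/2 then z - 1/2 + fr c else z + 2 * fr c - 1) else z + fr c := by
  rw [B_apply hS]
  by_cases h1 : z ∈ S
  · rcases c with _ | u <;> simp [Bf, h1, pval, fr, dy]
  · by_cases h2 : z - 1 ∈ S
    · rcases c with _ | _ | ⟨_ | _, u⟩ <;> simp only [Bf, h1, h2, pval, fr, dy] <;> norm_num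
      · simp only [dy]; ring
      · have := dy_lt u
        rw [if_pos (by linarith)]; simp only [dy]; ring
      · have := dy_pos u
        rw [if_neg (by linarith)]; ring
    · simp [Bf, h1, h2, pval]

lemma B_mono {S : Set ℤ} (hS : NC S) {q q' : Pos} (h : pval q < pval q') :
    pval (B S q) < pval (B S q') := by
  obtain ⟨z, c⟩ := q
  obtain ⟨z', c'⟩ := q'
  rw [pval_lt] at h
  simp only at h
  rw [pval_B hS, pval_B hS]
  have h1 := fr_nonneg c
  have h2 := fr_nonneg c'
  have h3 := fr_lt c
  have h4 := fr_lt c'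
  rcases h with h | ⟨h, h'⟩
  · by_cases h5 : z' = z + 1
    · subst h5
      by_cases h6 : z ∈ S
      · have := hS z h6
        simp only [h6, this, if_true, if_false, add_sub_cancel_right]
        push_cast
        split_ifs <;> linarith
      · simp only [h6, if_false, add_sub_cancel_right]
        push_cast
        split_ifs <;> linarith
    · have : (z : ℚ) + 2 ≤ z' := by
        have : z + 2 ≤ z' := by omega
        exact_mod_cast this
      split_ifs <;> linarith
  · subst h
    split_ifs <;> linarith

end LO

namespace LO

@[ext] structure Om (K : Type) where
  q : Pos
  l : List (K × List Bool)

section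
variable {K : Type} [Group K] [LinearOrder K]

abbrev Letter (K : Type) := ℕ ×ₗ (K ×ₗ ℚ)

def cls8 (κ : K) : ℕ := if 1 < κ then 0 else if κ = 1 then 1 else 3

def ent (e : K × List Bool) : Letter K := toLex (cls8 e.1, toLex (e.1, dy e.2))

lemma ent_inj : Function.Injective (ent (K := K)) := by
  rintro ⟨κ, u⟩ ⟨κ', u'⟩ h
  simp only [ent, EmbeddingLike.apply_eq_iff_eq, Prod.mk.injEq] at h
  rw [h.2.1, dy_inj _ _ h.2.2]

def endL : Letter K := toLex (2, toLex (1, 0))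

def keyl (l : List (K × List Bool)) : List (Letter K) := l.map ent ++ [endL]

lemma keyl_inj : Function.Injective (keyl (K := K)) := by
  intro l l' h
  simp only [keyl, List.append_cancel_right_eq] at h
  exact List.map_injective_iff.2 ent_inj h

def key1 (p : Om K) : ℚ ×ₗ List (Letter K) := toLex (pval p.q, keyl p.l)

lemma key1_inj : Function.Injective (key1 (K := K)) := by
  rintro ⟨q, l⟩ ⟨q', l'⟩ h
  simp only [key1, EmbeddingLike.apply_eq_iff_eq, Prod.mk.injEq] at h
  rw [pval_inj h.1, keyl_inj h.2]

noncomputable instance : LinearOrder (Om K) := LinearOrder.lift' key1 key1_inj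

lemma om_lt {p p' : Om K} : p < p' ↔ pval p.q < pval p'.q ∨ (p.q = p'.q ∧ keyl p.l < keyl p'.l) := by
  change key1 p < key1 p' ↔ _
  simp only [key1, Prod.Lex.toLex_lt_toLex]
  constructor
  · rintro (h | ⟨h, h'⟩)
    · exact Or.inl h
    · exact Or.inr ⟨pval_inj h, h'⟩
  · rintro (h | ⟨h, h'⟩)
    · exact Or.inl h
    · exact Or.inr ⟨by rw [h], h'⟩

lemma keyl_cons_lt {e e' : K × List Bool} {l l'} : keyl (e :: l) < keyl (e' :: l') ↔
    ent e < ent e' ∨ (e = e' ∧ keyl l < keyl l') := by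
  simp only [keyl, List.map_cons, List.cons_append, List.cons_lt_cons_iff]
  constructor
  · rintro (h | ⟨h, h'⟩)
    · exact Or.inl h
    · exact Or.inr ⟨ent_inj h, h'⟩
  · rintro (h | ⟨h, h'⟩)
    · exact Or.inl h
    · exact Or.inr ⟨by rw [h], h'⟩

lemma keyl_nil_lt {e' : K × List Bool} {l'} : keyl [] < keyl (e' :: l') ↔ e'.1 < 1 := by
  simp only [keyl, List.map_cons, List.cons_append, List.map_nil, List.nil_append,
    List.cons_lt_cons_iff, ent, endL, Prod.Lex.toLex_lt_toLex, cls8]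
  split_ifs with h1 h2
  · simp [h1.le, h1.not_gt]
  · simp [h2]
  · have : e'.1 < 1 := lt_of_le_of_ne (not_lt.1 h1) h2
    simp [this]

lemma keyl_lt_nil {e' : K × List Bool} {l'} : keyl (e' :: l') < keyl [] ↔ 1 ≤ e'.1 := by
  simp only [keyl, List.map_cons, List.cons_append, List.map_nil, List.nil_append,
    List.cons_lt_cons_iff, ent, endL, Prod.Lex.toLex_lt_toLex, cls8]
  split_ifs with h1 h2
  · simp [h1.le, h1.not_gt]
  · simp [h2]
  · have : e'.1 < 1 := lt_of_le_of_ne (not_lt.1 h1) h2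
    simp [this]

lemma ent_lt {κ κ' : K} {u u'} : ent (κ, u) < ent (κ', u') ↔
    cls8 κ < cls8 κ' ∨ (cls8 κ = cls8 κ' ∧ (κ < κ' ∨ (κ = κ' ∧ dy u < dy u'))) := by
  simp only [ent, Prod.Lex.toLex_lt_toLex]

/-- Placement of the point of block `z` with coordinate `κ`, node `u` and tail `l`. -/
def place (z : ℤ) (κ : K) (u : List Bool) (l : List (K × List Bool)) : Om K :=
  if κ = 1 then ⟨(z, some u), l⟩ else if κ < 1 then ⟨(z, none), (κ, u) :: l⟩
  else ⟨(z + 1, none), (κ, u) :: l⟩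

lemma place_one (z : ℤ) (u l) : place z (1 : K) u l = ⟨(z, some u), l⟩ := by simp [place]
lemma place_lt {z : ℤ} {κ : K} (h : κ < 1) (u l) : place z κ u l = ⟨(z, none), (κ, u) :: l⟩ := by
  simp [place, h.ne, h]
lemma place_gt {z : ℤ} {κ : K} (h : 1 < κ) (u l) : place z κ u l = ⟨(z + 1, none), (κ, u) :: l⟩ := by
  simp [place, h.ne', h.not_gt]

def unplace : Om K → Option (ℤ × K × List Bool × List (K × List Bool))
  | ⟨(z, some u), l⟩ => some (z, 1, u, l)
  | ⟨(_, none), []⟩ => none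
  | ⟨(z, none), (κ, u) :: l⟩ => if κ = 1 then none else if κ < 1 then some (z, κ, u, l)
      else some (z - 1, κ, u, l)

lemma unplace_place (z : ℤ) (κ : K) (u l) : unplace (place z κ u l) = some (z, κ, u, l) := by
  rcases lt_trichotomy κ 1 with h | h | h
  · rw [place_lt h]; simp [unplace, h, h.ne]
  · subst h; rw [place_one]; rfl
  · rw [place_gt h]; simp [unplace, h.not_gt, h.ne']

/-- Special lists at integer nodes. -/
def spec : List (K × List Bool) → Prop
  | [] => True
  | (κ, _) :: _ => κ = 1

lemma unplace_spec {z : ℤ} {l : List (K × List Bool)} (h : spec l) : unplace ⟨(z, none), l⟩ = none := by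
  rcases l with _ | ⟨⟨κ, u⟩, l⟩
  · rfl
  · simp only [spec] at h; simp [unplace, h]

lemma om_cases (p : Om K) : (∃ z κ u l, p = place z κ u l) ∨ (∃ z l, spec l ∧ p = ⟨(z, none), l⟩) := by
  rcases p with ⟨⟨z, _ | u⟩, l⟩
  · rcases l with _ | ⟨⟨κ, u⟩, l⟩
    · exact Or.inr ⟨z, [], trivial, rfl⟩
    · rcases lt_trichotomy κ 1 with h | h | h
      · left; exact ⟨z, κ, u, l, by rw [place_lt h]⟩
      · right; exact ⟨z, (κ, u) :: l, h, rfl⟩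
      · left; exact ⟨z - 1, κ, u, l, by rw [place_gt h]; simp⟩
  · left; exact ⟨z, 1, u, l, by rw [place_one]⟩

open Classical in
noncomputable def katf (S : Set ℤ) (k : K) (p : Om K) : Om K :=
  match unplace p with
  | none => p
  | some (z, κ, u, l) => if z ∈ S then place z (k * κ) u l else p

lemma katf_place {S : Set ℤ} {z : ℤ} (hz : z ∈ S) (k κ : K) (u l) :
    katf S k (place z κ u l) = place z (k * κ) u l := by
  simp [katf, unplace_place, hz]
lemma katf_place' {S : Set ℤ} {z : ℤ} (hz : z ∉ S) (k κ : K) (u l) :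
    katf S k (place z κ u l) = place z κ u l := by
  simp [katf, unplace_place, hz]
lemma katf_spec (S : Set ℤ) {z : ℤ} (k : K) {l} (h : spec l) :
    katf S k ⟨(z, none), l⟩ = ⟨(z, none), l⟩ := by
  simp [katf, unplace_spec h]

lemma katf_mul (S : Set ℤ) (k k' : K) (p : Om K) : katf S (k * k') p = katf S k (katf S k' p) := by
  rcases om_cases p with ⟨z, κ, u, l, rfl⟩ | ⟨z, l, h, rfl⟩
  · by_cases hz : z ∈ S
    · simp only [katf_place hz, mul_assoc]
    · simp only [katf_place' hz]
  · simp only [katf_spec S _ h]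

lemma katf_one (S : Set ℤ) (p : Om K) : katf S 1 p = p := by
  rcases om_cases p with ⟨z, κ, u, l, rfl⟩ | ⟨z, l, h, rfl⟩
  · by_cases hz : z ∈ S
    · simp only [katf_place hz, one_mul]
    · simp only [katf_place' hz]
  · simp only [katf_spec S _ h]

noncomputable def kat (S : Set ℤ) : K →* Equiv.Perm (Om K) :=
  MonoidHom.toHomPerm
    { toFun := fun k => (katf S k : Function.End (Om K))
      map_one' := funext (katf_one S)
      map_mul' := fun k k' => funext (katf_mul S k k') }

lemma kat_apply (S : Set ℤ) (k : K) (p : Om K) : kat S k p = katf S k p := rfl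

lemma kat_place {S : Set ℤ} {z : ℤ} (hz : z ∈ S) (k κ : K) (u l) :
    kat S k (place z κ u l) = place z (k * κ) u l := katf_place hz ..
lemma kat_place' {S : Set ℤ} {z : ℤ} (hz : z ∉ S) (k κ : K) (u l) :
    kat S k (place z κ u l) = place z κ u l := katf_place' hz ..
lemma kat_spec (S : Set ℤ) {z : ℤ} (k : K) {l} (h : spec l) :
    kat S k ⟨(z, none), l⟩ = ⟨(z, none), l⟩ := katf_spec S k h

def key2 (p : Om K) : ℤ ×ₗ ℕ ×ₗ K ×ₗ ℚ ×ₗ List (Letter K) :=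
  match unplace p with
  | none => toLex (p.q.1, toLex (0, toLex (1, toLex (0, keyl p.l))))
  | some (z, κ, u, l) => toLex (z, toLex (1, toLex (κ, toLex (dy u, keyl l))))

lemma key2_place (z κ u l) : key2 (place z κ u l : Om K) =
    toLex (z, toLex (1, toLex (κ, toLex (dy u, keyl l)))) := by
  simp [key2, unplace_place]
lemma key2_spec {z : ℤ} {l : List (K × List Bool)} (h : spec l) : key2 (⟨(z, none), l⟩ : Om K) =
    toLex (z, toLex (0, toLex (1, toLex (0, keyl l)))) := by
  simp [key2, unplace_spec h]

lemma keyl_spec_lt {l l' : List (K × List Bool)} {κ : K} {u} (h : spec l) (hκ : κ < 1) :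
    keyl l < keyl ((κ, u) :: l') := by
  rcases l with _ | ⟨⟨κ', u'⟩, l⟩
  · rw [keyl_nil_lt]; exact hκ
  · simp only [spec] at h; subst h
    rw [keyl_cons_lt, ent_lt]; left; left
    simp [cls8, hκ.not_gt, hκ.ne]

lemma keyl_lt_spec {l l' : List (K × List Bool)} {κ : K} {u} (h : spec l) (hκ : 1 < κ) :
    keyl ((κ, u) :: l') < keyl l := by
  rcases l with _ | ⟨⟨κ', u'⟩, l⟩
  · rw [keyl_lt_nil]; exact hκ.le
  · simp only [spec] at h; subst h
    rw [keyl_cons_lt, ent_lt]; left; left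
    simp [cls8, hκ]

lemma fr_none : fr none = 0 := rfl
lemma fr_some (u) : fr (some u) = dy u := rfl

lemma lt_of_key2 {p p' : Om K} (h : key2 p < key2 p') : p < p' := by
  rw [om_lt, pval_lt]
  rcases om_cases p with ⟨z, κ, u, l, rfl⟩ | ⟨z, l, hl, rfl⟩ <;>
  rcases om_cases p' with ⟨z', κ', u', l', rfl⟩ | ⟨z', l', hl', rfl⟩
  · rw [key2_place, key2_place] at h
    simp only [Prod.Lex.toLex_lt_toLex, lt_self_iff_false, false_or, true_and] at h
    have d1 := dy_pos u
    have d2 := dy_pos u'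
    rcases lt_trichotomy κ 1 with hk | hk | hk <;> rcases lt_trichotomy κ' 1 with hk' | hk' | hk' <;>
    (try subst hk) <;> (try subst hk') <;>
    simp only [place_lt, place_gt, place_one, *] <;> simp only [fr_none, fr_some, lt_self_iff_false,
      and_false, or_false, Prod.mk.injEq, and_true, keyl_cons_lt, ent_lt, add_left_inj, cls8]
    · rcases h with h | ⟨h, h2 | ⟨h2, h3 | ⟨h3, h4⟩⟩⟩
      · exact Or.inl h
      · simp [h, h2, hk.not_gt, hk'.not_gt, hk.ne, hk'.ne]
      · simp [h, h2, h3]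
      · have := dy_inj _ _ h3
        simp [h, h2, this, h4]
    · rcases h with h | ⟨h, h2 | ⟨h2, h3 | ⟨h3, h4⟩⟩⟩
      · simp [h]
      · simp [h, d2]
      · simp [h, d2]
      · simp [h, d2]
    · rcases h with h | ⟨h, _⟩
      · left; omega
      · left; omega
    · rcases h with h | ⟨h, h2 | ⟨h2, h3 | ⟨h3, h4⟩⟩⟩
      · simp [h]
      · exact absurd h2 hk'.not_gt
      · exact absurd h2 hk'.ne'
      · exact absurd h2 hk'.ne'
    · rcases h with h | ⟨h, h2 | ⟨h2, h3 | ⟨h3, h4⟩⟩⟩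
      · simp [h]
      · exact absurd h2 (lt_irrefl _)
      · simp [h, h3]
      · simp [h, dy_inj _ _ h3, h4]
    · rcases h with h | ⟨h, _⟩
      · left; left; omega
      · left; left; omega
    · rcases h with h | ⟨h, h2 | ⟨h2, h3 | ⟨h3, h4⟩⟩⟩
      · rcases (show z + 1 < z' ∨ z + 1 = z' by omega) with h5 | h5
        · simp [h5]
        · simp [h5, hk, hk'.not_gt, hk'.ne]
      · exact absurd (hk.trans h2) hk'.not_gt
      · rw [h2] at hk; exact absurd hk hk'.not_gt
      · rw [h2] at hk; exact absurd hk hk'.not_gt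
    · rcases h with h | ⟨h, h2 | ⟨h2, h3 | ⟨h3, h4⟩⟩⟩
      · rcases (show z + 1 < z' ∨ z + 1 = z' by omega) with h5 | h5
        · simp [h5]
        · simp [h5, d2]
      · exact absurd h2 hk.not_gt
      · exact absurd h2 hk.ne'
      · exact absurd h2 hk.ne'
    · rcases h with h | ⟨h, h2 | ⟨h2, h3 | ⟨h3, h4⟩⟩⟩
      · left; omega
      · simp [h, h2, hk, hk']
      · simp [h, h2, h3]
      · have := dy_inj _ _ h3
        simp [h, h2, this, h4]
  · rw [key2_place, key2_spec hl'] at h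
    simp only [Prod.Lex.toLex_lt_toLex] at h
    have hz : z < z' := by
      rcases h with h | ⟨h, h2 | ⟨h2, _⟩⟩
      · exact h
      · omega
      · omega
    rcases lt_trichotomy κ 1 with hk | hk | hk
    · rw [place_lt hk]; simp [hz]
    · subst hk; rw [place_one]; simp [hz]
    · rw [place_gt hk]
      rcases (show z + 1 < z' ∨ z + 1 = z' by omega) with h5 | h5
      · simp [h5]
      · simp [h5, keyl_lt_spec hl' hk]
  · rw [key2_place, key2_spec hl] at h
    simp only [Prod.Lex.toLex_lt_toLex] at h
    have hz : z < z' ∨ z = z' := by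
      rcases h with h | ⟨h, _⟩
      · exact Or.inl h
      · exact Or.inr h
    rcases lt_trichotomy κ' 1 with hk | hk | hk
    · rw [place_lt hk]
      rcases hz with hz | hz
      · simp [hz]
      · simp [hz, keyl_spec_lt hl hk]
    · subst hk; rw [place_one]
      rcases hz with hz | hz
      · simp [hz]
      · simp [hz, fr_none, fr_some, dy_pos]
    · rw [place_gt hk]
      left; left; simp only; omega
  · rw [key2_spec hl, key2_spec hl'] at h
    simp only [Prod.Lex.toLex_lt_toLex, lt_self_iff_false, false_or, true_and] at h
    rcases h with h | ⟨h, h2⟩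
    · simp [h]
    · simp [h, h2]

lemma key2_inj {p p' : Om K} (h : key2 p = key2 p') : p = p' := by
  rcases om_cases p with ⟨z, κ, u, l, rfl⟩ | ⟨z, l, hl, rfl⟩ <;>
  rcases om_cases p' with ⟨z', κ', u', l', rfl⟩ | ⟨z', l', hl', rfl⟩
  · rw [key2_place, key2_place] at h
    simp only [EmbeddingLike.apply_eq_iff_eq, Prod.mk.injEq, true_and] at h
    rw [h.1, h.2.1, dy_inj _ _ h.2.2.1, keyl_inj h.2.2.2]
  · rw [key2_place, key2_spec hl'] at h
    simp at h
  · rw [key2_place, key2_spec hl] at h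
    simp at h
  · rw [key2_spec hl, key2_spec hl'] at h
    simp only [EmbeddingLike.apply_eq_iff_eq, Prod.mk.injEq, true_and] at h
    rw [h.1, keyl_inj h.2]

lemma lt_iff_key2 {p p' : Om K} : p < p' ↔ key2 p < key2 p' := by
  refine ⟨fun h => ?_, lt_of_key2⟩
  rcases lt_trichotomy (key2 p) (key2 p') with h1 | h1 | h1
  · exact h1
  · rw [key2_inj h1] at h; exact absurd h (lt_irrefl _)
  · exact absurd (lt_of_key2 h1) h.not_gt

variable [MulLeftMono K]

lemma kat_mono (S : Set ℤ) (k : K) {p p' : Om K} (h : p < p') : kat S k p < kat S k p' := by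
  rw [lt_iff_key2] at h ⊢
  rcases om_cases p with ⟨z, κ, u, l, rfl⟩ | ⟨z, l, hl, rfl⟩ <;>
  rcases om_cases p' with ⟨z', κ', u', l', rfl⟩ | ⟨z', l', hl', rfl⟩
  · by_cases hz : z ∈ S <;> by_cases hz' : z' ∈ S <;>
    simp only [kat_place, kat_place', hz, hz', not_false_eq_true, key2_place,
      Prod.Lex.toLex_lt_toLex, mul_lt_mul_iff_left, mul_right_inj] at h ⊢
    · exact h
    · rcases h with h | ⟨h, _⟩
      · exact Or.inl h
      · subst h; exact absurd hz hz'
    · rcases h with h | ⟨h, _⟩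
      · exact Or.inl h
      · subst h; exact absurd hz' hz
    · exact h
  · by_cases hz : z ∈ S <;>
    simp only [kat_place, kat_place', kat_spec _ _ hl', hz, not_false_eq_true, key2_place, key2_spec hl',
      Prod.Lex.toLex_lt_toLex] at h ⊢
    · rcases h with h | ⟨h, h2 | ⟨h2, _⟩⟩
      · exact Or.inl h
      · omega
      · omega
    · exact h
  · by_cases hz : z' ∈ S <;>
    simp only [kat_place, kat_place', kat_spec _ _ hl, hz, not_false_eq_true, key2_place, key2_spec hl,
      Prod.Lex.toLex_lt_toLex] at h ⊢
    · rcases h with h | ⟨h, h2⟩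
      · exact Or.inl h
      · simp [h]
    · exact h
  · rw [kat_spec _ _ hl, kat_spec _ _ hl']; exact h

/-- The lift of a permutation of positions. -/
def liftP : Equiv.Perm Pos →* Equiv.Perm (Om K) where
  toFun σ :=
    { toFun := fun p => ⟨σ p.q, p.l⟩
      invFun := fun p => ⟨σ⁻¹ p.q, p.l⟩
      left_inv := fun p => by simp
      right_inv := fun p => by simp }
  map_one' := rfl
  map_mul' _ _ := rfl

omit [MulLeftMono K] in
lemma liftP_apply (σ : Equiv.Perm Pos) (p : Om K) : liftP σ p = ⟨σ p.q, p.l⟩ := rfl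

omit [MulLeftMono K] in
lemma liftB_mono {S : Set ℤ} (hS : NC S) {p p' : Om K} (h : p < p') :
    liftP (B S) p < liftP (B S) p' := by
  rw [om_lt] at h ⊢
  simp only [liftP_apply]
  rcases h with h | ⟨h, h'⟩
  · exact Or.inl (B_mono hS h)
  · exact Or.inr ⟨by rw [h], h'⟩
end
end LO

namespace LO

/-! ### Local permutations -/

def c1f (b : Bool) (f : List Bool → List Bool) : List Bool → List Bool
  | [] => []
  | b' :: w => if b' = b then b' :: f w else b' :: w

lemma c1f_c1f (b : Bool) (f g : List Bool → List Bool) (w) :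
    c1f b f (c1f b g w) = c1f b (f ∘ g) w := by
  rcases w with _ | ⟨b', w⟩
  · rfl
  · by_cases h : b' = b <;> simp [c1f, h]

lemma c1f_id (b : Bool) (w) : c1f b id w = w := by
  rcases w with _ | ⟨b', w⟩
  · rfl
  · by_cases h : b' = b <;> simp [c1f, h]

def cone1 (b : Bool) : Equiv.Perm (List Bool) →* Equiv.Perm (List Bool) where
  toFun f :=
    { toFun := c1f b f
      invFun := c1f b (f⁻¹ : Equiv.Perm _)
      left_inv := fun w => by
        rw [c1f_c1f, ← Equiv.Perm.coe_mul, inv_mul_cancel]; exact c1f_id b w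
      right_inv := fun w => by
        rw [c1f_c1f, ← Equiv.Perm.coe_mul, mul_inv_cancel]; exact c1f_id b w }
  map_one' := Equiv.ext (c1f_id b)
  map_mul' f g := Equiv.ext fun w => (c1f_c1f b f g w).symm

lemma cone1_apply (b f w) : cone1 b f w = c1f b f w := rfl

def cone : List Bool → Equiv.Perm (List Bool) →* Equiv.Perm (List Bool)
  | [] => MonoidHom.id _
  | b :: v => (cone1 b).comp (cone v)

lemma cone_append (v : List Bool) (f u) : cone v f (v ++ u) = v ++ f u := by
  induction v with
  | nil => rfl
  | cons b v ih => simp [cone, cone1_apply, c1f, ih]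

lemma cone_fix (v : List Bool) (f) : ∀ w, (∀ u, w ≠ v ++ u) → cone v f w = w := by
  induction v with
  | nil => intro w h; exact absurd rfl (h w)
  | cons b v ih =>
    intro w h
    rcases w with _ | ⟨b', w⟩
    · rfl
    · by_cases hb : b' = b
      · subst hb
        simp only [cone, MonoidHom.comp_apply, cone1_apply, c1f, if_true]
        rw [ih w]
        intro u hu
        exact h u (by simp [hu])
      · simp [cone, cone1_apply, c1f, hb]

def Xp : Equiv.Perm (List Bool) where
  toFun
    | [] => [false]
    | false :: u => false :: false :: u
    | [true] => []
    | true :: false :: u => false :: true :: u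
    | true :: true :: u => true :: u
  invFun
    | [] => [true]
    | [false] => []
    | false :: false :: u => false :: u
    | false :: true :: u => true :: false :: u
    | true :: u => true :: true :: u
  left_inv := by rintro (_ | ⟨_ | _, _ | ⟨_ | _, u⟩⟩) <;> rfl
  right_inv := by rintro (_ | ⟨_ | _, _ | ⟨_ | _, u⟩⟩) <;> rfl

/-- `a` is `X` in the cone `1`. -/
def Ap : Equiv.Perm (List Bool) := cone [true] Xp

def Bp : Equiv.Perm (List Bool) := Ap * Xp⁻¹ * Ap⁻¹

lemma comm_AB : Ap * Bp * Ap⁻¹ * Bp⁻¹ = cone [true, false] Xp := by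
  have : Ap * (Ap * Xp⁻¹) = cone [true, false] Xp * (Ap * Xp⁻¹ * Ap) := by
    ext1 w
    rcases w with _ | ⟨_ | _, _ | ⟨_ | _, _ | ⟨_ | _, _ | ⟨_ | _, u⟩⟩⟩⟩ <;> rfl
  have e : Ap * Bp * Ap⁻¹ * Bp⁻¹ = (Ap * (Ap * Xp⁻¹)) * (Ap⁻¹ * Xp * Ap⁻¹) := by
    rw [Bp]; group
  rw [e, this]; group

open Classical in
noncomputable def locf (S : Set ℤ) (f : List Bool → List Bool) (q : Pos) : Pos :=
  if q.1 ∈ S then (q.1, q.2.map f) else q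

noncomputable def loc (S : Set ℤ) : Equiv.Perm (List Bool) →* Equiv.Perm Pos where
  toFun f :=
    { toFun := locf S f
      invFun := locf S (f⁻¹ : Equiv.Perm _)
      left_inv := by
        rintro ⟨z, _ | u⟩ <;> by_cases h : z ∈ S <;> simp [locf, h]
      right_inv := by
        rintro ⟨z, _ | u⟩ <;> by_cases h : z ∈ S <;> simp [locf, h] }
  map_one' := Equiv.ext <| by
    rintro ⟨z, _ | u⟩ <;> by_cases h : z ∈ S <;> simp [locf, h]
  map_mul' f g := Equiv.ext <| by
    rintro ⟨z, _ | u⟩ <;> by_cases h : z ∈ S <;> simp [locf, h]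

lemma loc_none (S f z) : loc S f (z, none) = (z, none) := by
  change locf S f (z, none) = _
  simp [locf]
lemma loc_some {S : Set ℤ} {z} (h : z ∈ S) (f u) : loc S f (z, some u) = (z, some (f u)) := by
  change locf S f _ = _
  simp [locf, h]
lemma loc_fix {S : Set ℤ} {z} (h : z ∉ S) (f c) : loc S f (z, c) = (z, c) := by
  change locf S f _ = _
  simp [locf, h]

lemma loc_inter (S S' : Set ℤ) (f f' : Equiv.Perm (List Bool)) :
    loc S f * loc S' f' * (loc S f)⁻¹ * (loc S' f')⁻¹ = loc (S ∩ S') (f * f' * f⁻¹ * f'⁻¹) := by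
  rw [← map_inv, ← map_inv]
  ext1 ⟨z, c⟩
  simp only [Equiv.Perm.mul_apply]
  rcases c with _ | u
  · simp only [loc_none]
  · by_cases h : z ∈ S <;> by_cases h' : z ∈ S'
    · have hi : z ∈ S ∩ S' := ⟨h, h'⟩
      simp only [loc_some h, loc_some h', loc_some hi, Equiv.Perm.mul_apply]
    · have hi : z ∉ S ∩ S' := fun hi => h' hi.2
      simp only [loc_some h, loc_fix h', loc_fix hi]; simp
    · have hi : z ∉ S ∩ S' := fun hi => h hi.1
      simp only [loc_fix h, loc_some h', loc_fix hi]; simp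
    · have hi : z ∉ S ∩ S' := fun hi => h hi.1
      simp only [loc_fix h, loc_fix h', loc_fix hi]

lemma loc_union {S S' : Set ℤ} (h : ∀ z ∈ S, z ∉ S') (f) :
    loc (S ∪ S') f = loc S f * loc S' f := by
  ext1 ⟨z, c⟩
  simp only [Equiv.Perm.mul_apply]
  rcases c with _ | u
  · simp only [loc_none]
  · by_cases h1 : z ∈ S
    · have := h z h1
      simp [loc_some, loc_fix, h1, this]
    · by_cases h2 : z ∈ S' <;> simp [loc_some, loc_fix, h1, h2]

def shift (S : Set ℤ) (d : ℤ) : Set ℤ := {z | z - d ∈ S}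
lemma mem_shift {S : Set ℤ} {d z} : z ∈ shift S d ↔ z - d ∈ S := Iff.rfl

/-- conjugation of local permutations -/
lemma loc_conj (σ : Equiv.Perm Pos) (S : Set ℤ) (d : ℤ) (v v' : List Bool)
    (h : ∀ z ∈ S, ∀ u, σ (z, some (v ++ u)) = (z + d, some (v' ++ u))) (f) :
    σ * loc S (cone v f) * σ⁻¹ = loc (shift S d) (cone v' f) := by
  rw [mul_inv_eq_iff_eq_mul]
  ext1 ⟨z, c⟩
  simp only [Equiv.Perm.mul_apply]
  by_cases hp : z ∈ S ∧ ∃ u, c = some (v ++ u)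
  · obtain ⟨hz, u, rfl⟩ := hp
    have h2 : z + d ∈ shift S d := by simpa [mem_shift] using hz
    rw [loc_some hz, cone_append, h z hz, h z hz, loc_some h2, cone_append]
  · have e1 : loc S (cone v f) (z, c) = (z, c) := by
      by_cases hz : z ∈ S
      · rcases c with _ | w
        · rw [loc_none]
        · rw [loc_some hz, cone_fix]
          intro u hu
          exact hp ⟨hz, u, by rw [hu]⟩
      · rw [loc_fix hz]
    rw [e1]
    obtain ⟨z', c', hq⟩ : ∃ z' c', σ (z, c) = (z', c') := ⟨_, _, rfl⟩
    rw [hq]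
    by_cases hz : z' ∈ shift S d
    · rcases c' with _ | w
      · rw [loc_none]
      · rw [loc_some hz, cone_fix]
        intro u hu
        have h3 := h (z' - d) hz u
        rw [sub_add_cancel, ← hu, ← hq] at h3
        have := σ.injective h3
        simp only [Prod.mk.injEq] at this
        exact hp ⟨by rw [← this.1]; exact hz, u, this.2.symm⟩
    · rw [loc_fix hz]

/-- residue classes modulo eight -/
def cls (r : ℤ) : Set ℤ := {z | (z - r) % 8 = 0}
lemma mem_cls {r z} : z ∈ cls r ↔ (z - r) % 8 = 0 := Iff.rfl

lemma nc_cls {S : Set ℤ} {r : ℤ} (h : S ⊆ cls r) : NC S := by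
  intro z hz hz'
  have h1 := h hz
  have h2 := h hz'
  rw [mem_cls] at h1 h2
  omega

/-- `X` localized is conjugate to `B`. -/
lemma B_conj {S : Set ℤ} {r : ℤ} (h : S ⊆ cls r) :
    B (cls (r - 1)) * B (cls r) * loc (shift S 1) Xp = B S * (B (cls (r - 1)) * B (cls r)) := by
  have n0 : NC S := nc_cls h
  have n1 : NC (cls r) := nc_cls le_rfl
  have n2 : NC (cls (r - 1)) := nc_cls le_rfl
  have hS : ∀ y, (y - r) % 8 ≠ 0 → y ∉ S := fun y hy hy' => hy (h hy')
  ext1 ⟨y, c⟩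
  simp only [Equiv.Perm.mul_apply]
  by_cases h1 : y - 1 ∈ S
  · obtain ⟨z, rfl⟩ : ∃ z, y = z + 1 := ⟨y - 1, by ring⟩
    have hz : z ∈ S := by simpa using h1
    have hzr : z ∈ cls r := h hz
    have hm := mem_cls.1 hzr
    have hsh : z + 1 ∈ shift S 1 := by simpa [mem_shift] using hz
    have m1 : z + 1 ∉ cls (r - 1) := by rw [mem_cls]; omega
    have m2 : z + 1 - 1 ∉ cls (r - 1) := by rw [mem_cls]; omega
    have m3 : z - 1 ∈ cls (r - 1) := by rw [mem_cls]; omega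
    have key : ∀ c, B (cls (r - 1)) (z + 1, c) = (z + 1, c) := B_fix n2 m1 m2
    have key2 : ∀ u, B (cls (r - 1)) (z, some (true :: u)) = (z, some u) := by
      intro u
      have := B_true1 n2 m3 u
      rwa [sub_add_cancel] at this
    have key3 : B (cls (r - 1)) (z, some []) = (z, none) := by
      have := B_nil1 n2 m3
      rwa [sub_add_cancel] at this
    rcases c with _ | _ | ⟨_ | _, _ | ⟨_ | _, u⟩⟩ <;>
      simp [key3, B_none n0 hz, loc_none, loc_some hsh, Xp, B_none1 n1 hzr, B_nil1 n1 hzr, B_false1 n1 hzr,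
        B_true1 n1 hzr, key, key2, B_some n0 hz, B_nil1 n0 hz, B_false1 n0 hz, B_true1 n0 hz, B_none1 n0 hz]
  · have e1 : ∀ c, loc (shift S 1) Xp (y, c) = (y, c) := fun c => loc_fix (by simpa [mem_shift] using h1) _ _
    rw [e1]
    symm
    by_cases h2 : y ∈ cls r
    · have hm := mem_cls.1 h2
      have m3 : y - 1 ∈ cls (r - 1) := by rw [mem_cls]; omega
      have f0 : ∀ c, B S (y - 1, c) = (y - 1, c) :=
        B_fix n0 (hS _ (by omega)) (hS _ (by omega))
      rcases c with _ | u
      · rw [B_none n1 h2]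
        have := B_none1 n2 m3
        rw [sub_add_cancel] at this
        rw [this, f0]
      · rw [B_some n1 h2]
        have := B_false1 n2 m3 u
        rw [sub_add_cancel] at this
        rw [this, f0]
    · by_cases h3 : y - 1 ∈ cls r
      · obtain ⟨z, rfl⟩ : ∃ z, y = z + 1 := ⟨y - 1, by ring⟩
        rw [add_sub_cancel_right] at h1 h3
        have hm := mem_cls.1 h3
        have m1 : z + 1 ∉ cls (r - 1) := by rw [mem_cls]; omega
        have m2 : z + 1 - 1 ∉ cls (r - 1) := by rw [mem_cls]; omega
        have m3 : z - 1 ∈ cls (r - 1) := by rw [mem_cls]; omega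
        have key : ∀ c, B (cls (r - 1)) (z + 1, c) = (z + 1, c) := B_fix n2 m1 m2
        have key2 : ∀ u, B (cls (r - 1)) (z, some (true :: u)) = (z, some u) := by
          intro u
          have := B_true1 n2 m3 u
          rwa [sub_add_cancel] at this
        have key3 : B (cls (r - 1)) (z, some []) = (z, none) := by
          have := B_nil1 n2 m3
          rwa [sub_add_cancel] at this
        have f0 : ∀ c, B S (z, c) = (z, c) := B_fix n0 h1 (hS _ (by omega))
        have f1 : ∀ c, B S (z + 1, c) = (z + 1, c) := B_fix n0 (hS _ (by omega)) (by simpa using h1)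
        rcases c with _ | _ | ⟨_ | _, u⟩ <;>
          simp [B_none1 n1 h3, B_nil1 n1 h3, B_false1 n1 h3, B_true1 n1 h3, key, key2, key3, f0, f1]
      · rw [mem_cls] at h2 h3
        rw [B_fix n1 h2 h3]
        by_cases h4 : y ∈ cls (r - 1)
        · have hm := mem_cls.1 h4
          have f0 : ∀ c, B S (y, c) = (y, c) := B_fix n0 (hS _ (by omega)) (hS _ (by omega))
          rcases c with _ | u
          · rw [B_none n2 h4, f0]
          · rw [B_some n2 h4, f0]
        · have h5 := h4
          rw [mem_cls] at h4
          rw [B_fix n2 h5 (by rw [mem_cls]; omega), B_fix n0 (hS _ h2) (hS _ h3)]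

/-! ### The group of position permutations -/

noncomputable def vv (z : ℤ) : ℕ := multiplicity (8 : ℤ) (7 * z + 1)

lemma pow_dvd_vv {k : ℕ} {z : ℤ} : (8 : ℤ) ^ k ∣ 7 * z + 1 ↔ k ≤ vv z := by
  have : FiniteMultiplicity (8 : ℤ) (7 * z + 1) := by
    rw [Int.finiteMultiplicity_iff]
    constructor
    · decide
    · omega
  exact this.pow_dvd_iff_le_multiplicity

def Cj (j : ℕ) : Set ℤ := {z | j ≤ vv z ∧ 2 ∣ vv z - j}
def Ej (j : ℕ) : Set ℤ := {z | j ≤ vv z}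

lemma Ej_cls {j : ℕ} (hj : 2 ≤ j) : Ej j ⊆ cls 1 := by
  intro z hz
  have h1 : 1 ≤ vv z := le_trans (by omega) hz
  have := pow_dvd_vv.2 h1
  rw [mem_cls]
  omega

lemma Cj_Ej (j : ℕ) : Cj j ⊆ Ej j := fun _ h => h.1

lemma Ej_eq (j : ℕ) : Ej j = Cj j ∪ shift (Cj j) (-8 ^ j) := by
  ext z
  constructor
  · intro hz
    by_cases h : vv z = j
    · left; exact ⟨h.ge, by simp [h]⟩
    · right
      rw [mem_shift]
      have h1 : j + 1 ≤ vv z := by have : j ≤ vv z := hz; omega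
      have h2 := pow_dvd_vv.2 h1
      have e : vv (z - -8 ^ j) = j := by
        have e1 : (8 : ℤ) ^ j ∣ 7 * (z - -8 ^ j) + 1 := by
          rw [show 7 * (z - -8 ^ j) + 1 = (7 * z + 1) + 8 ^ j * 7 by ring]
          exact dvd_add (dvd_trans (pow_dvd_pow _ (by omega)) h2) (Dvd.intro _ rfl)
        have e2 : ¬ (8 : ℤ) ^ (j + 1) ∣ 7 * (z - -8 ^ j) + 1 := by
          rw [show 7 * (z - -8 ^ j) + 1 = (7 * z + 1) + 8 ^ j * 7 by ring]
          intro h3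
          have h4 := (dvd_add_right h2).1 h3
          rw [pow_succ] at h4
          have := (mul_dvd_mul_iff_left (pow_ne_zero j (by norm_num : (8 : ℤ) ≠ 0))).1 h4
          omega
        rw [pow_dvd_vv] at e1 e2
        omega
      exact ⟨e.ge, by rw [e]; simp⟩
  · rintro (h | h)
    · exact h.1
    · rw [mem_shift] at h
      have := pow_dvd_vv.2 h.1
      change j ≤ vv z
      rw [← pow_dvd_vv]
      rw [show 7 * (z - -8 ^ j) + 1 = (7 * z + 1) + 8 ^ j * 7 by ring] at this
      exact (dvd_add_left (Dvd.intro _ rfl)).1 this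

lemma Cj_succ (j : ℕ) : Cj (j + 1) = Ej j \ Cj j := by
  ext z
  simp only [Cj, Ej, Set.mem_ofPred_eq, Set.mem_sdiff]
  omega

def C1 : Set ℤ := Cj 2

def TT : Subgroup (Equiv.Perm Pos) :=
  Subgroup.closure ({σ | ∃ r, σ = B (cls r)} ∪ {B C1})

lemma B_cls_mem (r : ℤ) : B (cls r) ∈ TT := Subgroup.subset_closure (Or.inl ⟨r, rfl⟩)
lemma B_C1_mem : B C1 ∈ TT := Subgroup.subset_closure (Or.inr rfl)

/-- conjugate by an element of `TT` -/
def CT (σ ρ : Equiv.Perm Pos) : Prop := ∃ τ ∈ TT, τ * σ * τ⁻¹ = ρ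

lemma CT.symm {σ ρ} (h : CT σ ρ) : CT ρ σ := by
  obtain ⟨τ, h, rfl⟩ := h
  exact ⟨τ⁻¹, inv_mem h, by group⟩
lemma CT.trans {σ ρ ξ} (h : CT σ ρ) (h' : CT ρ ξ) : CT σ ξ := by
  obtain ⟨τ, h, rfl⟩ := h
  obtain ⟨τ', h', rfl⟩ := h'
  exact ⟨τ' * τ, mul_mem h' h, by group⟩
lemma CT.mem {σ ρ} (h : CT σ ρ) (hs : σ ∈ TT) : ρ ∈ TT := by
  obtain ⟨τ, h, rfl⟩ := h
  exact mul_mem (mul_mem h hs) (inv_mem h)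

lemma CT_B {S : Set ℤ} {r : ℤ} (h : S ⊆ cls r) : CT (loc (shift S 1) Xp) (B S) := by
  refine ⟨_, mul_mem (B_cls_mem (r - 1)) (B_cls_mem r), ?_⟩
  rw [B_conj h, mul_inv_cancel_right]

/-- translation by one on blocks of class `r` -/
noncomputable def gt (r : ℤ) : Equiv.Perm Pos := (B (cls (r + 1)))⁻¹ * (B (cls r))⁻¹ * (B (cls (r - 1)))⁻¹

lemma gt_mem (r) : gt r ∈ TT := mul_mem (mul_mem (inv_mem (B_cls_mem _)) (inv_mem (B_cls_mem _)))
  (inv_mem (B_cls_mem _))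

lemma gt_vals {r z : ℤ} (hz : z ∈ cls r) : (∀ c, gt r (z, c) = (z + 1, c)) ∧
    gt r (z + 1, none) = (z + 2, none) := by
  have n0 : NC (cls r) := nc_cls le_rfl
  have n1 : NC (cls (r + 1)) := nc_cls le_rfl
  have n2 : NC (cls (r - 1)) := nc_cls le_rfl
  have hm := mem_cls.1 hz
  have m1 : z - 1 ∈ cls (r - 1) := by rw [mem_cls]; omega
  have m2 : z + 1 ∈ cls (r + 1) := by rw [mem_cls]; omega
  have k1 := Bi_none1 n2 m1
  have k2 := Bi_some1 n2 m1
  rw [sub_add_cancel] at k1 k2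
  constructor
  · rintro (_ | u)
    · simp only [gt, Equiv.Perm.mul_apply]
      rw [k1, Bi_nil n0 hz, Bi_none n1 m2]
    · simp only [gt, Equiv.Perm.mul_apply]
      rw [k2, Bi_true n0 hz, Bi_false n1 m2]
  · simp only [gt, Equiv.Perm.mul_apply]
    rw [Bi_fix n2 (by rw [mem_cls]; omega) (by rw [mem_cls]; omega), Bi_none1 n0 hz, Bi_nil n1 m2]
    congr 1; ring

/-- translations -/
lemma exists_trans (r : ℤ) (n : ℕ) : ∃ τ ∈ TT, ∀ z ∈ cls r, (∀ c, τ (z, c) = (z + n, c)) ∧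
    τ (z + 1, none) = (z + n + 1, none) := by
  induction n with
  | zero => exact ⟨1, one_mem _, by simp⟩
  | succ n ih =>
    obtain ⟨τ, h1, h2⟩ := ih
    refine ⟨gt (r + n) * τ, mul_mem (gt_mem _) h1, fun z hz => ?_⟩
    have hz' : z + n ∈ cls (r + n) := by rw [mem_cls] at hz ⊢; omega
    obtain ⟨h3, h4⟩ := gt_vals hz'
    refine ⟨fun c => ?_, ?_⟩
    · rw [Equiv.Perm.mul_apply, (h2 z hz).1, h3]; congr 1; push_cast; ring
    · rw [Equiv.Perm.mul_apply, (h2 z hz).2, h4]; congr 1; push_cast; ring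

lemma shift_shift (S : Set ℤ) (d e : ℤ) : shift (shift S d) e = shift S (d + e) := by
  ext z; simp only [mem_shift]; rw [show z - e - d = z - (d + e) by ring]
lemma shift_zero (S : Set ℤ) : shift S 0 = S := by
  ext z; simp [mem_shift]

lemma shift_cls {S : Set ℤ} {r : ℤ} (h : S ⊆ cls r) (d : ℤ) : shift S d ⊆ cls (r + d) := by
  intro z hz
  have := h hz
  rw [mem_cls] at this ⊢
  omega

lemma CT_nat {S : Set ℤ} {r : ℤ} (h : S ⊆ cls r) (n : ℕ) (f) : CT (loc S f) (loc (shift S n) f) := by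
  obtain ⟨τ, h1, h2⟩ := exists_trans r n
  exact ⟨τ, h1, loc_conj τ S n [] [] (fun z hz u => (h2 z (h hz)).1 _) f⟩

lemma CT_shift {S : Set ℤ} {r : ℤ} (h : S ⊆ cls r) (d : ℤ) (f) : CT (loc S f) (loc (shift S d) f) := by
  rcases Int.eq_nat_or_neg d with ⟨n, rfl | rfl⟩
  · exact CT_nat h n f
  · have := (CT_nat (shift_cls h (-n)) n f).symm
    rwa [shift_shift, neg_add_cancel, shift_zero] at this

lemma CT_cone {S : Set ℤ} (v : List Bool) (f) : ∀ {r : ℤ} (_ : S ⊆ cls r),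
    CT (loc S (cone v f)) (loc S f) := by
  induction v generalizing S with
  | nil => intro r h; exact ⟨1, one_mem _, by simp [cone]⟩
  | cons b v ih =>
    intro r h
    refine CT.trans ?_ (ih h)
    have n0 : NC (cls r) := nc_cls le_rfl
    have n1 : NC (cls (r + 1)) := nc_cls le_rfl
    rcases b with _ | _
    · refine ⟨_, inv_mem (B_cls_mem r), ?_⟩
      have := loc_conj (B (cls r))⁻¹ S 0 (false :: v) v (fun z hz u => by
        rw [List.cons_append, Bi_false n0 (h hz), add_zero]) f
      rwa [shift_zero] at this
    · refine CT.trans (ρ := loc (shift S 1) (cone v f)) ?_ ((CT_shift h 1 _).symm)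
      refine ⟨_, mul_mem (inv_mem (B_cls_mem (r + 1))) (inv_mem (B_cls_mem r)), ?_⟩
      exact loc_conj ((B (cls (r + 1)))⁻¹ * (B (cls r))⁻¹) S 1 (true :: v) v (fun z hz u => by
        have m : z + 1 ∈ cls (r + 1) := by
          have := h hz
          rw [mem_cls] at this ⊢; omega
        rw [List.cons_append, Equiv.Perm.mul_apply, Bi_true n0 (h hz), Bi_false n1 m]) f

/-- sets on which `X` is available -/
def XS (S : Set ℤ) : Prop := loc S Xp ∈ TT

lemma XS.A {S : Set ℤ} {r} (h : S ⊆ cls r) (hS : XS S) : loc S Ap ∈ TT :=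
  (CT_cone [true] Xp h).symm.mem hS
lemma XS.B {S : Set ℤ} {r} (h : S ⊆ cls r) (hS : XS S) : loc S Bp ∈ TT := by
  rw [Bp, map_mul, map_mul, map_inv, map_inv]
  exact mul_mem (mul_mem (hS.A h) (inv_mem hS)) (inv_mem (hS.A h))

lemma XS.inter {S S' : Set ℤ} {r} (h : S ⊆ cls r) (h' : S' ⊆ cls r) (hS : XS S) (hS' : XS S') :
    XS (S ∩ S') := by
  have : loc (S ∩ S') (cone [true, false] Xp) ∈ TT := by
    rw [← comm_AB, ← loc_inter]
    exact mul_mem (mul_mem (mul_mem (hS.A h) (hS'.B h')) (inv_mem (hS.A h))) (inv_mem (hS'.B h'))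
  exact (CT_cone _ _ (Set.inter_subset_left.trans h)).mem this

lemma XS.diff {S S' : Set ℤ} (hs : S' ⊆ S) (hS : XS S) (hS' : XS S') : XS (S \ S') := by
  have : loc S Xp = loc (S \ S') Xp * loc S' Xp := by
    rw [← loc_union (fun z hz => hz.2), Set.sdiff_union_of_subset hs]
  rw [XS, ← mul_inv_eq_iff_eq_mul.2 this]
  exact mul_mem hS (inv_mem hS')

lemma XS.union {S S' : Set ℤ} {r} (h : S ⊆ cls r) (h' : S' ⊆ cls r) (hS : XS S) (hS' : XS S') :
    XS (S ∪ S') := by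
  have h1 : XS (S' \ (S ∩ S')) := hS'.diff Set.inter_subset_right (hS.inter h h' hS')
  have e : S ∪ S' = S ∪ (S' \ (S ∩ S')) := by ext z; simp
  rw [XS, e, loc_union (fun z hz hz' => hz'.2 ⟨hz, hz'.1⟩)]
  exact mul_mem hS h1

lemma XS.shift {S : Set ℤ} {r} (h : S ⊆ cls r) (hS : XS S) (d : ℤ) : XS (shift S d) :=
  (CT_shift h d _).mem hS

lemma XS_Cj (j : ℕ) (hj : 2 ≤ j) : XS (Cj j) ∧ XS (Ej j) := by
  have main : ∀ j, 2 ≤ j → XS (Cj j) → XS (Ej j) := by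
    intro j hj h
    have h1 := (Cj_Ej j).trans (Ej_cls hj)
    have h2 := h.shift h1 (-8 ^ j)
    have h3 : LO.shift (Cj j) (-8 ^ j) ⊆ cls 1 := by
      refine Set.Subset.trans ?_ (Ej_cls hj)
      rw [Ej_eq]; exact Set.subset_union_right
    rw [Ej_eq]
    exact h.union h1 h3 h2
  induction j, hj using Nat.le_induction with
  | base =>
    have h0 : Cj 2 ⊆ cls 1 := (Cj_Ej 2).trans (Ej_cls le_rfl)
    have : XS (Cj 2) := by
      have h1 : XS (LO.shift (Cj 2) 1) := (CT_B h0).symm.mem B_C1_mem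
      have h2 := h1.shift (shift_cls h0 1) (-1)
      rwa [shift_shift, add_neg_cancel, shift_zero] at h2
    exact ⟨this, main 2 le_rfl this⟩
  | succ j hj ih =>
    have : XS (Cj (j + 1)) := by
      rw [Cj_succ]; exact ih.2.diff (Cj_Ej j) ih.1
    exact ⟨this, main _ (by omega) this⟩

/-- residue classes modulo powers of eight -/
def cl (k : ℕ) (z : ℤ) : Set ℤ := {y | (8 : ℤ) ^ k ∣ y - z}

def rep1 : ℕ → ℤ
  | 0 => 0
  | j + 1 => 8 * rep1 j + 1

lemma rep1_eq (j : ℕ) : 7 * rep1 j + 1 = 8 ^ j := by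
  induction j with
  | zero => rfl
  | succ j ih => rw [rep1, pow_succ, ← ih]; ring

lemma vv_rep1 (j : ℕ) : vv (rep1 j) = j := by
  have h1 : j ≤ vv (rep1 j) := by rw [← pow_dvd_vv, rep1_eq]
  have h2 : ¬ j + 1 ≤ vv (rep1 j) := by
    rw [← pow_dvd_vv, rep1_eq, pow_succ]
    intro h
    have h3 : (8 : ℤ) ^ j * 8 ∣ 8 ^ j * 1 := by simpa using h
    have := (mul_dvd_mul_iff_left (pow_ne_zero j (by norm_num : (8 : ℤ) ≠ 0))).1 h3
    omega
  omega

lemma Ej_cl (j : ℕ) : Ej j = cl j (rep1 j) := by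
  ext z
  change j ≤ vv z ↔ (8 : ℤ) ^ j ∣ z - rep1 j
  rw [← pow_dvd_vv]
  have : 7 * z + 1 = 7 * (z - rep1 j) + 8 ^ j := by rw [← rep1_eq]; ring
  rw [this, dvd_add_left dvd_rfl]
  have hc : IsCoprime ((8 : ℤ) ^ j) 7 := IsCoprime.pow_left ⟨1, -1, by norm_num⟩
  exact ⟨fun h => hc.dvd_of_dvd_mul_left h, fun h => Dvd.dvd.mul_left h 7⟩

lemma cl_cls {k : ℕ} (hk : 1 ≤ k) (z : ℤ) : cl k z ⊆ cls z := by
  intro y hy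
  have : (8 : ℤ) ^ 1 ∣ y - z := dvd_trans (pow_dvd_pow _ hk) hy
  rw [mem_cls]; omega

lemma shift_cl (k z d) : shift (cl k z) d = cl k (z + d) := by
  ext y
  change _ ∣ y - d - z ↔ _ ∣ y - (z + d)
  rw [show y - d - z = y - (z + d) by ring]

lemma XS_cl (k : ℕ) (hk : 2 ≤ k) (z : ℤ) : XS (cl k z) := by
  have h := (XS_Cj k hk).2
  rw [Ej_cl] at h
  have := h.shift (cl_cls (by omega) _) (z - rep1 k)
  rwa [shift_cl, add_sub_cancel] at this

end LO

namespace LO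

section
variable {K : Type} [Group K] [LinearOrder K]

/-- The generators coming from `K`. -/
noncomputable def cc (k : K) : Equiv.Perm (Om K) := kat (cls 0) k * (kat (cls 3) k)⁻¹

noncomputable def gens (k : Fin 3 → K) (i : Fin 12) : Equiv.Perm (Om K) :=
  if i.val < 8 then liftP (B (cls (i.val : ℤ))) else if i.val = 8 then liftP (B C1)
  else cc (k (Fin.ofNat 3 (i.val - 9)))

noncomputable def act (k : Fin 3 → K) (w : List (Fin 12 × Bool)) : Equiv.Perm (Om K) :=
  FreeGroup.lift (gens k) (FreeGroup.mk w)

def EK (k : Fin 3 → K) (w : List (Fin 3 × Bool)) : K := FreeGroup.lift k (FreeGroup.mk w)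

variable (k : Fin 3 → K)

lemma act_nil : act k [] = 1 := by simp [act, FreeGroup.lift_mk]
lemma act_cons (i b w) : act k ((i, b) :: w) = cond b (gens k i) (gens k i)⁻¹ * act k w := by
  simp [act, FreeGroup.lift_mk]
lemma act_append (w w') : act k (w ++ w') = act k w * act k w' := by
  simp [act, FreeGroup.lift_mk]
lemma act_inv (w) : act k (FreeGroup.invRev w) = (act k w)⁻¹ := by
  rw [act, act, ← map_inv, FreeGroup.inv_mk]

omit [LinearOrder K] in
lemma EK_nil : EK k [] = 1 := by simp [EK, FreeGroup.lift_mk]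
omit [LinearOrder K] in
lemma EK_cons (i b w) : EK k ((i, b) :: w) = cond b (k i) (k i)⁻¹ * EK k w := by
  simp [EK, FreeGroup.lift_mk]
omit [LinearOrder K] in
lemma EK_append (w w') : EK k (w ++ w') = EK k w * EK k w' := by
  simp [EK, FreeGroup.lift_mk]
omit [LinearOrder K] in
lemma EK_inv (w) : EK k (FreeGroup.invRev w) = (EK k w)⁻¹ := by
  rw [EK, EK, ← map_inv, FreeGroup.inv_mk]

noncomputable def HH : Subgroup (Equiv.Perm (Om K)) := (FreeGroup.lift (gens k)).range

lemma act_mem (w) : act k w ∈ HH k := ⟨_, rfl⟩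
lemma mem_HH {h} : h ∈ HH k ↔ ∃ w, act k w = h := by
  constructor
  · rintro ⟨x, rfl⟩
    exact ⟨x.toWord, by rw [act, FreeGroup.mk_toWord]⟩
  · rintro ⟨w, rfl⟩; exact act_mem k w

lemma HH_ind {P : Equiv.Perm (Om K) → Prop} (h1 : P 1) (hm : ∀ a b, P a → P b → P (a * b))
    (hi : ∀ a, P a → P a⁻¹) (hg : ∀ i, P (gens k i)) : ∀ h ∈ HH k, P h := by
  intro h hh
  obtain ⟨w, rfl⟩ := (mem_HH k).1 hh
  induction w with
  | nil => rw [act_nil]; exact h1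
  | cons a w ih =>
    obtain ⟨i, b⟩ := a
    rw [act_cons]
    refine hm _ _ ?_ (ih (act_mem k w))
    cases b
    · exact hi _ (hg i)
    · exact hg i

lemma cls_emod (r : ℤ) : cls r = cls ((r % 8).toNat : ℤ) := by
  ext z; simp only [mem_cls]; omega

lemma gens_B (r : ℤ) : gens k ⟨(r % 8).toNat, by omega⟩ = liftP (B (cls r)) := by
  rw [gens, if_pos (by simp only; omega), ← cls_emod]
lemma gens_C : gens k 8 = liftP (B C1) := by
  rw [gens, if_neg (by decide), if_pos (by decide)]
lemma gens_c (i : Fin 3) : gens k ⟨9 + i.val, by omega⟩ = cc (k i) := by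
  rw [gens, if_neg (by simp; omega), if_neg (by simp; omega)]
  congr 2
  ext
  simp

lemma gens_cases {P : Equiv.Perm (Om K) → Prop} (h1 : ∀ r, P (liftP (B (cls r))))
    (h2 : P (liftP (B C1))) (h3 : ∀ i, P (cc (k i))) (i) : P (gens k i) := by
  rw [gens]
  split_ifs
  · exact h1 _
  · exact h2
  · exact h3 _

lemma gens_mem (i) : gens k i ∈ HH k := ⟨FreeGroup.of i, by simp⟩

lemma TT_mem {σ} (h : σ ∈ TT) : liftP σ ∈ HH k := by
  induction h using Subgroup.closure_induction with
  | mem x hx =>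
    rcases hx with ⟨r, rfl⟩ | hx
    · rw [← gens_B]; exact gens_mem ..
    · rw [Set.mem_singleton_iff] at hx
      subst hx
      rw [← gens_C k]; exact gens_mem ..
  | one => rw [map_one]; exact one_mem _
  | mul x y _ _ hx hy => rw [map_mul]; exact mul_mem hx hy
  | inv x _ hx => rw [map_inv]; exact inv_mem hx

/-! ### Moves -/

def MV (n : ℕ) (q q' : Pos) : Prop := ∃ w, w.length ≤ n ∧ ∀ l, act k w ⟨q, l⟩ = ⟨q', l⟩

variable {k}
lemma MV.refl (n q) : MV k n q q := ⟨[], by simp, fun l => by rw [act_nil]; rfl⟩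
lemma MV.symm {n q q'} (h : MV k n q q') : MV k n q' q := by
  obtain ⟨w, h1, h2⟩ := h
  refine ⟨FreeGroup.invRev w, by simpa using h1, fun l => ?_⟩
  rw [act_inv, ← h2 l]; simp
lemma MV.trans {n m q q' q''} (h : MV k n q q') (h' : MV k m q' q'') : MV k (n + m) q q'' := by
  obtain ⟨w, h1, h2⟩ := h
  obtain ⟨w', h1', h2'⟩ := h'
  refine ⟨w' ++ w, by simp; omega, fun l => ?_⟩
  rw [act_append, Equiv.Perm.mul_apply, h2, h2']
lemma MV.mono {n m q q'} (h : MV k n q q') (hm : n ≤ m) : MV k m q q' := by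
  obtain ⟨w, h1, h2⟩ := h
  exact ⟨w, h1.trans hm, h2⟩

lemma MV.B (r : ℤ) (q) : MV k 1 q (B (cls r) q) :=
  ⟨[(⟨(r % 8).toNat, by omega⟩, true)], by simp, fun l => by
    rw [act_cons, act_nil, mul_one]
    simp only [cond_true]
    rw [gens_B, liftP_apply]⟩
lemma MV.Bi (r : ℤ) (q) : MV k 1 q ((LO.B (cls r))⁻¹ q) := by
  have := (MV.B (k := k) r ((LO.B (cls r))⁻¹ q)).symm
  rwa [← Equiv.Perm.mul_apply, mul_inv_cancel, Equiv.Perm.one_apply] at this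

lemma mem_cls_self (z : ℤ) : z ∈ cls z := by rw [mem_cls]; simp

lemma MV.succ (z : ℤ) (c) : MV k 3 (z, c) (z + 1, c) := by
  have := (gt_vals (mem_cls_self z)).1 c
  rw [← this]
  simp only [gt, Equiv.Perm.mul_apply]
  exact ((MV.Bi _ _).trans (MV.Bi _ _)).trans (MV.Bi _ _)

lemma MV.add (z : ℤ) (c) (n : ℕ) : MV k (3 * n) (z, c) (z + n, c) := by
  induction n with
  | zero => simpa using MV.refl _ _
  | succ n ih =>
    have := ih.trans (MV.succ _ _)
    push_cast
    rwa [← add_assoc]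

lemma MV.int (z z' : ℤ) (c) : MV k (3 * (z' - z).natAbs) (z, c) (z', c) := by
  rcases le_total z z' with h | h
  · have := MV.add (k := k) z c (z' - z).natAbs
    rwa [show z + ((z' - z).natAbs : ℤ) = z' by omega] at this
  · have := (MV.add (k := k) z' c (z' - z).natAbs).symm
    rwa [show z' + ((z' - z).natAbs : ℤ) = z by omega] at this

lemma MV.node (u : List Bool) : ∀ z : ℤ, MV k (5 * u.length + 4) (z, some u) (z, none) := by
  induction u with
  | nil =>
    intro z
    have h1 := MV.Bi (k := k) z (z, some [])
    rw [Bi_nil (nc_cls le_rfl) (mem_cls_self z)] at h1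
    exact (h1.trans (MV.succ z none).symm).mono (by simp)
  | cons b u ih =>
    intro z
    have n0 : NC (cls z) := nc_cls le_rfl
    have n1 : NC (cls (z + 1)) := nc_cls le_rfl
    cases b
    · have h1 := MV.Bi (k := k) z (z, some (false :: u))
      rw [Bi_false n0 (mem_cls_self z)] at h1
      exact (h1.trans (ih z)).mono (by simp; omega)
    · have h1 := MV.Bi (k := k) z (z, some (true :: u))
      rw [Bi_true n0 (mem_cls_self z)] at h1
      have h2 := MV.Bi (k := k) (z + 1) (z + 1, some (false :: u))
      rw [Bi_false n1 (mem_cls_self _)] at h2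
      exact (((h1.trans h2).trans (ih _)).trans (MV.succ z none).symm).mono (by simp; omega)

def sz : Option (List Bool) → ℕ
  | none => 0
  | some u => 5 * u.length + 4

lemma MV.pos (z z' : ℤ) (c) : MV k (3 * (z' - z).natAbs + sz c) (z, none) (z', c) := by
  refine (MV.int z z' none).trans ?_
  cases c
  · exact MV.refl _ _
  · exact (MV.node _ _).symm

variable (k) in
lemma act_cword (v : List (Fin 3 × Bool)) (κ : K) (u l) :
    act k (v.map fun e => (⟨9 + e.1.val, by omega⟩, e.2)) (place 0 κ u l) =
      place 0 (EK k v * κ) u l := by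
  have h0 : (0 : ℤ) ∈ cls 0 := by rw [mem_cls]; simp
  have h3 : (0 : ℤ) ∉ cls 3 := by rw [mem_cls]; decide
  induction v with
  | nil => simp [act_nil, EK_nil]
  | cons a v ih =>
    obtain ⟨i, b⟩ := a
    rw [List.map_cons, act_cons, Equiv.Perm.mul_apply, ih, EK_cons, gens_c]
    cases b
    · simp only [cond_false, cc, mul_inv_rev, inv_inv, Equiv.Perm.mul_apply]
      rw [← map_inv, kat_place h0, kat_place' h3, mul_assoc]
    · simp only [cond_true, cc, Equiv.Perm.mul_apply]
      rw [← map_inv, kat_place' h3, kat_place h0, mul_assoc]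

lemma lemmaR (v : List (Fin 3 × Bool)) (hv : EK k v ≠ 1) (z : ℤ) (c) :
    ∃ w, w.length ≤ v.length + (3 * z.natAbs + 3 + sz c) ∧
      ∀ u l, act k w ⟨(0, some u), l⟩ = ⟨(z, c), (EK k v, u) :: l⟩ := by
  have h1 := fun u l => act_cword k v 1 u l
  simp only [place_one, mul_one] at h1
  rcases lt_or_gt_of_ne hv with h | h
  · obtain ⟨w, hw, hw'⟩ := MV.pos (k := k) 0 z c
    refine ⟨w ++ (v.map fun e => (⟨9 + e.1.val, by omega⟩, e.2)), ?_, fun u l => ?_⟩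
    · simp only [List.length_append, List.length_map]
      rw [sub_zero] at hw; omega
    · rw [act_append, Equiv.Perm.mul_apply, h1, place_lt h, hw']
  · obtain ⟨w, hw, hw'⟩ := MV.pos (k := k) 1 z c
    refine ⟨w ++ (v.map fun e => (⟨9 + e.1.val, by omega⟩, e.2)), ?_, fun u l => ?_⟩
    · simp only [List.length_append, List.length_map]
      omega
    · rw [act_append, Equiv.Perm.mul_apply, h1, place_gt h, zero_add, hw']

lemma reach (m : ℕ) (l : List (K × List Bool))
    (hl : ∀ e ∈ l, e.1 ≠ 1 ∧ e.2.length ≤ m ∧ ∃ v : List (Fin 3 × Bool), v.length ≤ m ∧ EK k v = e.1) :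
    ∀ (z : ℤ) (c), ∃ w, w.length ≤ l.length * (6 * m + 7) + (3 * z.natAbs + 3 + sz c) ∧
      act k w ⟨(0, none), []⟩ = ⟨(z, c), l⟩ := by
  induction l with
  | nil =>
    intro z c
    obtain ⟨w, hw, hw'⟩ := MV.pos (k := k) 0 z c
    exact ⟨w, by rw [sub_zero] at hw; simp; omega, hw' _⟩
  | cons e l ih =>
    intro z c
    obtain ⟨κ, u⟩ := e
    obtain ⟨h1, h2, v, h3, h4⟩ := hl (κ, u) (by simp)
    simp only at h1 h2 h4
    subst h4
    obtain ⟨w1, hw1, hw1'⟩ := ih (fun e he => hl e (by simp [he])) 0 (some u)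
    obtain ⟨w2, hw2, hw2'⟩ := lemmaR v h1 z c
    refine ⟨w2 ++ w1, ?_, by rw [act_append, Equiv.Perm.mul_apply, hw1', hw2']⟩
    simp only [List.length_append, List.length_cons, sz, Int.natAbs_zero, mul_zero, add_mul, one_mul] at *
    omega

def jf (l : List (K × List Bool)) : Prop := ∀ e ∈ l, e.1 ≠ 1

lemma reach2 (hk : ∀ κ, ∃ v, EK k v = κ) {κ : K} (hκ : κ ≠ 1) (l : List (K × List Bool)) (hl : jf l) :
    ∀ (q : Pos), ∃ w, ∀ u r, act k w ⟨(0, some u), r⟩ = ⟨q, l ++ (κ, u) :: r⟩ := by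
  induction l with
  | nil =>
    rintro ⟨z, c⟩
    obtain ⟨v, rfl⟩ := hk κ
    obtain ⟨w, -, h⟩ := lemmaR v hκ z c
    exact ⟨w, h⟩
  | cons e l ih =>
    rintro ⟨z, c⟩
    obtain ⟨κ1, u1⟩ := e
    have h1 : κ1 ≠ 1 := hl (κ1, u1) (by simp)
    obtain ⟨w1, hw1⟩ := ih (fun e he => hl e (by simp [he])) (0, some u1)
    obtain ⟨v, rfl⟩ := hk κ1
    obtain ⟨w2, -, hw2⟩ := lemmaR v h1 z c
    exact ⟨w2 ++ w1, fun u r => by rw [act_append, Equiv.Perm.mul_apply, hw1, hw2]; rfl⟩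

/-! ### Junk -/

lemma katf_app (S : Set ℤ) (κ : K) (u1 l1) (p : Om K) :
    kat S κ ⟨p.q, p.l ++ (1, u1) :: l1⟩ = ⟨(kat S κ p).q, (kat S κ p).l ++ (1, u1) :: l1⟩ := by
  have hp : ∀ z (κ : K) u l, (⟨(place z κ u l).q, (place z κ u l).l ++ (1, u1) :: l1⟩ : Om K) =
      place z κ u (l ++ (1, u1) :: l1) := by
    intro z κ u l
    rcases lt_trichotomy κ 1 with h | h | h
    · simp [place_lt h]
    · subst h; simp [place_one]
    · simp [place_gt h]
  rcases om_cases p with ⟨z, κ', u, l, rfl⟩ | ⟨z, l, h, rfl⟩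
  · rw [hp]
    by_cases hz : z ∈ S
    · rw [kat_place hz, kat_place hz, hp]
    · rw [kat_place' hz, kat_place' hz, hp]
  · rw [kat_spec _ _ h]
    apply kat_spec
    rcases l with _ | ⟨e, l⟩
    · rfl
    · exact h

lemma perm_comm_inv {α : Type*} {σ : Equiv.Perm α} {F : α → α} (h : ∀ p, σ (F p) = F (σ p)) (p) :
    σ⁻¹ (F p) = F (σ⁻¹ p) := by
  rw [Equiv.Perm.inv_eq_iff_eq, h]; simp

lemma app_comm {h} (hh : h ∈ HH k) (u1 l1) : ∀ p : Om K,
    h ⟨p.q, p.l ++ (1, u1) :: l1⟩ = ⟨(h p).q, (h p).l ++ (1, u1) :: l1⟩ := by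
  set F : Om K → Om K := fun p => ⟨p.q, p.l ++ (1, u1) :: l1⟩ with hF
  change ∀ p, h (F p) = F (h p)
  revert h
  apply HH_ind
  · intro p; rfl
  · intro a b ha hb p
    rw [Equiv.Perm.mul_apply, hb, ha]; rfl
  · intro a ha; exact perm_comm_inv ha
  · refine gens_cases k (P := fun h => ∀ p, h (F p) = F (h p)) ?_ ?_ ?_
    · intro r p; rfl
    · intro p; rfl
    · intro i p
      simp only [cc, Equiv.Perm.mul_apply, ← map_inv]
      have e : ∀ S κ (p : Om K), kat S κ (F p) = F (kat S κ p) := fun S κ p => katf_app S κ u1 l1 p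
      rw [e, e]

lemma eq_one_of_jf {h} (hh : h ∈ HH k) (H : ∀ q l, jf l → h ⟨q, l⟩ = ⟨q, l⟩) : h = 1 := by
  have aux : ∀ l : List (K × List Bool), jf l ∨ ∃ l0 u l1, jf l0 ∧ l = l0 ++ (1, u) :: l1 := by
    intro l
    induction l with
    | nil => left; intro e he; simp at he
    | cons e l ih =>
      obtain ⟨κ, u⟩ := e
      by_cases hκ : κ = 1
      · right; exact ⟨[], u, l, by intro e he; simp at he, by simp [hκ]⟩
      · rcases ih with ih | ⟨l0, u', l1, h1, rfl⟩
        · left; intro e he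
          rcases List.mem_cons.1 he with rfl | he
          · exact hκ
          · exact ih e he
        · right; refine ⟨(κ, u) :: l0, u', l1, ?_, rfl⟩
          intro e he
          rcases List.mem_cons.1 he with rfl | he
          · exact hκ
          · exact h1 e he
  ext1 ⟨q, l⟩
  rcases aux l with hl | ⟨l0, u, l1, h1, rfl⟩
  · exact H q l hl
  · have := app_comm hh u l1 ⟨q, l0⟩
    rw [H q l0 h1] at this
    exact this

/-! ### Monotonicity -/

variable [MulLeftMono K]

lemma HH_mono {h} (hh : h ∈ HH k) : ∀ {p p' : Om K}, p < p' → h p < h p' := by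
  have hi : ∀ a : Equiv.Perm (Om K), (∀ {p p' : Om K}, p < p' → a p < a p') →
      ∀ {p p' : Om K}, p < p' → a⁻¹ p < a⁻¹ p' := by
    intro a ha p p' hp
    rcases lt_trichotomy (a⁻¹ p) (a⁻¹ p') with h | h | h
    · exact h
    · rw [(a⁻¹).injective h] at hp; exact absurd hp (lt_irrefl _)
    · have := ha h
      simp only [Equiv.Perm.inv_def, Equiv.apply_symm_apply] at this
      exact absurd hp this.not_gt
  revert h
  apply HH_ind (P := fun h => ∀ {p p' : Om K}, p < p' → h p < h p')
  · intro p p' h; exact h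
  · intro a b ha hb p p' h
    exact ha (hb h)
  · exact hi
  · refine gens_cases k (P := fun h => ∀ {p p' : Om K}, p < p' → h p < h p') ?_ ?_ ?_
    · intro r p p' h; exact liftB_mono (nc_cls le_rfl) h
    · intro p p' h
      exact liftB_mono (nc_cls ((Cj_Ej 2).trans (Ej_cls le_rfl))) h
    · intro i p p' h
      simp only [cc, Equiv.Perm.mul_apply, ← map_inv]
      exact kat_mono _ _ (kat_mono _ _ h)

end
end LO

namespace LO
set_option linter.unusedSectionVars false

section
variable {K : Type} [Group K] [LinearOrder K]

/-! ### Locality -/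

def tau (d : ℤ) (p : Om K) : Om K := ⟨(p.q.1 + d, p.q.2), p.l⟩

lemma B_tau {S : Set ℤ} (hS : NC S) {z d : ℤ} (h1 : z ∈ S ↔ z + d ∈ S) (h2 : z - 1 ∈ S ↔ z - 1 + d ∈ S)
    (c) : B S (z + d, c) = ((B S (z, c)).1 + d, (B S (z, c)).2) := by
  rw [B_apply hS, B_apply hS]
  have e : z + d - 1 = z - 1 + d := by ring
  by_cases a1 : z ∈ S
  · have a2 := h1.1 a1
    rcases c with _ | u <;> simp [Bf, a1, a2]
  · have a2 : z + d ∉ S := fun h => a1 (h1.2 h)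
    by_cases b1 : z - 1 ∈ S
    · have b2 := h2.1 b1
      rcases c with _ | _ | ⟨_ | _, u⟩ <;> simp [Bf, a1, a2, b1, b2, e]
    · have b2 : z - 1 + d ∉ S := fun h => b1 (h2.2 h)
      simp [Bf, a1, a2, b1, b2, e]

lemma Bi_tau {S : Set ℤ} (hS : NC S) {z d : ℤ} (h1 : z ∈ S ↔ z + d ∈ S) (h2 : z - 1 ∈ S ↔ z - 1 + d ∈ S)
    (c) : (B S)⁻¹ (z + d, c) = (((B S)⁻¹ (z, c)).1 + d, ((B S)⁻¹ (z, c)).2) := by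
  rw [Bi_apply hS, Bi_apply hS]
  have e : z + d - 1 = z - 1 + d := by ring
  by_cases a1 : z ∈ S
  · have a2 := h1.1 a1
    rcases c with _ | _ | ⟨_ | _, u⟩ <;> simp [Bg, a1, a2] <;> ring
  · have a2 : z + d ∉ S := fun h => a1 (h1.2 h)
    by_cases b1 : z - 1 ∈ S
    · have b2 := h2.1 b1
      rcases c with _ | u <;> simp [Bg, a1, a2, b1, b2, e]
    · have b2 : z - 1 + d ∉ S := fun h => b1 (h2.2 h)
      simp [Bg, a1, a2, b1, b2, e]

lemma B_disp {S : Set ℤ} (hS : NC S) (q : Pos) : |(B S q).1 - q.1| ≤ 1 := by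
  obtain ⟨z, c⟩ := q
  rw [B_apply hS]
  simp only [Bf]
  split_ifs
  · rcases c with _ | u <;> simp
  · rcases c with _ | _ | ⟨_ | _, u⟩ <;> simp
  · simp

lemma Bi_disp {S : Set ℤ} (hS : NC S) (q : Pos) : |((B S)⁻¹ q).1 - q.1| ≤ 1 := by
  have := B_disp hS ((B S)⁻¹ q)
  rw [← Equiv.Perm.mul_apply, mul_inv_cancel, Equiv.Perm.one_apply, abs_sub_comm] at this
  exact this

lemma place_tau (z d : ℤ) (κ : K) (u l) : tau d (place z κ u l) = place (z + d) κ u l := by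
  rcases lt_trichotomy κ 1 with h | h | h
  · simp [place_lt h, tau]
  · subst h; simp [place_one, tau]
  · simp [place_gt h, tau]; ring

lemma kat_tau {S : Set ℤ} {d : ℤ} (h : ∀ z, z ∈ S ↔ z + d ∈ S) (κ : K) (p : Om K) :
    kat S κ (tau d p) = tau d (kat S κ p) := by
  rcases om_cases p with ⟨z, κ', u, l, rfl⟩ | ⟨z, l, hl, rfl⟩
  · rw [place_tau]
    by_cases hz : z ∈ S
    · rw [kat_place ((h z).1 hz), kat_place hz, place_tau]
    · rw [kat_place' (fun h' => hz ((h z).2 h')), kat_place' hz, place_tau]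
  · rw [kat_spec _ _ hl]
    exact kat_spec _ _ hl

lemma place_disp (z : ℤ) (κ : K) (u l) : (place z κ u l).q.1 = z ∨ (place z κ u l).q.1 = z + 1 := by
  rcases lt_trichotomy κ 1 with h | h | h
  · simp [place_lt h]
  · subst h; simp [place_one]
  · simp [place_gt h]

lemma kat_disp (S : Set ℤ) (κ : K) (p : Om K) : |(kat S κ p).q.1 - p.q.1| ≤ 1 := by
  rcases om_cases p with ⟨z, κ', u, l, rfl⟩ | ⟨z, l, hl, rfl⟩
  · by_cases hz : z ∈ S
    · rw [kat_place hz, abs_le]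
      rcases place_disp z κ' u l with h | h <;> rcases place_disp z (κ * κ') u l with h' | h' <;>
      rw [h, h'] <;> constructor <;> linarith
    · rw [kat_place' hz]; simp
  · rw [kat_spec _ _ hl]; simp

lemma cls_add {d : ℤ} (hd : 8 ∣ d) (r z : ℤ) : z ∈ cls r ↔ z + d ∈ cls r := by
  simp only [mem_cls]; omega

lemma vv_add {k : ℕ} {z d : ℤ} (h : vv z < k) (hd : (8 : ℤ) ^ k ∣ d) : vv (z + d) = vv z := by
  have aux : ∀ j, j ≤ k → (j ≤ vv (z + d) ↔ j ≤ vv z) := by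
    intro j hj
    rw [← pow_dvd_vv, ← pow_dvd_vv, show 7 * (z + d) + 1 = (7 * z + 1) + 7 * d by ring]
    exact dvd_add_left (Dvd.dvd.mul_left (dvd_trans (pow_dvd_pow _ hj) hd) 7)
  have h1 := aux (vv z) h.le
  have h2 := aux (vv z + 1) h
  omega

lemma vv_lt {z : ℤ} {Z : ℕ} (h : |z| ≤ Z) : vv z < 7 * Z + 2 := by
  have h1 : (8 : ℤ) ^ vv z ∣ 7 * z + 1 := pow_dvd_vv.2 le_rfl
  have h2 : (8 : ℤ) ^ vv z ≤ |7 * z + 1| := Int.le_of_dvd (by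
    rw [abs_pos]; omega) ((dvd_abs _ _).2 h1)
  have h3 : vv z < 8 ^ vv z := Nat.lt_pow_self (by norm_num)
  have h4 : ((8 ^ vv z : ℕ) : ℤ) ≤ 7 * Z + 1 := by
    push_cast
    refine h2.trans ?_
    rw [abs_le] at h ⊢
    constructor <;> omega
  omega

lemma mem_C1 {z : ℤ} : z ∈ C1 ↔ 2 ≤ vv z ∧ 2 ∣ vv z := by
  change 2 ≤ vv z ∧ 2 ∣ vv z - 2 ↔ _
  omega

lemma nc_C1 : NC C1 := nc_cls ((Cj_Ej 2).trans (Ej_cls le_rfl))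

def Loc (h : Equiv.Perm (Om K)) : Prop :=
  (∃ R : ℕ, ∀ p, |(h p).q.1 - p.q.1| ≤ R) ∧
  ∀ Z : ℕ, ∃ k : ℕ, ∀ d, (8 : ℤ) ^ k ∣ d → ∀ p : Om K, |p.q.1| ≤ Z → h (tau d p) = tau d (h p)

lemma Loc.mul {a b : Equiv.Perm (Om K)} (ha : Loc a) (hb : Loc b) : Loc (a * b) := by
  obtain ⟨⟨R, hR⟩, ha⟩ := ha
  obtain ⟨⟨R', hR'⟩, hb⟩ := hb
  refine ⟨⟨R + R', fun p => ?_⟩, fun Z => ?_⟩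
  · have h1 := hR (b p)
    have h2 := hR' p
    rw [Equiv.Perm.mul_apply]
    push_cast
    rw [abs_le] at *
    constructor <;> linarith
  · obtain ⟨k, hk⟩ := ha (Z + R')
    obtain ⟨k', hk'⟩ := hb Z
    refine ⟨max k k', fun d hd p hp => ?_⟩
    rw [Equiv.Perm.mul_apply, hk' d (dvd_trans (pow_dvd_pow _ (le_max_right _ _)) hd) p hp,
      hk d (dvd_trans (pow_dvd_pow _ (le_max_left _ _)) hd), Equiv.Perm.mul_apply]
    have h2 := hR' p
    push_cast
    rw [abs_le] at *
    constructor <;> linarith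

lemma Loc.inv {a : Equiv.Perm (Om K)} (ha : Loc a) : Loc a⁻¹ := by
  obtain ⟨⟨R, hR⟩, ha⟩ := ha
  have hR' : ∀ p, |(a⁻¹ p).q.1 - p.q.1| ≤ R := by
    intro p
    have := hR (a⁻¹ p)
    rw [← Equiv.Perm.mul_apply, mul_inv_cancel, Equiv.Perm.one_apply, abs_sub_comm] at this
    exact this
  refine ⟨⟨R, hR'⟩, fun Z => ?_⟩
  obtain ⟨k, hk⟩ := ha (Z + R)
  refine ⟨k, fun d hd p hp => ?_⟩
  rw [Equiv.Perm.inv_eq_iff_eq, hk d hd]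
  · simp
  · have h2 := hR' p
    push_cast
    rw [abs_le] at *
    constructor <;> linarith

lemma Loc_kat (r : ℤ) (κ : K) : Loc (kat (cls r) κ) := by
  refine ⟨⟨1, fun p => by simpa using kat_disp (cls r) κ p⟩, fun Z => ⟨1, fun d hd p _ => ?_⟩⟩
  exact kat_tau (cls_add (by simpa using hd) r) κ p

lemma Loc_B {S : Set ℤ} (hS : NC S) (h : ∀ Z : ℕ, ∃ k : ℕ, ∀ d : ℤ, (8 : ℤ) ^ k ∣ d → ∀ z : ℤ, |z| ≤ Z →
    (z ∈ S ↔ z + d ∈ S)) : Loc (liftP (B S) : Equiv.Perm (Om K)) := by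
  refine ⟨⟨1, fun p => by simpa [liftP_apply] using B_disp hS p.q⟩, fun Z => ?_⟩
  obtain ⟨k, hk⟩ := h (Z + 1)
  refine ⟨k, fun d hd p hp => ?_⟩
  have h1 := hk d hd p.q.1 (by push_cast; linarith)
  have h2 := hk d hd (p.q.1 - 1) (by push_cast; rw [abs_le] at *; constructor <;> linarith)
  simp only [tau, liftP_apply]
  rw [B_tau hS h1 h2]

lemma Loc_HH {k : Fin 3 → K} : ∀ h ∈ HH k, Loc h := by
  apply HH_ind
  · exact ⟨⟨0, fun p => by simp⟩, fun Z => ⟨0, fun d _ p _ => rfl⟩⟩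
  · intro a b; exact Loc.mul
  · intro a; exact Loc.inv
  · refine gens_cases k ?_ ?_ ?_
    · intro r
      exact Loc_B (nc_cls le_rfl) fun Z => ⟨1, fun d hd z _ => cls_add (by simpa using hd) r z⟩
    · refine Loc_B nc_C1 fun Z => ⟨7 * Z + 2, fun d hd z hz => ?_⟩
      rw [mem_C1, mem_C1, vv_add (vv_lt hz) hd]
    · intro i
      exact (Loc_kat _ _).mul (Loc_kat _ _).inv

/-! ### Intervals -/

lemma keyl_lt_app (l : List (K × List Bool)) {κ : K} (hκ : κ < 1) (w r) :
    keyl l < keyl (l ++ (κ, w) :: r) := by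
  induction l with
  | nil => rw [List.nil_append, keyl_nil_lt]; exact hκ
  | cons e l ih => rw [List.cons_append, keyl_cons_lt]; exact Or.inr ⟨rfl, ih⟩

variable [MulLeftMono K] [Nontrivial K]

lemma exists_lt_one : ∃ κ : K, κ < 1 := by
  obtain ⟨a, ha⟩ := exists_ne (1 : K)
  rcases lt_or_gt_of_ne ha with h | h
  · exact ⟨a, h⟩
  · exact ⟨a⁻¹, by simpa using h⟩

lemma exists_gap (l : List (K × List Bool)) : ∀ l', keyl l < keyl l' →
    ∃ κ : K, κ < 1 ∧ ∀ w r, keyl (l ++ (κ, w) :: r) < keyl l' := by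
  induction l with
  | nil =>
    rintro (_ | ⟨⟨κ, u⟩, l'⟩) h
    · exact absurd h (lt_irrefl _)
    · rw [keyl_nil_lt] at h
      have h2 : κ * κ < κ := by simpa using h
      refine ⟨κ * κ, h2.trans h, fun w r => ?_⟩
      rw [List.nil_append, keyl_cons_lt, ent_lt]
      simp only at h
      have h3 := h2.trans h
      left; right
      simp only [cls8, h.not_gt, h3.not_gt, h.ne, h3.ne, if_false, true_and]
      exact Or.inl h2
  | cons e l ih =>
    rintro (_ | ⟨e', l'⟩) h
    · obtain ⟨κ, hκ⟩ := exists_lt_one (K := K)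
      refine ⟨κ, hκ, fun w r => ?_⟩
      rw [keyl_lt_nil] at h
      rw [List.cons_append, keyl_lt_nil]; exact h
    · rw [keyl_cons_lt] at h
      rcases h with h | ⟨h, h'⟩
      · obtain ⟨κ, hκ⟩ := exists_lt_one (K := K)
        refine ⟨κ, hκ, fun w r => ?_⟩
        rw [List.cons_append, keyl_cons_lt]; exact Or.inl h
      · obtain ⟨κ, hκ, h2⟩ := ih l' h'
        refine ⟨κ, hκ, fun w r => ?_⟩
        rw [List.cons_append, keyl_cons_lt]; exact Or.inr ⟨h, h2 w r⟩

lemma exists_window {q : Pos} {l : List (K × List Bool)} {p' : Om K} (h : ⟨q, l⟩ < p') :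
    ∃ κ : K, κ < 1 ∧ ∀ w r, (⟨q, l⟩ : Om K) < ⟨q, l ++ (κ, w) :: r⟩ ∧ ⟨q, l ++ (κ, w) :: r⟩ < p' := by
  rw [om_lt] at h
  rcases h with h | ⟨h, h'⟩
  · obtain ⟨κ, hκ⟩ := exists_lt_one (K := K)
    refine ⟨κ, hκ, fun w r => ⟨?_, ?_⟩⟩
    · rw [om_lt]; exact Or.inr ⟨rfl, keyl_lt_app l hκ w r⟩
    · rw [om_lt]; exact Or.inl h
  · obtain ⟨κ, hκ, h2⟩ := exists_gap l _ h'
    refine ⟨κ, hκ, fun w r => ⟨?_, ?_⟩⟩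
    · rw [om_lt]; exact Or.inr ⟨rfl, keyl_lt_app l hκ w r⟩
    · rw [om_lt]; exact Or.inr ⟨h, h2 w r⟩

/-! ### Simplicity -/

variable {k : Fin 3 → K} (hk : ∀ κ, ∃ v, EK k v = κ) {N : Subgroup (Equiv.Perm (Om K))}
  (hN : ∀ n ∈ N, ∀ g ∈ HH k, g * n * g⁻¹ ∈ N) (hNH : N ≤ HH k)

include hk hN hNH in
lemma exists_disp (hne : ∃ n ∈ N, n ≠ 1) :
    ∃ n ∈ N, ∀ u l, ¬ ∃ u' l', n ⟨(0, some u), l⟩ = ⟨(0, some u'), l'⟩ := by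
  have key : ∃ n ∈ N, ∃ q l, jf l ∧ (⟨q, l⟩ : Om K) < n ⟨q, l⟩ := by
    obtain ⟨n, hn, hn1⟩ := hne
    by_contra hcon
    push Not at hcon
    apply hn1
    refine eq_one_of_jf (hNH hn) fun q l hl => ?_
    have h1 := hcon n hn q l hl
    have h2 := hcon n⁻¹ (inv_mem hn) q l hl
    refine le_antisymm h1 ?_
    by_contra h3
    have := HH_mono (inv_mem (hNH hn)) (not_le.1 h3)
    rw [← Equiv.Perm.mul_apply, inv_mul_cancel, Equiv.Perm.one_apply] at this
    exact absurd this h2.not_gt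
  obtain ⟨n, hn, q, l, hl, hlt⟩ := key
  obtain ⟨κ, hκ, hw⟩ := exists_window hlt
  obtain ⟨w, hw'⟩ := reach2 hk hκ.ne l hl q
  refine ⟨(act k w)⁻¹ * n * (act k w), ?_, ?_⟩
  · have := hN n hn _ (inv_mem (act_mem k w))
    rwa [inv_inv] at this
  · rintro u r ⟨u', r', h⟩
    rw [Equiv.Perm.mul_apply, Equiv.Perm.mul_apply, hw', Equiv.Perm.inv_eq_iff_eq, hw'] at h
    have h1 := HH_mono (hNH hn) (hw u r).1
    rw [h] at h1
    exact absurd h1 (hw u' r').2.not_gt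

include hN in
lemma CT_N {σ ρ} (h : CT σ ρ) (hs : liftP σ ∈ N) : liftP ρ ∈ N := by
  obtain ⟨τ, h, rfl⟩ := h
  have := hN _ hs _ (TT_mem k h)
  simpa using this

include hk hN hNH in
lemma exists_X10 (hne : ∃ n ∈ N, n ≠ 1) : ∃ m : ℕ, 2 ≤ m ∧ liftP (loc (cl m 0) Xp) ∈ N := by
  obtain ⟨n, hn, hd⟩ := exists_disp hk hN hNH hne
  obtain ⟨⟨R, hR⟩, hloc⟩ := Loc_HH n (hNH hn)
  obtain ⟨m0, hm0⟩ := hloc 0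
  set m := max m0 (R + 2) with hm
  have hm1 : m0 ≤ m := le_max_left _ _
  have hm2 : R + 2 ≤ m := le_max_right _ _
  refine ⟨m, by omega, ?_⟩
  have hX : XS (cl m 0) := XS_cl m (by omega) 0
  have hcl := cl_cls (show 1 ≤ m by omega) 0
  set σ : Equiv.Perm (Om K) := liftP (loc (cl m 0) Ap) with hσ
  set σ' : Equiv.Perm (Om K) := liftP (loc (cl m 0) Bp) with hσ'
  have hσH : σ ∈ HH k := TT_mem k (hX.A hcl)
  have hσH' : σ' ∈ HH k := TT_mem k (hX.B hcl)
  set ρ := n * σ⁻¹ * n⁻¹ with hρ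
  have h1 : σ * ρ ∈ N := by
    have := mul_mem (hN n hn σ hσH) (inv_mem hn)
    rwa [hρ, ← mul_assoc, ← mul_assoc]
  have h2 : (σ * ρ) * (σ' * (σ * ρ)⁻¹ * σ'⁻¹) ∈ N := mul_mem h1 (hN _ (inv_mem h1) _ hσH')
  have fixσ : ∀ (f : Equiv.Perm (List Bool)) (p : Om K), (liftP (loc (cl m 0) f) : Equiv.Perm (Om K)) p ≠ p →
      p.q.1 ∈ cl m 0 ∧ ∃ u, p.q.2 = some u := by
    rintro f ⟨⟨z, c⟩, l⟩ hp
    rw [liftP_apply] at hp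
    constructor
    · by_contra hz
      exact hp (by simp only at hz ⊢; rw [loc_fix hz])
    · rcases c with _ | u
      · exact absurd (by simp only; rw [loc_none]) hp
      · exact ⟨u, rfl⟩
  have hdis : Commute ρ σ' := by
    apply Equiv.Perm.Disjoint.commute
    intro x
    by_contra hcon
    rw [not_or] at hcon
    obtain ⟨c1, c2⟩ := hcon
    obtain ⟨a1, u', a2⟩ := fixσ _ _ c2
    have c3 : σ⁻¹ (n⁻¹ x) ≠ n⁻¹ x := by
      intro h
      apply c1
      rw [hρ, Equiv.Perm.mul_apply, Equiv.Perm.mul_apply, h]; simp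
    rw [hσ, ← map_inv, ← map_inv] at c3
    obtain ⟨b1, u, b2⟩ := fixσ _ _ c3
    obtain ⟨y, hy⟩ : ∃ y, n⁻¹ x = y := ⟨_, rfl⟩
    rw [hy] at b1 b2
    rw [Equiv.Perm.inv_eq_iff_eq] at hy
    obtain ⟨⟨z, c⟩, l⟩ := y
    simp only at b1 b2
    subst b2
    change (8 : ℤ) ^ m ∣ z - 0 at b1
    rw [sub_zero] at b1
    have e := hm0 z (dvd_trans (pow_dvd_pow _ hm1) b1) ⟨(0, some u), l⟩ (by simp)
    simp only [tau, zero_add] at e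
    rw [← hy] at e
    have hR0 := hR ⟨(0, some u), l⟩
    obtain ⟨⟨⟨z', c'⟩, l'⟩, hp'⟩ : ∃ p', n ⟨(0, some u), l⟩ = p' := ⟨_, rfl⟩
    rw [hp'] at e hR0
    rw [e] at a1 a2
    simp only at a2 hR0
    change (8 : ℤ) ^ m ∣ z' + z - 0 at a1
    rw [sub_zero, dvd_add_left b1] at a1
    have hz' : z' = 0 := by
      refine Int.eq_zero_of_abs_lt_dvd a1 ?_
      rw [sub_zero] at hR0
      refine lt_of_le_of_lt hR0 ?_
      have : R < 8 ^ m := lt_of_lt_of_le (Nat.lt_pow_self (by norm_num : 1 < 8))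
        (Nat.pow_le_pow_right (by norm_num) (by omega))
      exact_mod_cast this
    subst hz'
    subst a2
    exact hd u l ⟨u', l', hp'⟩
  have h3 : (σ * ρ) * (σ' * (σ * ρ)⁻¹ * σ'⁻¹) = σ * σ' * σ⁻¹ * σ'⁻¹ := by
    have := hdis.eq
    calc (σ * ρ) * (σ' * (σ * ρ)⁻¹ * σ'⁻¹) = σ * (ρ * σ') * ρ⁻¹ * σ⁻¹ * σ'⁻¹ := by group
      _ = σ * σ' * σ⁻¹ * σ'⁻¹ := by rw [this]; group
  rw [h3, hσ, hσ', ← map_inv liftP, ← map_inv liftP, ← map_mul liftP, ← map_mul liftP, ← map_mul liftP, loc_inter, Set.inter_self,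
    comm_AB] at h2
  exact CT_N hN (CT_cone _ _ hcl) h2

lemma cl_union_mem {f} {m : ℕ} (h : ∀ z, liftP (loc (cl (m + 1) z) f) ∈ N) (z : ℤ) :
    liftP (loc (cl m z) f) ∈ N := by
  have aux : ∀ n : ℕ, n ≤ 8 → liftP (loc {y | ∃ i : ℕ, i < n ∧ y ∈ cl (m + 1) (z + i * 8 ^ m)} f) ∈ N := by
    intro n
    induction n with
    | zero =>
      intro _
      have : loc {y | ∃ i : ℕ, i < 0 ∧ y ∈ cl (m + 1) (z + i * 8 ^ m)} f = 1 := by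
        ext1 ⟨y, c⟩
        rw [loc_fix]; · rfl
        rintro ⟨i, hi, _⟩; omega
      rw [this, map_one]; exact one_mem _
    | succ n ih =>
      intro hn
      have e : {y | ∃ i : ℕ, i < n + 1 ∧ y ∈ cl (m + 1) (z + i * 8 ^ m)} =
          {y | ∃ i : ℕ, i < n ∧ y ∈ cl (m + 1) (z + i * 8 ^ m)} ∪ cl (m + 1) (z + n * 8 ^ m) := by
        ext y
        constructor
        · rintro ⟨i, hi, hy⟩
          rcases (show i < n ∨ i = n by omega) with h | rfl
          · exact Or.inl ⟨i, h, hy⟩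
          · exact Or.inr hy
        · rintro (⟨i, hi, hy⟩ | hy)
          · exact ⟨i, by omega, hy⟩
          · exact ⟨n, by omega, hy⟩
      rw [e, loc_union, map_mul]
      · exact mul_mem (ih (by omega)) (h _)
      · rintro y ⟨i, hi, h1⟩ h2
        change (8 : ℤ) ^ (m + 1) ∣ _ at h1
        change (8 : ℤ) ^ (m + 1) ∣ _ at h2
        have h3 := dvd_sub h1 h2
        rw [show y - (z + i * 8 ^ m) - (y - (z + n * 8 ^ m)) = 8 ^ m * ((n : ℤ) - i) by ring, pow_succ] at h3
        have := (mul_dvd_mul_iff_left (pow_ne_zero m (by norm_num : (8 : ℤ) ≠ 0))).1 h3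
        omega
  have := aux 8 le_rfl
  have e : {y | ∃ i : ℕ, i < 8 ∧ y ∈ cl (m + 1) (z + i * 8 ^ m)} = cl m z := by
    ext y
    constructor
    · rintro ⟨i, hi, h⟩
      change (8 : ℤ) ^ (m + 1) ∣ _ at h
      change (8 : ℤ) ^ m ∣ _
      have h1 : (8 : ℤ) ^ m ∣ y - (z + i * 8 ^ m) := dvd_trans (pow_dvd_pow _ (by omega)) h
      have h2 := dvd_add h1 (Dvd.intro_left (i : ℤ) rfl : (8 : ℤ) ^ m ∣ i * 8 ^ m)
      rwa [show y - (z + i * 8 ^ m) + i * 8 ^ m = y - z by ring] at h2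
    · rintro ⟨a, ha⟩
      refine ⟨(a % 8).toNat, by omega, a / 8, ?_⟩
      have h1 : (((a % 8).toNat : ℕ) : ℤ) = a % 8 := by omega
      have h2 : a = 8 * (a / 8) + a % 8 := by omega
      rw [h1]
      linear_combination ha + 8 ^ m * h2
  rwa [e] at this

lemma cl_one (z : ℤ) : cl 1 z = cls z := by
  ext y
  change (8 : ℤ) ^ 1 ∣ y - z ↔ _
  rw [mem_cls]; omega

include hk hN hNH in
lemma TT_le_N (hne : ∃ n ∈ N, n ≠ 1) : ∀ σ ∈ TT, liftP σ ∈ N := by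
  obtain ⟨m, hm, h0⟩ := exists_X10 hk hN hNH hne
  have h1 : ∀ z, liftP (loc (cl m z) Xp) ∈ N := by
    intro z
    have := CT_N hN (CT_shift (cl_cls (by omega) 0) z Xp) h0
    rwa [shift_cl, zero_add] at this
  have h2 : ∀ j, ∀ z, liftP (loc (cl (1 + (m - 1 - j)) z) Xp) ∈ N := by
    intro j
    induction j with
    | zero => rwa [show 1 + (m - 1 - 0) = m by omega]
    | succ j ih =>
      by_cases hj : m - 1 - j = 0
      · rwa [show 1 + (m - 1 - (j + 1)) = 1 + (m - 1 - j) by omega]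
      · apply cl_union_mem
        rwa [show 1 + (m - 1 - (j + 1)) + 1 = 1 + (m - 1 - j) by omega]
  have h3 : ∀ r, liftP (loc (cls r) Xp) ∈ N := by
    intro r
    have := h2 (m - 1) r
    rwa [Nat.sub_self, add_zero, cl_one] at this
  have h4 : ∀ r, liftP (B (cls r)) ∈ N := by
    intro r
    refine CT_N hN (CT_B (le_refl (cls r))) ?_
    have : shift (cls r) 1 = cls (r + 1) := by rw [← cl_one, shift_cl, cl_one]
    rw [this]; exact h3 _
  have hC1 : C1 ⊆ cls 1 := (Cj_Ej 2).trans (Ej_cls le_rfl)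
  have h5 : liftP (B C1) ∈ N := by
    refine CT_N hN ((CT_shift hC1 1 Xp).trans (CT_B hC1)) ?_
    have a1 : liftP (loc (cls 1) Ap) ∈ N := CT_N hN (CT_cone [true] Xp (le_refl (cls 1))).symm (h3 1)
    have a2 : loc C1 Bp ∈ TT := (XS_Cj 2 le_rfl).1.B hC1
    have a3 := mul_mem a1 (hN _ (inv_mem a1) _ (TT_mem k a2))
    rw [← map_inv liftP, ← map_inv liftP, ← map_mul liftP, ← map_mul liftP, ← map_mul liftP, ← mul_assoc, ← mul_assoc, loc_inter,
      Set.inter_eq_right.2 hC1, comm_AB] at a3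
    exact CT_N hN (CT_cone _ _ hC1) a3
  intro σ hσ
  induction hσ using Subgroup.closure_induction with
  | mem x hx =>
    rcases hx with ⟨r, rfl⟩ | hx
    · exact h4 r
    · rw [Set.mem_singleton_iff] at hx
      subst hx; exact h5
  | one => rw [map_one]; exact one_mem _
  | mul x y _ _ hx hy => rw [map_mul]; exact mul_mem hx hy
  | inv x _ hx => rw [map_inv]; exact inv_mem hx

omit [MulLeftMono K] [Nontrivial K] in
lemma kat_conj (σ : Equiv.Perm Pos) (S : Set ℤ) (d : ℤ)
    (h : ∀ z ∈ S, (∀ c, σ (z, c) = (z + d, c)) ∧ σ (z + 1, none) = (z + d + 1, none)) (κ : K) :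
    liftP σ * kat S κ * (liftP σ)⁻¹ = kat (shift S d) κ := by
  have hp : ∀ z ∈ S, ∀ (κ : K) u l, liftP σ (place z κ u l) = place (z + d) κ u l := by
    intro z hz κ u l
    rcases lt_trichotomy κ 1 with h1 | h1 | h1
    · rw [place_lt h1, place_lt h1, liftP_apply, (h z hz).1]
    · subst h1; rw [place_one, place_one, liftP_apply, (h z hz).1]
    · rw [place_gt h1, place_gt h1, liftP_apply, (h z hz).2]
  rw [mul_inv_eq_iff_eq_mul]
  ext1 p
  simp only [Equiv.Perm.mul_apply]
  by_cases hc : ∃ z ∈ S, ∃ κ' u l, p = place z κ' u l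
  · obtain ⟨z, hz, κ', u, l, rfl⟩ := hc
    have hz' : z + d ∈ shift S d := by simpa [mem_shift] using hz
    rw [kat_place hz, hp z hz, hp z hz, kat_place hz']
  · have e1 : kat S κ p = p := by
      rcases om_cases p with ⟨z, κ', u, l, rfl⟩ | ⟨z, l, hl, rfl⟩
      · exact kat_place' (fun hz => hc ⟨z, hz, κ', u, l, rfl⟩) ..
      · exact kat_spec _ _ hl
    rw [e1]
    rcases om_cases (liftP σ p) with ⟨z, κ', u, l, e⟩ | ⟨z, l, hl, e⟩
    · rw [e, kat_place']
      intro hz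
      apply hc
      refine ⟨z - d, hz, κ', u, l, (liftP σ : Equiv.Perm (Om K)).injective ?_⟩
      rw [e, hp _ hz, sub_add_cancel]
    · rw [e, kat_spec _ _ hl]

omit [MulLeftMono K] [Nontrivial K] in
lemma kat_comm {S S' : Set ℤ} (h : ∀ z ∈ S, z ∉ S') (κ κ' : K) : Commute (kat S κ) (kat S' κ') := by
  apply Equiv.Perm.Disjoint.commute
  intro p
  rcases om_cases p with ⟨z, κ', u, l, rfl⟩ | ⟨z, l, hl, rfl⟩
  · by_cases hz : z ∈ S
    · right; exact kat_place' (h z hz) ..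
    · left; exact kat_place' hz ..
  · left; exact kat_spec _ _ hl

lemma cls_disj {r r' : ℤ} (h : (r - r') % 8 ≠ 0) : ∀ z ∈ cls r, z ∉ cls r' := by
  intro z h1 h2
  rw [mem_cls] at h1 h2; omega

lemma shift_clsr (r d : ℤ) : shift (cls r) d = cls (r + d) := by
  rw [← cl_one, shift_cl, cl_one]

/-- translation of the class `3` to the class `5` -/
noncomputable def f1 : Equiv.Perm Pos := gt 4 * gt 3
/-- translation of the classes `0`, `3` to the classes `3`, `5` -/
noncomputable def f2 : Equiv.Perm Pos := gt 2 * gt 1 * gt 0 * f1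

lemma gt_fix {r z : ℤ} (h : ∀ i : ℤ, -1 ≤ i → i ≤ 2 → (z - r - i) % 8 ≠ 0) (c) : gt r (z, c) = (z, c) := by
  have a1 := h (-1) (by norm_num) (by norm_num)
  have a2 := h 0 (by norm_num) (by norm_num)
  have a3 := h 1 (by norm_num) (by norm_num)
  have a4 := h 2 (by norm_num) (by norm_num)
  simp only [gt, Equiv.Perm.mul_apply]
  have hB : ∀ s, z ∉ cls s → z - 1 ∉ cls s → (B (cls s))⁻¹ (z, c) = (z, c) :=
    fun s h1 h2 => Bi_fix (nc_cls le_rfl) h1 h2 c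
  rw [hB (r - 1) (by rw [mem_cls]; omega) (by rw [mem_cls]; omega),
    hB r (by rw [mem_cls]; omega) (by rw [mem_cls]; omega),
    hB (r + 1) (by rw [mem_cls]; omega) (by rw [mem_cls]; omega)]

lemma f1_mem : f1 ∈ TT := mul_mem (gt_mem _) (gt_mem _)
lemma f2_mem : f2 ∈ TT := mul_mem (mul_mem (mul_mem (gt_mem _) (gt_mem _)) (gt_mem _)) f1_mem

lemma f1_0 : ∀ z ∈ cls 0, (∀ c, f1 (z, c) = (z + 0, c)) ∧ f1 (z + 1, none) = (z + 0 + 1, none) := by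
  intro z hz
  rw [mem_cls] at hz
  constructor
  · intro c
    rw [f1, Equiv.Perm.mul_apply, gt_fix (r := 3) (z := z) (by intros; omega),
      gt_fix (r := 4) (z := z) (by intros; omega), add_zero]
  · rw [f1, Equiv.Perm.mul_apply, gt_fix (r := 3) (z := z + 1) (by intros; omega),
      gt_fix (r := 4) (z := z + 1) (by intros; omega), add_zero]

lemma f1_3 : ∀ z ∈ cls 3, (∀ c, f1 (z, c) = (z + 2, c)) ∧ f1 (z + 1, none) = (z + 2 + 1, none) := by
  intro z hz
  have hz' : z + 1 ∈ cls 4 := by rw [mem_cls] at *; omega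
  obtain ⟨a1, a2⟩ := gt_vals hz
  obtain ⟨b1, b2⟩ := gt_vals hz'
  constructor
  · intro c
    rw [f1, Equiv.Perm.mul_apply, a1, b1]; congr 1; ring
  · rw [f1, Equiv.Perm.mul_apply, a2, show z + 2 = z + 1 + 1 by ring, b2]; congr 1; ring

lemma f2_0 : ∀ z ∈ cls 0, (∀ c, f2 (z, c) = (z + 3, c)) ∧ f2 (z + 1, none) = (z + 3 + 1, none) := by
  intro z hz
  have hz' : z + 1 ∈ cls 1 := by rw [mem_cls] at *; omega
  have hz'' : z + 1 + 1 ∈ cls 2 := by rw [mem_cls] at *; omega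
  obtain ⟨a1, a2⟩ := gt_vals hz
  obtain ⟨b1, b2⟩ := gt_vals hz'
  obtain ⟨d1, d2⟩ := gt_vals hz''
  obtain ⟨e1, e2⟩ := f1_0 z hz
  simp only [f2, Equiv.Perm.mul_apply]
  constructor
  · intro c
    rw [e1, add_zero, a1, b1, d1]; congr 1; ring
  · rw [e2, add_zero, a2, show z + 2 = z + 1 + 1 by ring, b2, show z + 1 + 2 = z + 1 + 1 + 1 by ring, d2]
    congr 1; ring

lemma f2_3 : ∀ z ∈ cls 3, (∀ c, f2 (z, c) = (z + 2, c)) ∧ f2 (z + 1, none) = (z + 2 + 1, none) := by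
  intro z hz
  obtain ⟨e1, e2⟩ := f1_3 z hz
  rw [mem_cls] at hz
  simp only [f2, Equiv.Perm.mul_apply]
  constructor
  · intro c
    rw [e1, gt_fix (r := 0) (z := z + 2) (by intros; omega),
      gt_fix (r := 1) (z := z + 2) (by intros; omega), gt_fix (r := 2) (z := z + 2) (by intros; omega)]
  · rw [e2, gt_fix (r := 0) (z := z + 2 + 1) (by intros; omega),
      gt_fix (r := 1) (z := z + 2 + 1) (by intros; omega), gt_fix (r := 2) (z := z + 2 + 1) (by intros; omega)]

omit [MulLeftMono K] [Nontrivial K] in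
lemma f1_cc (κ : K) : liftP f1 * cc κ * (liftP f1)⁻¹ = kat (cls 0) κ * (kat (cls 5) κ)⁻¹ := by
  have h1 := kat_conj f1 (cls 0) 0 f1_0 κ
  have h2 := kat_conj f1 (cls 3) 2 f1_3 κ
  rw [shift_clsr] at h1 h2
  norm_num at h1 h2
  have e : ∀ a b c : Equiv.Perm (Om K), a * (b * c⁻¹) * a⁻¹ = (a * b * a⁻¹) * (a * c * a⁻¹)⁻¹ := by
    intros; group
  rw [cc, e, h1, h2]

omit [MulLeftMono K] [Nontrivial K] in
lemma f2_cc (κ : K) : liftP f2 * cc κ * (liftP f2)⁻¹ = kat (cls 3) κ * (kat (cls 5) κ)⁻¹ := by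
  have h1 := kat_conj f2 (cls 0) 3 f2_0 κ
  have h2 := kat_conj f2 (cls 3) 2 f2_3 κ
  rw [shift_clsr] at h1 h2
  norm_num at h1 h2
  have e : ∀ a b c : Equiv.Perm (Om K), a * (b * c⁻¹) * a⁻¹ = (a * b * a⁻¹) * (a * c * a⁻¹)⁻¹ := by
    intros; group
  rw [cc, e, h1, h2]

include hk hN hNH in
lemma HH_le_N (hne : ∃ n ∈ N, n ≠ 1) : HH k ≤ N := by
  have hT := TT_le_N hk hN hNH hne
  have hc : ∀ i, cc (k i) ∈ N := by
    intro i
    set κ := k i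
    have hH : cc κ ∈ HH k := by rw [← gens_c]; exact gens_mem ..
    have h1 : cc κ * liftP f1 * (cc κ)⁻¹ * (liftP f1)⁻¹ ∈ N :=
      mul_mem (hN _ (hT f1 f1_mem) _ hH) (inv_mem (hT f1 f1_mem))
    have e1 : cc κ * liftP f1 * (cc κ)⁻¹ * (liftP f1)⁻¹ = cc κ * (liftP f1 * cc κ * (liftP f1)⁻¹)⁻¹ := by group
    have c1 : Commute (kat (cls 0) κ) (kat (cls 3) κ)⁻¹ := by
      rw [← map_inv]; exact kat_comm (cls_disj (by norm_num)) _ _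
    have e2 : cc κ * (liftP f1 * cc κ * (liftP f1)⁻¹)⁻¹ = (liftP f2 * cc κ * (liftP f2)⁻¹)⁻¹ := by
      have c2 : Commute (kat (cls 3) κ)⁻¹ (kat (cls 5) κ) := by
        rw [← map_inv]; exact kat_comm (cls_disj (by norm_num)) _ _
      have c3 : Commute (kat (cls 0) κ) (kat (cls 5) κ) := kat_comm (cls_disj (by norm_num)) _ _
      rw [f1_cc, f2_cc, cc, c1.eq, mul_inv_rev, inv_inv, mul_inv_rev, inv_inv, ← c2.eq, mul_assoc,
        ← mul_assoc (kat (cls 0) κ), c3.eq, mul_inv_cancel_right]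
    rw [e1, e2, inv_mem_iff] at h1
    have h2 := hN _ h1 _ (inv_mem (TT_mem k f2_mem))
    have e3 : (liftP f2)⁻¹ * (liftP f2 * cc κ * (liftP f2)⁻¹) * (liftP f2)⁻¹⁻¹ = cc κ := by group
    rwa [e3] at h2
  refine HH_ind k (one_mem _) (fun a b => mul_mem) (fun a => inv_mem) ?_
  refine gens_cases k (fun r => hT _ (B_cls_mem r)) (hT _ B_C1_mem) hc

lemma simple_HH (hk : ∀ κ, ∃ v, EK k v = κ) : IsSimpleGroup (HH k) := by
  have hnt : Nontrivial (HH k) := by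
    refine ⟨⟨liftP (B (cls 0)), TT_mem k (B_cls_mem 0)⟩, 1, ?_⟩
    intro h
    have h1 := congrArg (fun g : HH k => (g : Equiv.Perm (Om K)) ⟨(0, some []), []⟩) h
    simp only [OneMemClass.coe_one, Equiv.Perm.one_apply, liftP_apply] at h1
    rw [B_some (nc_cls le_rfl) (mem_cls_self 0)] at h1
    simp at h1
  refine { exists_pair_ne := hnt.exists_pair_ne, eq_bot_or_eq_top_of_normal := fun M hM => ?_ }
  by_cases hb : M = ⊥
  · exact Or.inl hb
  · right
    have hle : HH k ≤ M.map (HH k).subtype := by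
      refine HH_le_N hk ?_ ?_ ?_
      · rintro n ⟨n', hn', rfl⟩ g hg
        exact ⟨⟨g, hg⟩ * n' * ⟨g, hg⟩⁻¹, hM.conj_mem _ hn' _, rfl⟩
      · rintro _ ⟨n', _, rfl⟩; exact n'.2
      · obtain ⟨n, hn, hn1⟩ := M.bot_or_exists_ne_one.resolve_left hb
        exact ⟨_, ⟨_, hn, rfl⟩, fun h => hn1 (Subtype.ext h)⟩
    rw [eq_top_iff]
    intro x _
    obtain ⟨y, hy, e⟩ := hle x.2
    rwa [← Subtype.ext e]

end
end LO

namespace LO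
set_option linter.unusedSectionVars false

section
variable {K : Type} [Group K] [LinearOrder K]

/-! ### Deciding triviality by testing finitely many points -/

structure Dat (K : Type) where
  d : ℤ
  x : ℕ → K
  V : ℕ → List Bool
  l2 : List (K × List Bool)

def Dl (x : ℕ → K) (V : ℕ → List Bool) (l2 : List (K × List Bool)) :
    List (K × List Bool) → List (K × List Bool)
  | [] => l2
  | (κ, u) :: l => (κ * x l.length, u ++ V l.length) :: Dl x V l2 l

def Dat.app (D : Dat K) (p : Om K) : Om K :=
  ⟨(p.q.1 + D.d, p.q.2.map (· ++ D.V p.l.length)), Dl D.x D.V D.l2 p.l⟩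

def SS (a b : K) : Prop := (a < 1 ↔ b < 1) ∧ (a = 1 ↔ b = 1)

def EntOK (k : Fin 3 → K) (x : ℕ → K) (V : ℕ → List Bool) (j : ℕ) : List (K × List Bool) → Prop
  | [] => True
  | (κ, u) :: l => (V l.length = [] ∨ j ≤ u.length) ∧
      (∀ w : List (Fin 3 × Bool), w.length ≤ j → SS (EK k w * κ) (EK k w * κ * x l.length)) ∧ EntOK k x V j l

structure Cap (k : Fin 3 → K) (D : Dat K) (j : ℕ) (p : Om K) : Prop where
  d8 : 8 ∣ D.d
  win : ∀ y, |y - p.q.1| ≤ j → (y ∈ C1 ↔ y + D.d ∈ C1)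
  c : D.V p.l.length = [] ∨ ∃ u, p.q.2 = some u ∧ j ≤ u.length
  ent : EntOK k D.x D.V j p.l
  xhi : ∀ h, p.l.length ≤ h → D.x h = 1
  vhi : ∀ h, p.l.length < h → D.V h = []
  l2 : D.l2 = [] ∨ j ≤ p.l.length

variable {k : Fin 3 → K}

lemma EntOK.mono {x : ℕ → K} {V} {j j'} (hj : j' ≤ j) : ∀ {l}, EntOK k x V j l → EntOK k x V j' l
  | [], _ => trivial
  | (_, _) :: _, ⟨h1, h2, h3⟩ => ⟨h1.imp id fun h => hj.trans h, fun w hw => h2 w (hw.trans hj), h3.mono hj⟩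

lemma EntOK.shift {x : ℕ → K} {V : ℕ → List Bool} {j : ℕ} {κ : K} {u l : ℕ} (w0 : List (Fin 3 × Bool)) (hw0 : w0.length ≤ 1)
    (h : ∀ w : List (Fin 3 × Bool), w.length ≤ j + 1 → SS (EK k w * κ) (EK k w * κ * x l)) :
    (V l = [] ∨ j + 1 ≤ u) → (V l = [] ∨ j ≤ u) ∧ ∀ w : List (Fin 3 × Bool), w.length ≤ j →
      SS (EK k w * (EK k w0 * κ)) (EK k w * (EK k w0 * κ) * x l) := by
  intro hv
  refine ⟨hv.imp id fun h => by omega, fun w hw => ?_⟩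
  have := h (w ++ w0) (by simp; omega)
  rwa [EK_append, mul_assoc (EK k w)] at this

/-- the common part of `Cap` for a placed point -/
structure Cap' (k : Fin 3 → K) (D : Dat K) (j : ℕ) (κ : K) (u : List Bool) (l : List (K × List Bool)) : Prop where
  v : D.V l.length = [] ∨ j ≤ u.length
  s : ∀ w : List (Fin 3 × Bool), w.length ≤ j → SS (EK k w * κ) (EK k w * κ * D.x l.length)
  ent : EntOK k D.x D.V j l
  xhi : ∀ h, l.length < h → D.x h = 1
  vhi : ∀ h, l.length < h → D.V h = []

lemma Cap'.ss {D : Dat K} {j κ u l} (h : Cap' k D j κ u l) : SS κ (κ * D.x l.length) := by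
  have := h.s [] (by simp)
  rwa [EK_nil, one_mul] at this

lemma Cap'.step {D : Dat K} {j κ u l} (h : Cap' k D (j + 1) κ u l) (w0 : List (Fin 3 × Bool)) (hw0 : w0.length ≤ 1) :
    Cap' k D j (EK k w0 * κ) u l := by
  obtain ⟨a, b⟩ := EntOK.shift (V := D.V) w0 hw0 h.s h.v
  exact ⟨a, b, h.ent.mono (by omega), h.xhi, h.vhi⟩

lemma app_place {D : Dat K} {κ : K} {l : List (K × List Bool)} (hs : SS κ (κ * D.x l.length)) (z : ℤ) (u) (hv : ∀ h, l.length < h → D.V h = []) :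
    D.app (place z κ u l) = place (z + D.d) (κ * D.x l.length) (u ++ D.V l.length) (Dl D.x D.V D.l2 l) := by
  rcases lt_trichotomy κ 1 with h | h | h
  · rw [place_lt h, place_lt (hs.1.1 h)]; rfl
  · subst h
    rw [hs.2.1 rfl, place_one, place_one]; rfl
  · have h1 : 1 < κ * D.x l.length := by
      rcases lt_trichotomy (κ * D.x l.length) 1 with h' | h' | h'
      · exact absurd (hs.1.2 h') h.not_gt
      · exact absurd (hs.2.2 h') h.ne'
      · exact h'
    rw [place_gt h, place_gt h1]
    simp [Dat.app, Dl]; ring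

lemma Cap.to' {D : Dat K} {j z κ u l} (h : Cap k D j (place z κ u l)) : Cap' k D j κ u l := by
  by_cases h1 : κ = 1
  · subst h1
    rw [place_one] at h
    obtain ⟨d8, win, c, ent, xhi, vhi, l2⟩ := h
    refine ⟨?_, ?_, ent, fun h hh => xhi h hh.le, vhi⟩
    · simpa using c
    · intro w _
      rw [xhi _ le_rfl, mul_one (EK k w * 1)]; exact ⟨Iff.rfl, Iff.rfl⟩
  · have h2 : ∃ z', place z κ u l = ⟨(z', none), (κ, u) :: l⟩ := by
      rcases lt_or_gt_of_ne h1 with h2 | h2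
      · exact ⟨_, place_lt h2 ..⟩
      · exact ⟨_, place_gt h2 ..⟩
    obtain ⟨z', e⟩ := h2
    rw [e] at h
    obtain ⟨d8, win, c, ⟨e1, e2, e3⟩, xhi, vhi, l2⟩ := h
    refine ⟨e1, e2, e3, xhi, fun h hh => ?_⟩
    rcases Nat.lt_or_ge (l.length + 1) h with h3 | h3
    · exact vhi h h3
    · have : h = l.length + 1 := by omega
      subst this
      simpa using c

lemma Cap'.to {D : Dat K} {j κ u l} (h : Cap' k D j κ u l) (z : ℤ) (d8 : 8 ∣ D.d)
    (win : ∀ y, |y - (place z κ u l).q.1| ≤ j → (y ∈ C1 ↔ y + D.d ∈ C1)) (l2 : D.l2 = [] ∨ j ≤ l.length) :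
    Cap k D j (place z κ u l) := by
  have hs := h.ss
  obtain ⟨v, s, ent, xhi, vhi⟩ := h
  by_cases h1 : κ = 1
  · subst h1
    rw [place_one] at win ⊢
    refine ⟨d8, win, by simpa using v, ent, fun h hh => ?_, vhi, l2⟩
    rcases Nat.lt_or_ge l.length h with h3 | h3
    · exact xhi h h3
    · obtain rfl : h = l.length := by simp at hh; omega
      simpa using hs.2
  · have h2 : ∃ z', place z κ u l = ⟨(z', none), (κ, u) :: l⟩ := by
      rcases lt_or_gt_of_ne h1 with h2 | h2
      · exact ⟨_, place_lt h2 ..⟩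
      · exact ⟨_, place_gt h2 ..⟩
    obtain ⟨z', e⟩ := h2
    rw [e] at win ⊢
    refine ⟨d8, win, Or.inl (vhi _ (by simp)), ⟨v, s, ent⟩, fun h hh => xhi h (by simp at hh; omega),
      fun h hh => vhi h (by simp at hh; omega), l2.imp id fun h => by simp; omega⟩

lemma Cap.mono {D : Dat K} {j j' p} (h : Cap k D j p) (hj : j' ≤ j) : Cap k D j' p :=
  ⟨h.d8, fun y hy => h.win y (hy.trans (by exact_mod_cast hj)), h.c.imp id fun ⟨u, h1, h2⟩ => ⟨u, h1, hj.trans h2⟩, h.ent.mono hj,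
    h.xhi, h.vhi, h.l2.imp id fun h => hj.trans h⟩

lemma win_step {D : Dat K} {j p} (h : Cap k D (j + 1) p) {z' : ℤ} (hz : |z' - p.q.1| ≤ 1) :
    ∀ y, |y - z'| ≤ j → (y ∈ C1 ↔ y + D.d ∈ C1) := by
  intro y hy
  apply h.win
  push_cast
  rw [abs_le] at *
  constructor <;> linarith

lemma step_kat {D : Dat K} {j p} (h : Cap k D (j + 1) p) (r : ℤ) (w0 : List (Fin 3 × Bool)) (hw0 : w0.length ≤ 1) :
    kat (cls r) (EK k w0) (D.app p) = D.app (kat (cls r) (EK k w0) p) ∧ Cap k D j (kat (cls r) (EK k w0) p) := by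
  have hdisp := kat_disp (cls r) (EK k w0) p
  rcases om_cases p with ⟨z, κ', u, l, rfl⟩ | ⟨z, l, hl, rfl⟩
  · have h' := h.to'
    by_cases hz : z ∈ cls r
    · have h2 := h'.step w0 hw0
      rw [kat_place hz] at hdisp ⊢
      rw [app_place h'.ss z u h'.vhi, kat_place ((cls_add h.d8 r z).1 hz), app_place h2.ss z u h2.vhi, mul_assoc]
      refine ⟨rfl, h2.to z h.d8 (win_step h hdisp) ?_⟩
      refine h.l2.imp id fun h3 => ?_
      have : (place z κ' u l).l.length ≤ l.length + 1 := by
        rcases lt_trichotomy κ' 1 with h | h | h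
        · simp [place_lt h]
        · subst h; simp [place_one]
        · simp [place_gt h]
      omega
    · rw [kat_place' hz, app_place h'.ss z u h'.vhi, kat_place' (fun h3 => hz ((cls_add h.d8 r z).2 h3))]
      exact ⟨rfl, h.mono (by omega)⟩
  · rw [kat_spec _ _ hl]
    refine ⟨kat_spec _ _ ?_, h.mono (by omega)⟩
    rcases l with _ | ⟨⟨κ, u⟩, l⟩
    · rcases h.l2 with h1 | h1
      · simp only [Dl, h1, spec]
      · simp at h1
    · obtain ⟨e1, e2, e3⟩ := h.ent
      change κ = 1 at hl
      subst hl
      have := (e2 [] (by simp)).2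
      simp only [EK_nil, one_mul] at this
      simpa [Dl, spec] using this

lemma B_app {S : Set ℤ} (hS : NC S) {V : List Bool} {c : Option (List Bool)} {j : ℕ}
    (h : V = [] ∨ ∃ u, c = some u ∧ j + 1 ≤ u.length) (z : ℤ) :
    B S (z, c.map (· ++ V)) = ((B S (z, c)).1, (B S (z, c)).2.map (· ++ V)) ∧
      (V = [] ∨ ∃ u, (B S (z, c)).2 = some u ∧ j ≤ u.length) := by
  rcases h with rfl | ⟨u, rfl, hu⟩
  · simp
  · rw [B_apply hS, B_apply hS]
    rcases u with _ | ⟨b, u⟩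
    · simp at hu
    · simp only [List.length_cons] at hu
      simp only [Bf, Option.map]
      split_ifs
      · exact ⟨by simp, Or.inr ⟨_, rfl, by simp; omega⟩⟩
      · cases b
        · exact ⟨by simp, Or.inr ⟨_, rfl, by simp; omega⟩⟩
        · exact ⟨by simp, Or.inr ⟨_, rfl, by omega⟩⟩
      · exact ⟨by simp, Or.inr ⟨_, rfl, by simp; omega⟩⟩

lemma Bi_app {S : Set ℤ} (hS : NC S) {V : List Bool} {c : Option (List Bool)} {j : ℕ}
    (h : V = [] ∨ ∃ u, c = some u ∧ j + 1 ≤ u.length) (z : ℤ) :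
    (B S)⁻¹ (z, c.map (· ++ V)) = (((B S)⁻¹ (z, c)).1, ((B S)⁻¹ (z, c)).2.map (· ++ V)) ∧
      (V = [] ∨ ∃ u, ((B S)⁻¹ (z, c)).2 = some u ∧ j ≤ u.length) := by
  rcases h with rfl | ⟨u, rfl, hu⟩
  · simp
  · rw [Bi_apply hS, Bi_apply hS]
    rcases u with _ | ⟨b, u⟩
    · simp at hu
    · simp only [List.length_cons] at hu
      simp only [Bg, Option.map]
      split_ifs
      · cases b
        · exact ⟨by simp, Or.inr ⟨_, rfl, by omega⟩⟩
        · exact ⟨by simp, Or.inr ⟨_, rfl, by simp; omega⟩⟩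
      · exact ⟨by simp, Or.inr ⟨_, rfl, by simp; omega⟩⟩
      · exact ⟨by simp, Or.inr ⟨_, rfl, by simp; omega⟩⟩

lemma step_B {D : Dat K} {j p} (h : Cap k D (j + 1) p) {S : Set ℤ} (hS : NC S)
    (hw : ∀ y, |y - p.q.1| ≤ 1 → (y ∈ S ↔ y + D.d ∈ S)) :
    liftP (B S) (D.app p) = D.app (liftP (B S) p) ∧ Cap k D j (liftP (B S) p) := by
  have h1 := hw p.q.1 (by simp)
  have h2 := hw (p.q.1 - 1) (by simp)
  obtain ⟨e1, e2⟩ := B_app hS h.c p.q.1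
  constructor
  · simp only [liftP_apply, Dat.app]
    rw [B_tau hS h1 h2, e1]
  · exact ⟨h.d8, win_step h (B_disp hS p.q), e2, h.ent.mono (by omega), h.xhi, h.vhi, h.l2.imp id fun h => by
      simp only [liftP_apply]; omega⟩

lemma step_Bi {D : Dat K} {j p} (h : Cap k D (j + 1) p) {S : Set ℤ} (hS : NC S)
    (hw : ∀ y, |y - p.q.1| ≤ 1 → (y ∈ S ↔ y + D.d ∈ S)) :
    (liftP (B S))⁻¹ (D.app p) = D.app ((liftP (B S))⁻¹ p) ∧ Cap k D j ((liftP (B S))⁻¹ p) := by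
  have h1 := hw p.q.1 (by simp)
  have h2 := hw (p.q.1 - 1) (by simp)
  obtain ⟨e1, e2⟩ := Bi_app hS h.c p.q.1
  rw [← map_inv]
  constructor
  · simp only [liftP_apply, Dat.app]
    rw [Bi_tau hS h1 h2, e1]
  · exact ⟨h.d8, win_step h (Bi_disp hS p.q), e2, h.ent.mono (by omega), h.xhi, h.vhi, h.l2.imp id fun h => by
      simp only [liftP_apply]; omega⟩

lemma step_gen {D : Dat K} {j p} (h : Cap k D (j + 2) p) (i : Fin 12) :
    (gens k i (D.app p) = D.app (gens k i p) ∧ Cap k D j (gens k i p)) ∧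
    ((gens k i)⁻¹ (D.app p) = D.app ((gens k i)⁻¹ p) ∧ Cap k D j ((gens k i)⁻¹ p)) := by
  revert i
  have hw1 : ∀ r y, |y - p.q.1| ≤ 1 → (y ∈ cls r ↔ y + D.d ∈ cls r) := fun r y _ => cls_add h.d8 r y
  have hw2 : ∀ y, |y - p.q.1| ≤ 1 → (y ∈ C1 ↔ y + D.d ∈ C1) := fun y hy => h.win y (hy.trans (by push_cast; linarith))
  apply gens_cases k (P := fun g => (g (D.app p) = D.app (g p) ∧ Cap k D j (g p)) ∧
    (g⁻¹ (D.app p) = D.app (g⁻¹ p) ∧ Cap k D j (g⁻¹ p)))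
  · intro r
    have a := step_B h (nc_cls (le_refl (cls r))) (hw1 r)
    have b := step_Bi h (nc_cls (le_refl (cls r))) (hw1 r)
    exact ⟨⟨a.1, a.2.mono (by omega)⟩, b.1, b.2.mono (by omega)⟩
  · have a := step_B h nc_C1 hw2
    have b := step_Bi h nc_C1 hw2
    exact ⟨⟨a.1, a.2.mono (by omega)⟩, b.1, b.2.mono (by omega)⟩
  · intro i
    have e1 : k i = EK k [(i, true)] := by rw [EK_cons, EK_nil, mul_one]; rfl
    have e2 : (k i)⁻¹ = EK k [(i, false)] := by rw [EK_cons, EK_nil, mul_one]; rfl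
    constructor
    · rw [cc, ← map_inv, e2, e1]
      obtain ⟨a1, a2⟩ := step_kat h 3 [(i, false)] (by simp)
      obtain ⟨b1, b2⟩ := step_kat a2 0 [(i, true)] (by simp)
      simp only [Equiv.Perm.mul_apply]
      exact ⟨by rw [a1, b1], b2⟩
    · rw [cc, mul_inv_rev, inv_inv, ← map_inv, e2, e1]
      obtain ⟨a1, a2⟩ := step_kat h 0 [(i, false)] (by simp)
      obtain ⟨b1, b2⟩ := step_kat a2 3 [(i, true)] (by simp)
      simp only [Equiv.Perm.mul_apply]
      exact ⟨by rw [a1, b1], b2⟩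

lemma step_act {D : Dat K} {p} (w : List (Fin 12 × Bool)) : ∀ {j}, Cap k D (j + 2 * w.length) p →
    act k w (D.app p) = D.app (act k w p) ∧ Cap k D j (act k w p) := by
  induction w with
  | nil => intro j h; rw [act_nil]; exact ⟨rfl, by simpa using h⟩
  | cons a w ih =>
    intro j h
    obtain ⟨i, b⟩ := a
    obtain ⟨a1, a2⟩ := ih (j := j + 2) (by simpa [mul_add, add_assoc, add_comm] using h)
    obtain ⟨⟨b1, b2⟩, b3, b4⟩ := step_gen a2 i
    rw [act_cons, Equiv.Perm.mul_apply, Equiv.Perm.mul_apply, a1]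
    cases b
    · exact ⟨b3, b4⟩
    · exact ⟨b1, b2⟩

/-! ### Test points -/

lemma window (z : ℤ) (M : ℕ) : ∃ z' : ℤ, z'.natAbs ≤ 8 ^ (M + 3) + M ∧ 8 ∣ z - z' ∧
    ∀ y, |y - z'| ≤ M → (y ∈ C1 ↔ y + (z - z') ∈ C1) := by
  set k := M + 2 with hk
  have hpow : (2 * M : ℤ) < 8 ^ k := by
    have h1 : k < 2 ^ k := Nat.lt_two_pow_self
    have h2 : 2 ^ k * 2 ^ k ≤ 8 ^ k := by
      rw [← mul_pow]; exact Nat.pow_le_pow_left (by norm_num) _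
    have h3 : 4 * M < 8 ^ k := by nlinarith
    have : 2 * M < 8 ^ k := by omega
    exact_mod_cast this
  by_cases hhole : ∃ y, |y - z| ≤ M ∧ k ≤ vv y
  · obtain ⟨y0, hy0, hv⟩ := hhole
    obtain ⟨k', hk1, hk2, hk3⟩ : ∃ k', k ≤ k' ∧ k' ≤ k + 1 ∧ (2 ∣ k' ↔ 2 ∣ vv y0) := by
      by_cases h : (2 ∣ k ↔ 2 ∣ vv y0)
      · exact ⟨k, le_rfl, by omega, h⟩
      · exact ⟨k + 1, by omega, le_rfl, by omega⟩
    have h8 : (8 : ℤ) ^ k ∣ y0 - rep1 k' := by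
      have h1 : (8 : ℤ) ^ k ∣ 7 * y0 + 1 := pow_dvd_vv.2 hv
      have h2 : (8 : ℤ) ^ k ∣ 7 * rep1 k' + 1 := pow_dvd_vv.2 (by rw [vv_rep1]; exact hk1)
      have h3 := dvd_sub h1 h2
      rw [show 7 * y0 + 1 - (7 * rep1 k' + 1) = 7 * (y0 - rep1 k') by ring] at h3
      exact IsCoprime.dvd_of_dvd_mul_left (IsCoprime.pow_left ⟨1, -1, by norm_num⟩) h3
    have hd : z - (rep1 k' - (y0 - z)) = y0 - rep1 k' := by ring
    refine ⟨rep1 k' - (y0 - z), ?_, ?_, ?_⟩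
    · have h1 := rep1_eq k'
      have h2 : (8 : ℤ) ^ k' ≤ 8 ^ (M + 3) := pow_le_pow_right₀ (by norm_num) (by omega)
      have h3 : (0 : ℤ) < 8 ^ k' := by positivity
      rw [abs_le] at hy0
      zify
      rw [abs_le]; constructor <;> linarith
    · rw [hd]; exact dvd_trans (dvd_pow_self 8 (by omega)) h8
    · intro y hy
      rw [hd]
      by_cases he : y = rep1 k'
      · subst he
        rw [show rep1 k' + (y0 - rep1 k') = y0 by ring, mem_C1, mem_C1, vv_rep1, hk3]
        constructor <;> intro h <;> exact ⟨by omega, h.2⟩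
      · have hlt : vv (y + (y0 - rep1 k')) < k := by
          by_contra hcon
          have h1 : (8 : ℤ) ^ k ∣ 7 * (y + (y0 - rep1 k')) + 1 := pow_dvd_vv.2 (not_lt.1 hcon)
          have h2 : (8 : ℤ) ^ k ∣ 7 * y0 + 1 := pow_dvd_vv.2 hv
          have h3 := dvd_sub h1 h2
          rw [show 7 * (y + (y0 - rep1 k')) + 1 - (7 * y0 + 1) = 7 * (y - rep1 k') by ring] at h3
          have h4 := IsCoprime.dvd_of_dvd_mul_left (IsCoprime.pow_left ⟨1, -1, by norm_num⟩) h3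
          apply he
          have h5 := Int.eq_zero_of_abs_lt_dvd h4 ?_
          · linarith
          · rw [abs_le] at hy hy0
            rw [abs_lt]; constructor <;> linarith
        have := vv_add hlt (dvd_neg.2 h8)
        rw [add_neg_cancel_right] at this
        rw [mem_C1, mem_C1, this]
  · push Not at hhole
    have h0 : (0 : ℤ) < 8 ^ k := by positivity
    have h1 := Int.emod_nonneg z h0.ne'
    have h2 := Int.emod_lt_of_pos z h0
    have h8 : (8 : ℤ) ^ k ∣ z - z % 8 ^ k := Int.dvd_self_sub_emod
    refine ⟨z % 8 ^ k, ?_, dvd_trans (dvd_pow_self 8 (by omega)) h8, ?_⟩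
    · zify
      have h3 : (8 : ℤ) ^ k ≤ 8 ^ (M + 3) := pow_le_pow_right₀ (by norm_num) (by omega)
      rw [abs_of_nonneg h1]; linarith
    · intro y hy
      have hlt := hhole (y + (z - z % 8 ^ k)) (by rwa [show y + (z - z % 8 ^ k) - z = y - z % 8 ^ k by ring])
      have := vv_add hlt (dvd_neg.2 h8)
      rw [add_neg_cancel_right] at this
      rw [mem_C1, mem_C1, this]

/-- the gap property of `K` -/
def GapP (k : Fin 3 → K) : Prop := ∀ (m : ℕ) (κ : K), ∃ v : List (Fin 3 × Bool), v.length ≤ 3 * m + 3 ∧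
  ∀ w : List (Fin 3 × Bool), w.length ≤ m → SS (EK k w * EK k v) (EK k w * κ)

lemma Dl_congr {x x' : ℕ → K} {V V' : ℕ → List Bool} (l2) : ∀ {l : List (K × List Bool)}, (∀ h, h < l.length → x h = x' h ∧ V h = V' h) →
    Dl x V l2 l = Dl x' V' l2 l
  | [], _ => rfl
  | (κ, u) :: l, h => by
    rw [Dl, Dl, (h l.length (by simp)).1, (h l.length (by simp)).2, Dl_congr l2 fun h' hh => h h' (by simp; omega)]

lemma EntOK_congr {x x' : ℕ → K} {V V' : ℕ → List Bool} {j} : ∀ {l : List (K × List Bool)}, (∀ h, h < l.length → x h = x' h ∧ V h = V' h) →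
    EntOK k x V j l → EntOK k x' V' j l
  | [], _, _ => trivial
  | (κ, u) :: l, h, ⟨h1, h2, h3⟩ => by
    obtain ⟨e1, e2⟩ := h l.length (by simp)
    rw [e1] at h2
    rw [e2] at h1
    exact ⟨h1, h2, EntOK_congr (fun h' hh => h h' (by simp; omega)) h3⟩

lemma test_list (hg : GapP k) (M : ℕ) (l2) : ∀ l1 : List (K × List Bool), jf l1 → ∃ l x V, l.length = l1.length ∧
    Dl x V l2 l = l1 ++ l2 ∧ EntOK k x V M l ∧ (∀ h, l1.length ≤ h → x h = 1 ∧ V h = []) ∧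
    ∀ e ∈ l, e.1 ≠ 1 ∧ e.2.length ≤ 3 * M + 3 ∧ ∃ v : List (Fin 3 × Bool), v.length ≤ 3 * M + 3 ∧ EK k v = e.1 := by
  intro l1
  induction l1 with
  | nil =>
    intro _
    exact ⟨[], fun _ => 1, fun _ => [], rfl, rfl, trivial, fun h _ => ⟨rfl, rfl⟩, by simp⟩
  | cons e l1 ih =>
    obtain ⟨κ, u⟩ := e
    intro hj
    obtain ⟨l, x, V, h1, h2, h3, h4, h5⟩ := ih fun e he => hj e (List.mem_cons_of_mem _ he)
    obtain ⟨v, hv, hs⟩ := hg M κ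
    have hκ : κ ≠ 1 := hj (κ, u) (by simp)
    have hne : EK k v ≠ 1 := by
      have := (hs [] (by simp)).2
      simp only [EK_nil, one_mul] at this
      exact fun h => hκ (this.1 h)
    set x' := Function.update x l.length ((EK k v)⁻¹ * κ) with hx'
    set V' := Function.update V l.length (u.drop M) with hV'
    have hc : ∀ h, h < l.length → x h = x' h ∧ V h = V' h := by
      intro h hh
      rw [hx', hV', Function.update_of_ne hh.ne, Function.update_of_ne hh.ne]; exact ⟨rfl, rfl⟩
    have hx1 : x' l.length = (EK k v)⁻¹ * κ := by rw [hx', Function.update_self]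
    have hV1 : V' l.length = u.drop M := by rw [hV', Function.update_self]
    refine ⟨(EK k v, u.take M) :: l, x', V', by simp [h1], ?_, ⟨?_, ?_, EntOK_congr hc h3⟩, ?_, ?_⟩
    · rw [Dl, ← Dl_congr l2 hc, h2, hx1, hV1, mul_inv_cancel_left, List.take_append_drop]; rfl
    · rw [hV1]
      by_cases h : M ≤ u.length
      · right; simp [h]
      · left; simp; omega
    · rw [hx1]
      intro w hw
      have := hs w hw
      rwa [mul_assoc, mul_inv_cancel_left]
    · intro h hh
      simp only [List.length_cons] at hh
      rw [hx', hV', Function.update_of_ne (by omega), Function.update_of_ne (by omega)]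
      exact h4 h (by omega)
    · intro e he
      rw [List.mem_cons] at he
      rcases he with rfl | he
      · exact ⟨hne, by simp; omega, v, hv, rfl⟩
      · exact h5 e he

/-- length bound for the words leading to test points -/
def LB (M : ℕ) : ℕ := M * (6 * (3 * M + 3) + 7) + (3 * (8 ^ (M + 3) + M) + 3 + (5 * M + 4))

lemma test_point (hg : GapP k) (M : ℕ) (q : Pos) (l : List (K × List Bool)) (hl : jf l) :
    ∃ (D : Dat K) (p : Om K) (γ : List (Fin 12 × Bool)), D.app p = ⟨q, l⟩ ∧ Cap k D M p ∧ γ.length ≤ LB M ∧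
      act k γ ⟨(0, none), []⟩ = p := by
  obtain ⟨z, c⟩ := q
  obtain ⟨l', x, V, h1, h2, h3, h4, h5⟩ := test_list hg M (l.drop M) (l.take M)
    fun e he => hl e (List.mem_of_mem_take he)
  rw [List.take_append_drop] at h2
  obtain ⟨z', hz1, hz2, hz3⟩ := window z M
  obtain ⟨c', V0, hc1, hc2, hc3⟩ : ∃ (c' : Option (List Bool)) (V0 : List Bool), c'.map (· ++ V0) = c ∧
      (V0 = [] ∨ ∃ u, c' = some u ∧ M ≤ u.length) ∧ sz c' ≤ 5 * M + 4 := by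
    rcases c with _ | u
    · exact ⟨none, [], rfl, Or.inl rfl, by simp [sz]⟩
    · refine ⟨some (u.take M), u.drop M, by simp, ?_, by simp [sz]⟩
      by_cases h : M ≤ u.length
      · right; exact ⟨_, rfl, by simp [h]⟩
      · left; simp; omega
  set V' := Function.update V l'.length V0 with hV'
  have hc : ∀ h, h < l'.length → x h = x h ∧ V h = V' h := by
    intro h hh
    rw [hV', Function.update_of_ne hh.ne]; exact ⟨rfl, rfl⟩
  obtain ⟨γ, hγ, e⟩ := reach (3 * M + 3) l' h5 z' c'
  refine ⟨⟨z - z', x, V', l.drop M⟩, ⟨(z', c'), l'⟩, γ, ?_, ⟨hz2, hz3, ?_, EntOK_congr hc h3, ?_, ?_, ?_⟩, ?_, e⟩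
  · simp only [Dat.app]
    rw [← Dl_congr _ hc, h2, hV', Function.update_self, hc1]; congr 2; ring
  · simp only [hV', Function.update_self]; exact hc2
  · intro h hh; exact (h4 h (by simp only at hh; omega)).1
  · intro h hh
    simp only at hh ⊢
    rw [hV', Function.update_of_ne (by omega)]
    exact (h4 h (by omega)).2
  · simp only [h1]
    by_cases h : M ≤ l.length
    · right; simp [h]
    · left; simp; omega
  · have : l'.length ≤ M := by rw [h1]; simp
    refine hγ.trans ?_
    rw [LB]
    gcongr

theorem triv_of_tests (hg : GapP k) (w : List (Fin 12 × Bool))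
    (H : ∀ γ : List (Fin 12 × Bool), γ.length ≤ LB (2 * w.length) →
      act k w (act k γ ⟨(0, none), []⟩) = act k γ ⟨(0, none), []⟩) : act k w = 1 := by
  refine eq_one_of_jf (act_mem k w) fun q l hl => ?_
  obtain ⟨D, p, γ, e1, e2, e3, e4⟩ := test_point hg (2 * w.length) q l hl
  have h1 := H γ e3
  rw [e4] at h1
  rw [← e1, (step_act (j := 0) w (by simpa using e2)).1, h1]

end
end LO

namespace LO
set_option linter.unusedSectionVars false

/-! ### Generic computability lemmas -/

section gen
variable {α β σ : Type*} [Primcodable α] [Primcodable β] [Primcodable σ]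

lemma comp_foldl {f : α → List β} {g : α → σ} {h : α → σ × β → σ} (hf : Computable f)
    (hg : Computable g) (hh : Computable₂ h) :
    Computable fun a => (f a).foldl (fun s b => h a (s, b)) (g a) := by
  have h1 : Computable fun a => Nat.rec (motive := fun _ => σ) (g a)
      (fun n s => Option.casesOn (motive := fun _ => σ) ((f a)[n]?) s (fun b => h a (s, b))) (f a).length := by
    refine Computable.nat_rec (h := fun a (p : ℕ × σ) => Option.casesOn (motive := fun _ => σ) ((f a)[p.1]?) p.2 (fun b => h a (p.2, b)))
      (Computable.list_length.comp hf) hg ?_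
    refine Computable.option_casesOn (Computable.list_getElem?.comp (hf.comp Computable.fst)
      (Computable.fst.comp Computable.snd)) (Computable.snd.comp Computable.snd) ?_
    exact hh.comp (Computable.fst.comp Computable.fst)
      (Computable.pair (Computable.snd.comp (Computable.snd.comp Computable.fst)) Computable.snd)
  refine h1.of_eq fun a => ?_
  have aux : ∀ n, n ≤ (f a).length → Nat.rec (motive := fun _ => σ) (g a)
      (fun n s => Option.casesOn (motive := fun _ => σ) ((f a)[n]?) s (fun b => h a (s, b))) n =
      ((f a).take n).foldl (fun s b => h a (s, b)) (g a) := by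
    intro n
    induction n with
    | zero => intro _; simp
    | succ n ih =>
      intro hn
      have hn' : n < (f a).length := hn
      simp only
      rw [ih hn'.le, List.take_add_one, List.foldl_append]
      simp [hn']
  rw [aux _ le_rfl, List.take_length]

lemma comp_foldr {f : α → List β} {g : α → σ} {h : α → β × σ → σ} (hf : Computable f)
    (hg : Computable g) (hh : Computable₂ h) :
    Computable fun a => (f a).foldr (fun b s => h a (b, s)) (g a) := by
  refine (comp_foldl (h := fun a (p : σ × β) => h a (p.2, p.1)) (Computable.list_reverse.comp hf) hg
    (hh.comp Computable.fst (Computable.pair (Computable.snd.comp Computable.snd)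
      (Computable.fst.comp Computable.snd)))).of_eq fun a => ?_
  simp [List.foldl_reverse]

lemma comp_list_cases {f : α → List β} {g : α → σ} {h : α → β × List β → σ} (hf : Computable f)
    (hg : Computable g) (hh : Computable₂ h) :
    Computable fun a => List.casesOn (motive := fun _ => σ) (f a) (g a) (fun b l => h a (b, l)) := by
  refine (Computable.option_casesOn (o := fun a => (f a).head?) (g := fun a b => h a (b, (f a).tail))
    (Primrec.list_head?.to_comp.comp hf) hg (hh.comp Computable.fst (Computable.pair Computable.snd
      (Primrec.list_tail.to_comp.comp (hf.comp Computable.fst))))).of_eq fun a => ?_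
  cases f a <;> rfl

lemma comp_finite [Finite α] [Inhabited α] {f : α → β → σ} (hf : ∀ a, Computable (f a)) : Computable₂ f := by
  classical
  have aux : ∀ L : List α, ∃ g : α → β → σ, Computable₂ g ∧ ∀ a ∈ L, g a = f a := by
    intro L
    induction L with
    | nil => exact ⟨fun _ => f default, (hf default).comp Computable.snd, by simp⟩
    | cons a0 L ih =>
      obtain ⟨g, h1, h2⟩ := ih
      refine ⟨fun a x => bif decide (a = a0) then f a0 x else g a x,
        Computable.cond ((Primrec.dom_finite fun a => decide (a = a0)).to_comp.comp Computable.fst)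
          ((hf a0).comp Computable.snd) h1, ?_⟩
      intro a ha
      rw [List.mem_cons] at ha
      by_cases h : a = a0
      · subst h; simp
      · simp [h, h2 a (ha.resolve_left h)]
  have := Fintype.ofFinite α
  obtain ⟨g, h1, h2⟩ := aux Finset.univ.toList
  have : g = f := funext fun a => h2 a (by simp)
  rwa [← this]

end gen

/-! ### Representations -/

abbrev KW := List (Fin 3 × Bool)
abbrev PR := (ℕ × ℕ) × Option (List Bool)
abbrev Rep := PR × List (KW × List Bool)

def pv (x : PR) : Pos := ((x.1.1 : ℤ) - x.1.2, x.2)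

section
variable {K : Type} [Group K] [LinearOrder K] (k : Fin 3 → K)

def ev (x : Rep) : Om K := ⟨pv x.1, x.2.map fun e => (EK k e.1, e.2)⟩

/-- sign -/
noncomputable def sg (a : K) : ℕ := if a < 1 then 0 else if a = 1 then 1 else 2

def Sim (h : Equiv.Perm (Om K)) : Prop := ∃ f : Rep → Rep, Computable f ∧ ∀ x, ev k (f x) = h (ev k x)

variable {k}

lemma Sim.mul {a b : Equiv.Perm (Om K)} (ha : Sim k a) (hb : Sim k b) : Sim k (a * b) := by
  obtain ⟨f, h1, h2⟩ := ha
  obtain ⟨g, h3, h4⟩ := hb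
  exact ⟨f ∘ g, h1.comp h3, fun x => by rw [Function.comp, h2, h4]; rfl⟩

lemma Sim_liftP {σ : Equiv.Perm Pos} (f : PR → PR) (hf : Primrec f) (h : ∀ x, pv (f x) = σ (pv x)) :
    Sim k (liftP σ) :=
  ⟨fun x => (f x.1, x.2), Computable.pair (hf.to_comp.comp Computable.fst) Computable.snd, fun x => by
    simp only [ev, liftP_apply, h]⟩

/-- one forward move out of the upper half -/
def Tf : Option (List Bool) → Option (List Bool) × Bool
  | none => (some [], true)
  | some [] => (none, false)
  | some (false :: u) => (some (true :: u), true)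
  | some (true :: u) => (some u, false)

/-- one backward move -/
def Uf : Option (List Bool) → Option (List Bool) × Bool
  | none => (none, false)
  | some [] => (none, true)
  | some (false :: u) => (some u, false)
  | some (true :: u) => (some (false :: u), true)

lemma Tf_prim : Primrec Tf := by
  refine (Primrec.option_casesOn (f := fun _ => (some [], true)) (g := fun _ u => List.casesOn (motive := fun _ => Option (List Bool) × Bool) u (none, false)
    (fun b u => bif b then (some u, false) else (some (true :: u), true))) Primrec.id (Primrec.const _) ?_).of_eq ?_
  · refine Primrec.list_casesOn (h := fun _ (p : Bool × List Bool) => bif p.1 then (some p.2, false) else (some (true :: p.2), true)) Primrec.snd (Primrec.const _) ?_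
    refine Primrec.cond (Primrec.fst.comp Primrec.snd) ?_ ?_
    · exact Primrec.pair (Primrec.option_some.comp (Primrec.snd.comp Primrec.snd)) (Primrec.const _)
    · exact Primrec.pair (Primrec.option_some.comp (Primrec.list_cons.comp (Primrec.const _) (Primrec.snd.comp Primrec.snd))) (Primrec.const _)
  · rintro (_ | _ | ⟨_ | _, u⟩) <;> rfl

lemma Uf_prim : Primrec Uf := by
  refine (Primrec.option_casesOn (f := fun _ => (none, false)) (g := fun _ u => List.casesOn (motive := fun _ => Option (List Bool) × Bool) u (none, true)
    (fun b u => bif b then (some (false :: u), true) else (some u, false))) Primrec.id (Primrec.const _) ?_).of_eq ?_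
  · refine Primrec.list_casesOn (h := fun _ (p : Bool × List Bool) => bif p.1 then (some (false :: p.2), true) else (some p.2, false)) Primrec.snd (Primrec.const _) ?_
    refine Primrec.cond (Primrec.fst.comp Primrec.snd) ?_ ?_
    · exact Primrec.pair (Primrec.option_some.comp (Primrec.list_cons.comp (Primrec.const _) (Primrec.snd.comp Primrec.snd))) (Primrec.const _)
    · exact Primrec.pair (Primrec.option_some.comp (Primrec.snd.comp Primrec.snd)) (Primrec.const _)
  · rintro (_ | _ | ⟨_ | _, u⟩) <;> rfl

lemma consmap_prim : Primrec fun c : Option (List Bool) => c.map (false :: ·) :=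
  Primrec.option_map₁ (Primrec.list_cons.comp (Primrec.const _) Primrec.id)
lemma conselim_prim : Primrec fun c : Option (List Bool) => (some (Option.casesOn (motive := fun _ => List Bool) c [] (true :: ·))) :=
  Primrec.option_some.comp (Primrec.option_casesOn Primrec.id (Primrec.const _) (Primrec.list_cons.comp (Primrec.const _) Primrec.snd))

lemma Sim_B {S : Set ℤ} (hS : NC S) (m : ℕ × ℕ → Bool) (hm : Primrec m)
    (h : ∀ a b : ℕ, m (a, b) = true ↔ (a : ℤ) - b ∈ S) : Sim k (liftP (B S)) := by
  have hm0 : Primrec fun x : PR => m x.1 := hm.comp Primrec.fst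
  have hm1 : Primrec fun x : PR => m (x.1.1, x.1.2 + 1) := hm.comp (Primrec.pair (Primrec.fst.comp Primrec.fst)
    (Primrec.succ.comp (Primrec.snd.comp Primrec.fst)))
  have hT : Primrec fun x : PR => Tf x.2 := Tf_prim.comp Primrec.snd
  refine Sim_liftP (fun x => bif m x.1 then (x.1, x.2.map (false :: ·)) else
    bif m (x.1.1, x.1.2 + 1) then ((x.1.1, bif (Tf x.2).2 then x.1.2 + 1 else x.1.2), (Tf x.2).1) else x) ?_ ?_
  · refine Primrec.cond hm0 (Primrec.pair Primrec.fst (consmap_prim.comp Primrec.snd)) (Primrec.cond hm1 ?_ Primrec.id)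
    refine Primrec.pair (Primrec.pair (Primrec.fst.comp Primrec.fst) (Primrec.cond (Primrec.snd.comp hT) ?_ ?_)) (Primrec.fst.comp hT)
    · exact Primrec.succ.comp (Primrec.snd.comp Primrec.fst)
    · exact (Primrec.snd.comp Primrec.fst)
  · rintro ⟨⟨a, b⟩, c⟩
    have h0 := h a b
    have h1 := h a (b + 1)
    rw [show (a : ℤ) - ((b + 1 : ℕ) : ℤ) = a - b - 1 by push_cast; ring] at h1
    rw [B_apply hS]
    simp only [pv, Bf]
    by_cases e0 : m (a, b) = true
    · rcases c with _ | u <;> simp [e0, h0.1 e0]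
    · have f0 : (a : ℤ) - b ∉ S := fun h => e0 (h0.2 h)
      by_cases e1 : m (a, b + 1) = true
      · rcases c with _ | _ | ⟨_ | _, u⟩ <;> simp [e0, e1, f0, h1.1 e1, Tf] <;> ring
      · have f1 : (a : ℤ) - b - 1 ∉ S := fun h => e1 (h1.2 h)
        simp [e0, e1, f0, f1]

lemma Sim_Bi {S : Set ℤ} (hS : NC S) (m : ℕ × ℕ → Bool) (hm : Primrec m)
    (h : ∀ a b : ℕ, m (a, b) = true ↔ (a : ℤ) - b ∈ S) : Sim k (liftP (B S))⁻¹ := by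
  have hm0 : Primrec fun x : PR => m x.1 := hm.comp Primrec.fst
  have hm1 : Primrec fun x : PR => m (x.1.1, x.1.2 + 1) := hm.comp (Primrec.pair (Primrec.fst.comp Primrec.fst)
    (Primrec.succ.comp (Primrec.snd.comp Primrec.fst)))
  have hT : Primrec fun x : PR => Uf x.2 := Uf_prim.comp Primrec.snd
  rw [← map_inv]
  refine Sim_liftP (fun x => bif m x.1 then ((bif (Uf x.2).2 then x.1.1 + 1 else x.1.1, x.1.2), (Uf x.2).1) else
    bif m (x.1.1, x.1.2 + 1) then (x.1, some (Option.casesOn (motive := fun _ => List Bool) x.2 [] (true :: ·))) else x) ?_ ?_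
  · refine Primrec.cond hm0 ?_ (Primrec.cond hm1 (Primrec.pair Primrec.fst (conselim_prim.comp Primrec.snd)) Primrec.id)
    refine Primrec.pair (Primrec.pair (Primrec.cond (Primrec.snd.comp hT) ?_ ?_) (Primrec.snd.comp Primrec.fst)) (Primrec.fst.comp hT)
    · exact Primrec.succ.comp (Primrec.fst.comp Primrec.fst)
    · exact (Primrec.fst.comp Primrec.fst)
  · rintro ⟨⟨a, b⟩, c⟩
    have h0 := h a b
    have h1 := h a (b + 1)
    rw [show (a : ℤ) - ((b + 1 : ℕ) : ℤ) = a - b - 1 by push_cast; ring] at h1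
    rw [Bi_apply hS]
    simp only [pv, Bg]
    by_cases e0 : m (a, b) = true
    · rcases c with _ | _ | ⟨_ | _, u⟩ <;> simp [e0, h0.1 e0, Uf] <;> ring
    · have f0 : (a : ℤ) - b ∉ S := fun h => e0 (h0.2 h)
      by_cases e1 : m (a, b + 1) = true
      · rcases c with _ | u <;> simp [e0, e1, f0, h1.1 e1]
      · have f1 : (a : ℤ) - b - 1 ∉ S := fun h => e1 (h1.2 h)
        simp [e0, e1, f0, f1]

/-- membership in a class -/
def mcls (r : ℕ) (x : ℕ × ℕ) : Bool := decide ((x.1 + 7 * x.2 + 7 * r) % 8 = 0)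

lemma mcls_prim (r : ℕ) : Primrec (mcls r) := by
  refine PrimrecPred.decide (Primrec.eq.comp (Primrec.nat_mod.comp (Primrec.nat_add.comp (Primrec.nat_add.comp Primrec.fst
    (Primrec.nat_mul.comp (Primrec.const 7) Primrec.snd)) (Primrec.const (7 * r))) (Primrec.const 8)) (Primrec.const 0))

lemma mcls_iff (r a b : ℕ) : mcls r (a, b) = true ↔ (a : ℤ) - b ∈ cls r := by
  simp only [mcls, decide_eq_true_eq, mem_cls]; omega

/-- `|7 z + 1|` -/
def n71 (x : ℕ × ℕ) : ℕ := (7 * x.1 + 1 - 7 * x.2) + (7 * x.2 - (7 * x.1 + 1))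

lemma n71_prim : Primrec n71 := by
  have h1 : Primrec fun x : ℕ × ℕ => 7 * x.1 + 1 := Primrec.succ.comp (Primrec.nat_mul.comp (Primrec.const 7) Primrec.fst)
  have h2 : Primrec fun x : ℕ × ℕ => 7 * x.2 := Primrec.nat_mul.comp (Primrec.const 7) Primrec.snd
  exact Primrec.nat_add.comp (Primrec.nat_sub.comp h1 h2) (Primrec.nat_sub.comp h2 h1)

lemma pow8_prim : Primrec fun v : ℕ => 8 ^ v := by
  refine (Primrec.nat_rec₁ (f := fun _ n => n * 8) 1 (Primrec.nat_mul.comp Primrec.snd (Primrec.const 8))).of_eq fun n => ?_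
  induction n with
  | zero => rfl
  | succ n ih => rw [pow_succ, ← ih]

def vvN (x : ℕ × ℕ) : ℕ := Nat.findGreatest (fun v => n71 x % 8 ^ v = 0) (n71 x)

lemma vvN_prim : Primrec vvN := by
  refine Primrec.nat_findGreatest n71_prim ?_
  exact Primrec.eq.comp (Primrec.nat_mod.comp (n71_prim.comp Primrec.fst) (pow8_prim.comp Primrec.snd)) (Primrec.const 0)

lemma vvN_eq (a b : ℕ) : vvN (a, b) = vv ((a : ℤ) - b) := by
  have key : ∀ v, n71 (a, b) % 8 ^ v = 0 ↔ v ≤ vv ((a : ℤ) - b) := by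
    intro v
    rw [← pow_dvd_vv, ← Nat.dvd_iff_mod_eq_zero]
    have h1 : ((n71 (a, b) : ℕ) : ℤ) = |7 * ((a : ℤ) - b) + 1| := by
      simp only [n71]
      rcases le_total 0 (7 * ((a : ℤ) - b) + 1) with h | h
      · rw [abs_of_nonneg h]; omega
      · rw [abs_of_nonpos h]; omega
    rw [← Int.natCast_dvd_natCast, h1, dvd_abs]; push_cast; rfl
  have hpos : 0 < n71 (a, b) := by simp only [n71]; omega
  have hle : vv ((a : ℤ) - b) ≤ n71 (a, b) := by
    have h1 := (key _).2 le_rfl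
    have h2 := Nat.le_of_dvd hpos (Nat.dvd_of_mod_eq_zero h1)
    exact (Nat.lt_pow_self (by norm_num : 1 < 8)).le.trans h2
  apply le_antisymm
  · rw [← key]
    exact Nat.findGreatest_spec (P := fun v => n71 (a, b) % 8 ^ v = 0) (m := 0) (by omega) (by simp [Nat.mod_one])
  · exact Nat.le_findGreatest hle ((key _).2 le_rfl)

def mC1 (x : ℕ × ℕ) : Bool := decide (2 ≤ vvN x) && decide (vvN x % 2 = 0)

lemma mC1_prim : Primrec mC1 :=
  Primrec.and.comp (PrimrecPred.decide (Primrec.nat_le.comp (Primrec.const 2) vvN_prim))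
    (PrimrecPred.decide (Primrec.eq.comp (Primrec.nat_mod.comp vvN_prim (Primrec.const 2)) (Primrec.const 0)))

lemma mC1_iff (a b : ℕ) : mC1 (a, b) = true ↔ (a : ℤ) - b ∈ C1 := by
  rw [mem_C1, ← vvN_eq]
  simp [mC1]
  omega

end
end LO

namespace LO
set_option linter.unusedSectionVars false

/-! ### The action of the base group is computable -/

section gen
variable {α β σ : Type*} [Primcodable α] [Primcodable β] [Primcodable σ]

lemma comp_ite {c : α → Prop} [DecidablePred c] {f g : α → σ} (hc : Computable fun a => decide (c a))
    (hf : Computable f) (hg : Computable g) : Computable fun a => if c a then f a else g a :=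
  (Computable.cond hc hf hg).of_eq fun a => by by_cases h : c a <;> simp [h]

lemma comp_eqn {s : α → ℕ} (hs : Computable s) (n : ℕ) : Computable fun a => decide (s a = n) :=
  (Primrec.eq.decide : Primrec₂ fun a b : ℕ => decide (a = b)).to_comp.comp hs (Computable.const n)

/-- three-way selection -/
def sel {σ : Type*} (s : ℕ) (f g h : σ) : σ := if s = 0 then f else if s = 1 then g else h

lemma comp_sel {s : α → ℕ} {f g h : α → σ} (hs : Computable s) (hf : Computable f)
    (hg : Computable g) (hh : Computable h) : Computable fun a => sel (s a) (f a) (g a) (h a) :=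
  comp_ite (comp_eqn hs 0) hf (comp_ite (comp_eqn hs 1) hg hh)
end gen

section
variable {K : Type} [Group K] [LinearOrder K] {k : Fin 3 → K}

lemma sg_lt {a : K} (h : a < 1) : sg a = 0 := by simp [sg, h]
lemma sg_one : sg (1 : K) = 1 := by simp [sg]
lemma sg_gt {a : K} (h : 1 < a) : sg a = 2 := by simp [sg, h.not_gt, h.ne']

abbrev PArg := (ℕ × ℕ) × KW × List Bool × List (KW × List Bool)

def placeR (s : KW → ℕ) (x : PArg) : Rep :=
  sel (s x.2.1) ((x.1, none), (x.2.1, x.2.2.1) :: x.2.2.2) ((x.1, some x.2.2.1), x.2.2.2)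
    (((x.1.1 + 1, x.1.2), none), (x.2.1, x.2.2.1) :: x.2.2.2)

lemma placeR_comp {s : KW → ℕ} (hs : Computable s) : Computable (placeR s) := by
  have h1 : Computable fun x : PArg => x.1 := Computable.fst
  have h2 : Computable fun x : PArg => x.2.1 := Computable.fst.comp Computable.snd
  have h3 : Computable fun x : PArg => x.2.2.1 := Computable.fst.comp (Computable.snd.comp Computable.snd)
  have h4 : Computable fun x : PArg => x.2.2.2 := Computable.snd.comp (Computable.snd.comp Computable.snd)
  have h5 := Computable.list_cons.comp (h2.pair h3) h4
  refine comp_sel (hs.comp h2) ((h1.pair (Computable.const none)).pair h5)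
    ((h1.pair (Computable.option_some.comp h3)).pair h4) (((Computable.pair (Computable.succ.comp
      (Computable.fst.comp h1)) (Computable.snd.comp h1)).pair (Computable.const none)).pair h5)

lemma ev_placeR (z : ℕ × ℕ) (v u l) : ev k (placeR (fun v => sg (EK k v)) (z, v, u, l)) =
    place ((z.1 : ℤ) - z.2) (EK k v) u (l.map fun e => (EK k e.1, e.2)) := by
  rcases lt_trichotomy (EK k v) 1 with h | h | h
  · rw [place_lt h]; simp [placeR, sel, sg_lt h, ev, pv]
  · rw [h, place_one]; simp [placeR, sel, h, sg_one, ev, pv]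
  · rw [place_gt h]; simp [placeR, sel, sg_gt h, ev, pv]; ring

/-- inverse of placement -/
def unplaceR (s : KW → ℕ) (x : Rep) : Option PArg :=
  Option.casesOn (motive := fun _ => Option PArg) x.1.2
    (List.casesOn (motive := fun _ => Option PArg) x.2 none fun e l =>
      sel (s e.1) (some (x.1.1, e.1, e.2, l)) none (some ((x.1.1.1, x.1.1.2 + 1), e.1, e.2, l)))
    (fun u => some (x.1.1, [], u, x.2))

lemma unplaceR_comp {s : KW → ℕ} (hs : Computable s) : Computable (unplaceR s) := by
  have h1 : Computable fun x : Rep => x.1.1 := Computable.fst.comp Computable.fst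
  refine Computable.option_casesOn (Computable.snd.comp Computable.fst) ?_ ?_
  · refine comp_list_cases (h := fun (x : Rep) (p : (KW × List Bool) × List (KW × List Bool)) =>
      sel (s p.1.1) (some (x.1.1, p.1.1, p.1.2, p.2)) none (some ((x.1.1.1, x.1.1.2 + 1), p.1.1, p.1.2, p.2)))
      Computable.snd (Computable.const _) ?_
    have h2 : Computable fun y : Rep × ((KW × List Bool) × List (KW × List Bool)) => (y.2.1.1, y.2.1.2, y.2.2) :=
      Computable.pair (Computable.fst.comp (Computable.fst.comp Computable.snd))
        (Computable.pair (Computable.snd.comp (Computable.fst.comp Computable.snd)) (Computable.snd.comp Computable.snd))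
    have h0 : Computable fun y : Rep × ((KW × List Bool) × List (KW × List Bool)) => y.1.1.1 := h1.comp Computable.fst
    have hA : Computable fun y : Rep × ((KW × List Bool) × List (KW × List Bool)) =>
        (some (y.1.1.1, y.2.1.1, y.2.1.2, y.2.2) : Option PArg) := Computable.option_some.comp (h0.pair h2)
    have hB : Computable fun y : Rep × ((KW × List Bool) × List (KW × List Bool)) =>
        (some ((y.1.1.1.1, y.1.1.1.2 + 1), y.2.1.1, y.2.1.2, y.2.2) : Option PArg) :=
      Computable.option_some.comp (Computable.pair (Computable.pair
        (Computable.fst.comp h0) (Computable.succ.comp (Computable.snd.comp h0))) h2)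
    have h3 : Computable fun y : Rep × ((KW × List Bool) × List (KW × List Bool)) => s y.2.1.1 :=
      hs.comp (Computable.fst.comp (Computable.fst.comp Computable.snd))
    exact (comp_sel h3 hA (Computable.const none) hB :)
  · exact Computable.option_some.comp ((h1.comp Computable.fst).pair (Computable.pair (Computable.const _)
      (Computable.pair Computable.snd (Computable.snd.comp Computable.fst))))

lemma unplaceR_none (x : Rep) (h : unplaceR (fun v => sg (EK k v)) x = none) :
    ∃ z l, spec l ∧ ev k x = ⟨(z, none), l⟩ := by
  obtain ⟨⟨z, _ | u⟩, _ | ⟨⟨v, u'⟩, l⟩⟩ := x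
  · exact ⟨_, [], trivial, rfl⟩
  · rcases lt_trichotomy (EK k v) 1 with h1 | h1 | h1
    · simp [unplaceR, sel, sg_lt h1] at h
    · exact ⟨_, (EK k v, u') :: l.map fun e => (EK k e.1, e.2), h1, rfl⟩
    · simp [unplaceR, sel, sg_gt h1] at h
  · simp [unplaceR] at h
  · simp [unplaceR] at h

lemma unplaceR_some (x : Rep) {z v u l} (h : unplaceR (fun v => sg (EK k v)) x = some (z, v, u, l)) :
    ev k x = place ((z.1 : ℤ) - z.2) (EK k v) u (l.map fun e => (EK k e.1, e.2)) := by
  obtain ⟨⟨z, _ | u⟩, _ | ⟨⟨v, u'⟩, l⟩⟩ := x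
  · simp [unplaceR] at h
  · rcases lt_trichotomy (EK k v) 1 with h1 | h1 | h1
    · simp [unplaceR, sel, sg_lt h1] at h
      obtain ⟨rfl, rfl, rfl, rfl⟩ := h
      rw [place_lt h1]; rfl
    · simp [unplaceR, sel, h1, sg_one] at h
    · simp [unplaceR, sel, sg_gt h1] at h
      obtain ⟨rfl, rfl, rfl, rfl⟩ := h
      rw [place_gt h1]; simp [ev, pv]; ring
  · simp [unplaceR] at h
    obtain ⟨rfl, rfl, rfl, rfl⟩ := h
    rw [EK_nil, place_one]; rfl
  · simp [unplaceR] at h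
    obtain ⟨rfl, rfl, rfl, rfl⟩ := h
    rw [EK_nil, place_one]; rfl

lemma Sim_kat (hs : Computable fun v : KW => sg (EK k v)) (r : ℕ) (w : KW) : Sim k (kat (cls r) (EK k w)) := by
  refine ⟨fun x => Option.casesOn (motive := fun _ => Rep) (unplaceR (fun v => sg (EK k v)) x) x
    (fun y => bif mcls r y.1 then placeR (fun v => sg (EK k v)) (y.1, w ++ y.2.1, y.2.2) else x), ?_, ?_⟩
  · refine Computable.option_casesOn (unplaceR_comp hs) Computable.id ?_
    refine Computable.cond ((mcls_prim r).to_comp.comp (Computable.fst.comp Computable.snd)) ((placeR_comp hs).comp ?_) Computable.fst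
    exact (Computable.fst.comp Computable.snd).pair ((Computable.list_append.comp (Computable.const w)
      (Computable.fst.comp (Computable.snd.comp Computable.snd))).pair (Computable.snd.comp (Computable.snd.comp Computable.snd)))
  · intro x
    rcases e : unplaceR (fun v => sg (EK k v)) x with _ | ⟨z, v, u, l⟩
    · obtain ⟨z, l, h1, h2⟩ := unplaceR_none x e
      simp only [e]
      rw [h2, kat_spec _ _ h1]
    · have h2 := unplaceR_some x e
      simp only [e]
      by_cases hz : mcls r z = true
      · rw [h2, kat_place ((mcls_iff r z.1 z.2).1 hz), hz, cond_true, ev_placeR, EK_append]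
      · have hz' : (z.1 : ℤ) - z.2 ∉ cls r := fun h => hz ((mcls_iff r z.1 z.2).2 h)
        rw [Bool.not_eq_true] at hz
        rw [hz, cond_false, h2, kat_place' hz']

lemma EK_one (i : Fin 3) : EK k [(i, true)] = k i := by simp [EK_cons, EK_nil]

lemma Sim_gens (hs : Computable fun v : KW => sg (EK k v)) (i : Fin 12) : Sim k (gens k i) := by
  rw [gens]
  split_ifs
  · exact Sim_B (nc_cls le_rfl) _ (mcls_prim _) (mcls_iff _)
  · exact Sim_B nc_C1 _ mC1_prim mC1_iff
  · rw [← EK_one (k := k), cc, ← map_inv, ← EK_inv]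
    exact (Sim_kat hs 0 _).mul (Sim_kat hs 3 _)

lemma Sim_gens_inv (hs : Computable fun v : KW => sg (EK k v)) (i : Fin 12) : Sim k (gens k i)⁻¹ := by
  rw [gens]
  split_ifs
  · exact Sim_Bi (nc_cls le_rfl) _ (mcls_prim _) (mcls_iff _)
  · exact Sim_Bi nc_C1 _ mC1_prim mC1_iff
  · rw [← EK_one (k := k), cc, mul_inv_rev, inv_inv, ← map_inv, ← EK_inv]
    exact (Sim_kat hs 3 _).mul (Sim_kat hs 0 _)

lemma exists_run (hs : Computable fun v : KW => sg (EK k v)) :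
    ∃ run : List (Fin 12 × Bool) → Rep → Rep, Computable₂ run ∧ ∀ w x, ev k (run w x) = act k w (ev k x) := by
  have h : ∀ a : Fin 12 × Bool, Sim k (cond a.2 (gens k a.1) (gens k a.1)⁻¹) := by
    rintro ⟨i, _ | _⟩
    · exact Sim_gens_inv hs i
    · exact Sim_gens hs i
  choose st h1 h2 using h
  have h3 : Computable₂ st := comp_finite h1
  refine ⟨fun w x => w.foldr st x, ?_, ?_⟩
  · exact comp_foldr (f := fun p : List (Fin 12 × Bool) × Rep => p.1) (g := fun p => p.2) (h := fun _ q => st q.1 q.2)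
      Computable.fst Computable.snd (h3.comp (Computable.fst.comp Computable.snd) (Computable.snd.comp Computable.snd))
  · intro w x
    induction w with
    | nil => simp [act_nil]
    | cons a w ih => obtain ⟨i, b⟩ := a; simp only at ih; simp only; rw [List.foldr_cons, h2, ih, act_cons]; rfl

/-- base point -/
def oo : Om K := ⟨(0, none), []⟩
def oR : Rep := (((0, 0), none), [])
lemma ev_oR : ev k oR = oo := by simp [ev, oR, oo, pv]

/-- comparison with the base point -/
def sgO (s : KW → ℕ) (x : Rep) : ℕ :=
  if x.1.1.1 < x.1.1.2 then 0 else if x.1.1.2 < x.1.1.1 then 2 else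
    Option.casesOn (motive := fun _ => ℕ) x.1.2 (List.casesOn (motive := fun _ => ℕ) x.2 1
      (fun e _ => sel (s e.1) 2 0 0)) (fun _ => 2)

lemma sgO_comp {s : KW → ℕ} (hs : Computable s) : Computable (sgO s) := by
  have h1 : Computable fun x : Rep => x.1.1.1 := Computable.fst.comp (Computable.fst.comp Computable.fst)
  have h2 : Computable fun x : Rep => x.1.1.2 := Computable.snd.comp (Computable.fst.comp Computable.fst)
  have hl : Computable₂ fun a b : ℕ => decide (a < b) := (Primrec.nat_lt.decide : Primrec₂ _).to_comp
  refine comp_ite (hl.comp h1 h2) (Computable.const _) (comp_ite (hl.comp h2 h1) (Computable.const _) ?_)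
  refine Computable.option_casesOn (Computable.snd.comp Computable.fst) ?_ (Computable.const _)
  refine comp_list_cases (h := fun (x : Rep) (p : (KW × List Bool) × List (KW × List Bool)) =>
      sel (s p.1.1) 2 0 0) Computable.snd (Computable.const _) ?_
  exact comp_sel (hs.comp (Computable.fst.comp (Computable.fst.comp Computable.snd))) (Computable.const _)
    (Computable.const _) (Computable.const _)

lemma sgO_spec (x : Rep) : (sgO (fun v => sg (EK k v)) x = 0 ∧ ev k x < oo) ∨
    (sgO (fun v => sg (EK k v)) x = 1 ∧ ev k x = oo) ∨ (sgO (fun v => sg (EK k v)) x = 2 ∧ oo < ev k x) := by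
  obtain ⟨⟨⟨a, b⟩, c⟩, l⟩ := x
  simp only [om_lt, pval_lt, oo, ev, pv, Om.mk.injEq, Prod.mk.injEq]
  rcases lt_trichotomy a b with h | h | h
  · left; exact ⟨by simp [sgO, h], by left; left; omega⟩
  · subst h
    rcases c with _ | u
    · rcases l with _ | ⟨⟨v, u⟩, l⟩
      · right; left; simp [sgO]
      · rcases lt_or_ge (EK k v) 1 with h1 | h1
        · right; right
          simp [sgO, sel, sg_lt h1, keyl_nil_lt, h1]
        · left
          refine ⟨?_, by simp [keyl_lt_nil, h1]⟩
          rcases h1.eq_or_lt with h2 | h2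
          · simp [sgO, sel, ← h2, sg_one]
          · simp [sgO, sel, sg_gt h2]
    · right; right
      simp [sgO, fr_none, fr_some, dy_pos]
  · right; right
    exact ⟨by simp [sgO, h, h.not_gt], by left; left; omega⟩

/-- bound on codes of short words -/
lemma exists_code_bound : ∃ f : ℕ → ℕ, Computable f ∧ ∀ γ : List (Fin 12 × Bool), ∀ n, γ.length ≤ n →
    Encodable.encode γ ≤ f n := by
  obtain ⟨C, hC⟩ : ∃ C, ∀ a : Fin 12 × Bool, Encodable.encode a ≤ C :=
    ⟨Finset.univ.sup fun a : Fin 12 × Bool => Encodable.encode a, fun a =>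
      Finset.le_sup (f := fun a : Fin 12 × Bool => Encodable.encode a) (Finset.mem_univ a)⟩
  refine ⟨fun n => Nat.rec (motive := fun _ => ℕ) 0 (fun _ M => Nat.succ (Nat.pair C M)) n, ?_, ?_⟩
  · exact (Primrec.nat_rec₁ (f := fun _ M => Nat.succ (Nat.pair C M)) 0
      (Primrec.succ.comp (Primrec₂.natPair.comp (Primrec.const C) Primrec.snd))).to_comp
  · intro γ
    induction γ with
    | nil => intro n _; simp
    | cons a γ ih =>
      intro n hn
      rcases n with _ | n
      · simp at hn
      · rw [Encodable.encode_list_cons]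
        refine Nat.succ_le_succ ?_
        have h1 := ih n (by simpa using hn)
        rcases (hC a).eq_or_lt with h2 | h2 <;> rcases h1.eq_or_lt with h3 | h3
        · rw [h2, h3]
        · rw [h2]; exact (Nat.pair_lt_pair_right _ h3).le
        · rw [h3]; exact (Nat.pair_lt_pair_left _ h2).le
        · exact ((Nat.pair_lt_pair_right _ h3).trans (Nat.pair_lt_pair_left _ h2)).le

lemma LB_prim : Primrec LB := by
  have h3 : ∀ (c : ℕ) {f : ℕ → ℕ}, Primrec f → Primrec fun x => c * f x := fun c f hf =>
    Primrec.nat_mul.comp (Primrec.const c) hf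
  have ha : ∀ {f g : ℕ → ℕ}, Primrec f → Primrec g → Primrec fun x => f x + g x := fun hf hg =>
    Primrec.nat_add.comp hf hg
  have hc : ∀ c : ℕ, Primrec fun _ : ℕ => c := fun c => Primrec.const c
  have hi : Primrec fun x : ℕ => x := Primrec.id
  exact ha (Primrec.nat_mul.comp hi (ha (h3 6 (ha (h3 3 hi) (hc 3))) (hc 7)))
    (ha (ha (h3 3 (ha (pow8_prim.comp (ha hi (hc 3))) hi)) (hc 3)) (ha (h3 5 hi) (hc 4)))

/-- the `j`-th word -/
def gam (j : ℕ) : List (Fin 12 × Bool) := (Encodable.decode j).getD []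
lemma gam_encode (γ : List (Fin 12 × Bool)) : gam (Encodable.encode γ) = γ := by simp [gam]
lemma gam_comp : Computable gam :=
  Computable.option_getD Computable.decode (Computable.const [])

variable (k)
noncomputable def hkey (h : HH k) : Lex (ℕ → Om K) := toLex fun j => h.1 (act k (gam j) oo)

variable {k}
lemma hkey_inj (hk : ∀ κ, ∃ v, EK k v = κ) : Function.Injective (hkey k) := by
  intro h h' e
  have e1 : ∀ j, h.1 (act k (gam j) oo) = h'.1 (act k (gam j) oo) := fun j => congrFun (toLex.injective e) j
  have e2 : h'⁻¹ * h = 1 := by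
    apply Subtype.ext
    refine eq_one_of_jf (k := k) (h'⁻¹ * h).2 fun q l hl => ?_
    have : ∃ m, ∀ e ∈ l, e.1 ≠ 1 ∧ e.2.length ≤ m ∧ ∃ v : List (Fin 3 × Bool), v.length ≤ m ∧ EK k v = e.1 := by
      clear e e1
      induction l with
      | nil => exact ⟨0, by simp⟩
      | cons e l ih =>
        obtain ⟨m, hm⟩ := ih fun e he => hl e (List.mem_cons_of_mem _ he)
        obtain ⟨v, hv⟩ := hk e.1
        refine ⟨m + e.2.length + v.length, fun e' he' => ?_⟩
        rcases List.mem_cons.1 he' with rfl | he'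
        · exact ⟨hl _ List.mem_cons_self, by omega, v, by omega, hv⟩
        · obtain ⟨h1, h2, v', h3, h4⟩ := hm e' he'
          exact ⟨h1, by omega, v', by omega, h4⟩
    obtain ⟨m, hm⟩ := this
    obtain ⟨w, -, hw⟩ := reach m l hm q.1 q.2
    have e3 := e1 (Encodable.encode w)
    rw [gam_encode, oo, hw] at e3
    change h'.1⁻¹ (h.1 ⟨q, l⟩) = ⟨q, l⟩
    rw [Equiv.Perm.inv_eq_iff_eq]
    exact e3
  exact (inv_mul_eq_one.1 e2).symm

/-- first non-neutral value -/
def firstD (D : ℕ → ℕ) (N : ℕ) : ℕ := Nat.rec (motive := fun _ => ℕ) 1 (fun j s => if s = 1 then D j else s) N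

lemma firstD_spec (D : ℕ → ℕ) (N : ℕ) : (firstD D N = 1 ∧ ∀ j < N, D j = 1) ∨
    (∃ j, j < N ∧ (∀ i < j, D i = 1) ∧ D j ≠ 1 ∧ firstD D N = D j) := by
  induction N with
  | zero => left; exact ⟨rfl, by simp⟩
  | succ n ih =>
    have e : firstD D (n + 1) = if firstD D n = 1 then D n else firstD D n := rfl
    rcases ih with ⟨h1, h2⟩ | ⟨j, h0, h1, h2, h3⟩
    · rw [if_pos h1] at e
      by_cases h : D n = 1
      · left; refine ⟨by rw [e, h], fun j hj => ?_⟩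
        rcases Nat.lt_succ_iff_lt_or_eq.1 hj with h | rfl
        · exact h2 j h
        · exact h
      · right; exact ⟨n, by omega, h2, h, e⟩
    · rw [if_neg (by rw [h3]; exact h2)] at e
      right; exact ⟨j, by omega, h1, h2, by rw [e, h3]⟩

variable [MulLeftMono K]

lemma HH_lt_iff {h} (hh : h ∈ HH k) {p p' : Om K} : h p < h p' ↔ p < p' := by
  refine ⟨fun h1 => ?_, HH_mono hh⟩
  rcases lt_trichotomy p p' with h2 | h2 | h2
  · exact h2
  · subst h2; exact absurd h1 (lt_irrefl _)
  · exact absurd (HH_mono hh h2) h1.not_gt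

theorem order_HH (hk : ∀ κ, ∃ v, EK k v = κ) (hg : GapP k) (hs : Computable fun v : KW => sg (EK k v)) :
    ∃ l : LinearOrder (HH k), (∀ a b c : HH k, l.le b c → l.le (a * b) (a * c)) ∧
    Computable (fun w : List (Fin 12 × Bool) => orderSign l (⟨act k w, act_mem k w⟩ : HH k)) := by
  let L : LinearOrder (HH k) := LinearOrder.lift' (hkey k) (hkey_inj hk)
  have hlt : ∀ a b : HH k, L.lt a b ↔ ∃ j, (∀ i < j, a.1 (act k (gam i) oo) = b.1 (act k (gam i) oo)) ∧
      a.1 (act k (gam j) oo) < b.1 (act k (gam j) oo) := fun a b => Iff.rfl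
  refine ⟨L, ?_, ?_⟩
  · intro a b c h
    rcases (@le_iff_lt_or_eq _ L.toPartialOrder b c).1 h with h | h
    · refine (@le_iff_lt_or_eq _ L.toPartialOrder _ _).2 (Or.inl ?_)
      obtain ⟨j, h1, h2⟩ := (hlt _ _).1 h
      refine (hlt _ _).2 ⟨j, fun i hi => ?_, ?_⟩
      · change a.1 (b.1 _) = a.1 (c.1 _); rw [h1 i hi]
      · exact HH_mono a.2 h2
    · rw [h]
  · obtain ⟨run, hr, hrun⟩ := exists_run hs
    obtain ⟨f, hf, hfb⟩ := exists_code_bound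
    let D : List (Fin 12 × Bool) → ℕ → ℕ := fun w j =>
      sgO (fun v => sg (EK k v)) (run (FreeGroup.invRev (gam j)) (run w (run (gam j) oR)))
    have hinv : Computable (FreeGroup.invRev : List (Fin 12 × Bool) → List (Fin 12 × Bool)) :=
      (Primrec.list_reverse.comp (Primrec.list_map (f := fun l : List (Fin 12 × Bool) => l) (g := fun _ (a : Fin 12 × Bool) => (a.1, !a.2)) Primrec.id
        (Primrec.pair (Primrec.fst.comp Primrec.snd) (Primrec.not.comp (Primrec.snd.comp Primrec.snd))))).to_comp
    have hD : Computable₂ D := by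
      have h1 : Computable fun p : List (Fin 12 × Bool) × ℕ => gam p.2 := gam_comp.comp Computable.snd
      exact (sgO_comp hs).comp (hr.comp (hinv.comp h1) (hr.comp Computable.fst (hr.comp h1 (Computable.const _))))
    have hF : Computable fun w : List (Fin 12 × Bool) => firstD (D w) (f (LB (2 * w.length)) + 1) := by
      refine Computable.nat_rec (h := fun w (p : ℕ × ℕ) => if p.2 = 1 then D w p.1 else p.2)
        (Computable.succ.comp (hf.comp (LB_prim.to_comp.comp ((Primrec.nat_mul.comp (Primrec.const 2) Primrec.list_length).to_comp))))
        (Computable.const _) ?_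
      exact comp_ite (comp_eqn (Computable.snd.comp Computable.snd) 1)
        (hD.comp Computable.fst (Computable.fst.comp Computable.snd)) (Computable.snd.comp Computable.snd)
    refine (comp_sel hF (Computable.const (-1 : ℤ)) (Computable.const (0 : ℤ)) (Computable.const (1 : ℤ))).of_eq ?_
    intro w
    have hDs : ∀ j, (D w j = 0 ∧ act k w (act k (gam j) oo) < act k (gam j) oo) ∨
        (D w j = 1 ∧ act k w (act k (gam j) oo) = act k (gam j) oo) ∨
        (D w j = 2 ∧ act k (gam j) oo < act k w (act k (gam j) oo)) := by
      intro j
      have h0 := sgO_spec (k := k) (run (FreeGroup.invRev (gam j)) (run w (run (gam j) oR)))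
      rw [hrun, hrun, hrun, ev_oR, act_inv] at h0
      set g := act k (gam j) with hgd
      have e1 : ∀ p, g (g⁻¹ p) = p := fun p => by simp
      have e2 : g⁻¹ (act k w (g oo)) < oo ↔ act k w (g oo) < g oo := by
        rw [← HH_lt_iff (act_mem k (gam j)), ← hgd, e1]
      have e3 : oo < g⁻¹ (act k w (g oo)) ↔ g oo < act k w (g oo) := by
        rw [← HH_lt_iff (act_mem k (gam j)), ← hgd, e1]
      rw [e2, e3, Equiv.Perm.inv_eq_iff_eq] at h0
      exact h0
    simp only [orderSign, hlt]
    rcases firstD_spec (D w) (f (LB (2 * w.length)) + 1) with ⟨h1, h2⟩ | ⟨j, h0, h1, h2, h3⟩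
    · have h4 : act k w = 1 := by
        refine triv_of_tests hg w fun γ hγ => ?_
        have h5 := h2 (Encodable.encode γ) (Nat.lt_succ_of_le (hfb γ _ hγ))
        rcases hDs (Encodable.encode γ) with ⟨h6, _⟩ | ⟨_, h7⟩ | ⟨h6, _⟩
        · omega
        · rwa [gam_encode] at h7
        · omega
      rw [h1, if_neg, if_pos]
      · rfl
      · exact Subtype.ext h4
      · rintro ⟨j, _, h6⟩
        simp only [h4] at h6
        exact lt_irrefl _ h6
    · have h4 : ∀ i < j, act k w (act k (gam i) oo) = act k (gam i) oo := by
        intro i hi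
        have := h1 i hi
        rcases hDs i with ⟨h6, _⟩ | ⟨_, h7⟩ | ⟨h6, _⟩
        · omega
        · exact h7
        · omega
      rw [h3]
      rcases hDs j with ⟨h6, h7⟩ | ⟨h6, _⟩ | ⟨h6, h7⟩
      · rw [h6, if_pos]
        · rfl
        · exact ⟨j, h4, h7⟩
      · exact absurd h6 h2
      · rw [h6, if_neg, if_neg]
        · rfl
        · intro h8
          have h9 : act k w = 1 := congrArg Subtype.val h8
          rw [h9] at h7
          exact lt_irrefl _ h7
        · rintro ⟨i, h8, h9⟩
          rcases lt_trichotomy i j with h | h | h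
          · exact h9.ne (h4 i h)
          · subst h; exact h9.not_gt h7
          · exact h7.ne' (h8 j h)

end
end LO

namespace LO
set_option linter.unusedSectionVars false

/-! ### Orders from positive cones -/

open Classical in
/-- The linear order given by a positive cone. -/
@[reducible] noncomputable def coneOrder {A : Type} [Group A] (P : A → Prop) (h1 : ¬ P 1) (hm : ∀ a b, P a → P b → P (a * b))
    (ht : ∀ a, a ≠ 1 → P a ∨ P a⁻¹) : LinearOrder A where
  le a b := a = b ∨ P (a⁻¹ * b)
  lt a b := P (a⁻¹ * b)
  le_refl a := Or.inl rfl
  le_trans a b c := by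
    rintro (rfl | h) (rfl | h')
    · exact Or.inl rfl
    · exact Or.inr h'
    · exact Or.inr h
    · right; have := hm _ _ h h'; rwa [mul_assoc, mul_inv_cancel_left] at this
  le_antisymm a b := by
    rintro (rfl | h) (h' | h')
    · rfl
    · rfl
    · exact h'.symm
    · have := hm _ _ h h'; rw [mul_assoc, mul_inv_cancel_left, inv_mul_cancel] at this
      exact absurd this h1
  le_total a b := by
    by_cases h : a = b
    · exact Or.inl (Or.inl h)
    · rcases ht (a⁻¹ * b) (fun e => h (inv_mul_eq_one.1 e)) with h | h
      · exact Or.inl (Or.inr h)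
      · right; right; rwa [mul_inv_rev, inv_inv] at h
  lt_iff_le_not_ge a b := by
    constructor
    · intro h
      refine ⟨Or.inr h, ?_⟩
      rintro (rfl | h')
      · rw [inv_mul_cancel] at h; exact h1 h
      · have := hm _ _ h h'; rw [mul_assoc, mul_inv_cancel_left, inv_mul_cancel] at this
        exact h1 this
    · rintro ⟨rfl | h, h'⟩
      · exact absurd (Or.inl rfl) h'
      · exact h
  toDecidableLE := fun _ _ => Classical.propDecidable _

lemma coneOrder_lt {A : Type} [Group A] (P : A → Prop) (h1 hm ht) (a b : A) :
    (coneOrder P h1 hm ht).lt a b ↔ P (a⁻¹ * b) := Iff.rfl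
lemma coneOrder_le {A : Type} [Group A] (P : A → Prop) (h1 hm ht) (a b : A) :
    (coneOrder P h1 hm ht).le a b ↔ a = b ∨ P (a⁻¹ * b) := Iff.rfl

section lo
variable {V : Type} [Group V] [LinearOrder V] [MulLeftMono V]

lemma llt (a : V) {b c : V} (h : b < c) : a * b < a * c :=
  lt_of_le_of_ne (mul_le_mul_right h.le a) fun e => h.ne (mul_left_cancel e)
lemma one_lt_mul2 {a b : V} (ha : 1 < a) (hb : 1 < b) : 1 < a * b :=
  ha.trans (by simpa using llt a hb)
lemma one_lt_inv2 {a : V} : 1 < a⁻¹ ↔ a < 1 := by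
  constructor
  · intro h; simpa using llt a h
  · intro h; simpa using llt a⁻¹ h
lemma inv_lt_one2 {a : V} : a⁻¹ < 1 ↔ 1 < a := by
  rw [← one_lt_inv2, inv_inv]
end lo

/-! ### Unrestricted-type wreath products with the integers -/

@[ext] structure W (V : Type) [Group V] where
  f : ℤ → V
  d : ℤ
  bd : ∃ N : ℤ, ∀ n < N, f n = 1

namespace W
section
variable {V : Type} [Group V]

instance : Mul (W V) := ⟨fun a b => ⟨fun n => a.f n * b.f (n - a.d), a.d + b.d, by
  obtain ⟨N, hN⟩ := a.bd
  obtain ⟨M, hM⟩ := b.bd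
  refine ⟨min N (M + a.d), fun n hn => ?_⟩
  rw [hN n (lt_of_lt_of_le hn (min_le_left _ _)), hM _ (by have := lt_of_lt_of_le hn (min_le_right _ _); omega), one_mul]⟩⟩
instance : One (W V) := ⟨⟨fun _ => 1, 0, 0, fun _ _ => rfl⟩⟩
instance : Inv (W V) := ⟨fun a => ⟨fun n => (a.f (n + a.d))⁻¹, -a.d, by
  obtain ⟨N, hN⟩ := a.bd
  exact ⟨N - a.d, fun n hn => by rw [hN _ (by omega), inv_one]⟩⟩⟩

lemma mul_f (a b : W V) (n) : (a * b).f n = a.f n * b.f (n - a.d) := rfl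
lemma mul_d (a b : W V) : (a * b).d = a.d + b.d := rfl
lemma one_f (n) : (1 : W V).f n = 1 := rfl
lemma one_d : (1 : W V).d = 0 := rfl
lemma inv_f (a : W V) (n) : (a⁻¹).f n = (a.f (n + a.d))⁻¹ := rfl
lemma inv_d (a : W V) : (a⁻¹).d = -a.d := rfl

instance : Group (W V) := Group.ofLeftAxioms
  (fun a b c => by
    ext n
    · simp only [mul_f, mul_d, mul_assoc, sub_sub]
    · simp only [mul_d, add_assoc])
  (fun a => by
    ext n
    · simp only [mul_f, one_f, one_d, one_mul, sub_zero]
    · simp only [mul_d, one_d, zero_add])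
  (fun a => by
    ext n
    · simp only [mul_f, inv_f, inv_d, one_f, sub_neg_eq_add, inv_mul_cancel]
    · simp only [mul_d, inv_d, one_d, neg_add_cancel])

/-- the shift -/
def t : W V := ⟨fun _ => 1, 1, 0, fun _ _ => rfl⟩
/-- supported at the origin -/
def delta : V →* W V where
  toFun v := ⟨fun n => if n = 0 then v else 1, 0, 0, fun n hn => if_neg hn.ne⟩
  map_one' := by ext n <;> simp [one_f, one_d]
  map_mul' a b := by
    ext n
    · simp only [mul_f, sub_zero]; split_ifs <;> simp
    · simp [mul_d]

lemma delta_f (v : V) (n) : (delta v).f n = if n = 0 then v else 1 := rfl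
lemma delta_d (v : V) : (delta v).d = 0 := rfl
lemma delta_inj : Function.Injective (delta (V := V)) := by
  intro a b h
  have := congrArg (fun w => W.f w 0) h
  simpa [delta_f] using this

lemma t_pow_f (p : ℕ) (n) : ((t : W V) ^ p).f n = 1 := by
  induction p generalizing n with
  | zero => rfl
  | succ p ih => rw [pow_succ', mul_f, ih, mul_one]; rfl
lemma t_pow_d (p : ℕ) : ((t : W V) ^ p).d = p := by
  induction p with
  | zero => rfl
  | succ p ih => rw [pow_succ', mul_d, ih]; change (1 : ℤ) + p = _; push_cast; ring

/-- conjugation by a power of the shift -/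
lemma conj_t (a : W V) (ha : a.d = 0) (p : ℕ) (n) : ((t ^ p)⁻¹ * a * t ^ p).f n = a.f (n + p) := by
  simp only [mul_f, inv_f, inv_d, mul_d, t_pow_f, t_pow_d, ha, inv_one, one_mul, mul_one]
  congr 1; ring
lemma conj_t_d (a : W V) (ha : a.d = 0) (p : ℕ) : ((t ^ p)⁻¹ * a * t ^ p).d = 0 := by
  simp [mul_d, inv_d, ha]

lemma comm_f {a b : W V} (ha : a.d = 0) (hb : b.d = 0) (n) : (a * b * a⁻¹ * b⁻¹).f n =
    a.f n * b.f n * (a.f n)⁻¹ * (b.f n)⁻¹ := by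
  simp [mul_f, inv_f, inv_d, mul_d, ha, hb]
lemma comm_d {a b : W V} : (a * b * a⁻¹ * b⁻¹).d = 0 := by
  simp [mul_d, inv_d]

end

section
variable {V : Type} [Group V] [LinearOrder V]

def P (a : W V) : Prop := 0 < a.d ∨ (a.d = 0 ∧ ∃ n, (∀ m < n, a.f m = 1) ∧ 1 < a.f n)

variable [MulLeftMono V]

lemma P_one : ¬ P (1 : W V) := by
  rintro (h | ⟨_, n, _, h⟩)
  · exact lt_irrefl _ h
  · exact lt_irrefl _ h

lemma P_mul (a b : W V) (ha : P a) (hb : P b) : P (a * b) := by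
  rcases ha with ha | ⟨ha, n, h1, h2⟩
  · left
    rw [mul_d]
    rcases hb with hb | ⟨hb, _⟩ <;> omega
  · rcases hb with hb | ⟨hb, m, h3, h4⟩
    · left; rw [mul_d]; omega
    · right
      refine ⟨by rw [mul_d]; omega, min n m, fun i hi => ?_, ?_⟩
      · rw [mul_f, ha, sub_zero, h1 i (lt_of_lt_of_le hi (min_le_left _ _)), h3 i (lt_of_lt_of_le hi (min_le_right _ _)), one_mul]
      · rw [mul_f, ha, sub_zero]
        rcases lt_trichotomy n m with h | h | h
        · rw [min_eq_left h.le, h3 n h, mul_one]; exact h2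
        · subst h; rw [min_self]; exact one_lt_mul2 h2 h4
        · rw [min_eq_right h.le, h1 m h, one_mul]; exact h4

/-- first nontrivial coordinate -/
lemma exists_first (a : W V) (h : ∃ n, a.f n ≠ 1) : ∃ n, (∀ m < n, a.f m = 1) ∧ a.f n ≠ 1 := by
  obtain ⟨N, hN⟩ := a.bd
  obtain ⟨n, h1, h2⟩ := Int.exists_least_of_bdd (P := fun n => a.f n ≠ 1)
    ⟨N, fun z hz => by by_contra h; exact hz (hN z (not_le.1 h))⟩ h
  refine ⟨n, fun m hm => ?_, h1⟩
  by_contra h3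
  exact absurd (h2 m h3) (not_le.2 hm)

lemma P_tri (a : W V) (ha : a ≠ 1) : P a ∨ P a⁻¹ := by
  rcases lt_trichotomy a.d 0 with h | h | h
  · right; left; rw [inv_d]; omega
  · have : ∃ n, a.f n ≠ 1 := by
      by_contra! h2
      exact ha (W.ext (funext h2) h)
    obtain ⟨n, h1, h2⟩ := exists_first a this
    rcases lt_or_gt_of_ne h2 with h3 | h3
    · right; right
      refine ⟨by rw [inv_d, h, neg_zero], n, fun m hm => ?_, ?_⟩
      · rw [inv_f, h, add_zero, h1 m hm, inv_one]
      · rw [inv_f, h, add_zero]; exact one_lt_inv2.2 h3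
    · left; right; exact ⟨h, n, h1, h3⟩
  · left; left; exact h

noncomputable instance : LinearOrder (W V) := coneOrder P P_one P_mul P_tri

lemma lt_def (a b : W V) : a < b ↔ P (a⁻¹ * b) := Iff.rfl
lemma one_lt (a : W V) : 1 < a ↔ P a := by rw [lt_def, inv_one, one_mul]

instance : MulLeftMono (W V) := ⟨fun a b c h => by
  rcases h.eq_or_lt with h | h
  · simp only [h]; exact le_rfl
  · refine le_of_lt ((lt_def _ _).2 ?_)
    rw [lt_def] at h
    simpa [mul_assoc] using h⟩

lemma lt_one (a : W V) : a < 1 ↔ a.d < 0 ∨ (a.d = 0 ∧ ∃ n, (∀ m < n, a.f m = 1) ∧ a.f n < 1) := by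
  rw [← one_lt_inv2, one_lt, P, inv_d]
  simp only [inv_f, neg_eq_zero, Left.neg_pos_iff]
  refine or_congr Iff.rfl (and_congr_right fun h => ?_)
  simp only [h, add_zero, inv_eq_one, one_lt_inv2]

end
end W

/-! ### Computing signs in `W V` -/

/-- letters -/
def ltr {I A : Type} [Group A] (γ : I → A) (a : I × Bool) : A := if a.2 then γ a.1 else (γ a.1)⁻¹
/-- words -/
def evI {I A : Type} [Group A] (γ : I → A) (w : List (I × Bool)) : A := (w.map (ltr γ)).prod

lemma evI_nil {I A : Type} [Group A] (γ : I → A) : evI γ [] = 1 := rfl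
lemma evI_cons {I A : Type} [Group A] (γ : I → A) (a w) : evI γ (a :: w) = ltr γ a * evI γ w := by simp [evI]
lemma evI_append {I A : Type} [Group A] (γ : I → A) (w w') : evI γ (w ++ w') = evI γ w * evI γ w' := by simp [evI]
lemma EK_eq_evI {A : Type} [Group A] (γ : Fin 3 → A) (w) : EK γ w = evI γ w := by
  induction w with
  | nil => rw [EK_nil, evI_nil]
  | cons a w ih =>
    obtain ⟨i, b⟩ := a
    rw [EK_cons, evI_cons, ih]
    cases b <;> rfl

abbrev NW := List (ℕ × Bool)

section
variable {V : Type} [Group V] [LinearOrder V] [MulLeftMono V] {I : Type} [Primcodable I]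

def runW (gf : I × Bool → ℕ × ℕ → NW) (gd : I × Bool → ℕ × ℕ) (w : List (I × Bool)) (n : ℕ × ℕ)
    (s0 : (ℕ × ℕ) × NW) : (ℕ × ℕ) × NW :=
  w.foldl (fun s a => ((s.1.1 + (gd a).1, s.1.2 + (gd a).2), s.2 ++ gf a (n.1 + s.1.2, n.2 + s.1.1))) s0

lemma runW_spec (y : ℕ → V) (γ : I → W V) (gf : I × Bool → ℕ × ℕ → NW) (gd : I × Bool → ℕ × ℕ)
    (h1 : ∀ a n, evI y (gf a n) = (ltr γ a).f ((n.1 : ℤ) - n.2))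
    (h2 : ∀ a, ((gd a).1 : ℤ) - (gd a).2 = (ltr γ a).d) (w n) : ∀ s0,
    evI y (runW gf gd w n s0).2 = evI y s0.2 * (evI γ w).f ((n.1 : ℤ) - n.2 - (s0.1.1 - s0.1.2)) ∧
    ((runW gf gd w n s0).1.1 : ℤ) - (runW gf gd w n s0).1.2 = s0.1.1 - s0.1.2 + (evI γ w).d := by
  induction w with
  | nil => intro s0; simp [runW, evI_nil, W.one_f, W.one_d]
  | cons a w ih =>
    intro s0
    have e : runW gf gd (a :: w) n s0 = runW gf gd w n
      ((s0.1.1 + (gd a).1, s0.1.2 + (gd a).2), s0.2 ++ gf a (n.1 + s0.1.2, n.2 + s0.1.1)) := rfl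
    rw [e]
    obtain ⟨i1, i2⟩ := ih ((s0.1.1 + (gd a).1, s0.1.2 + (gd a).2), s0.2 ++ gf a (n.1 + s0.1.2, n.2 + s0.1.1))
    have h2' := h2 a
    constructor
    · rw [i1, evI_append, h1, evI_cons, W.mul_f, mul_assoc, ← h2']
      push_cast
      congr 3
      · ring
      · ring
    · rw [i2, evI_cons, W.mul_d]
      push_cast
      linarith

lemma sg_cases (a : V) : (sg a = 0 ∧ a < 1) ∨ (sg a = 1 ∧ a = 1) ∨ (sg a = 2 ∧ 1 < a) := by
  rcases lt_trichotomy a 1 with h | h | h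
  · exact Or.inl ⟨sg_lt h, h⟩
  · exact Or.inr (Or.inl ⟨by rw [h, sg_one], h⟩)
  · exact Or.inr (Or.inr ⟨sg_gt h, h⟩)

/-- start in the neutral state -/
def runW0 (gf : I × Bool → ℕ × ℕ → NW) (gd : I × Bool → ℕ × ℕ) (p : List (I × Bool) × (ℕ × ℕ)) : (ℕ × ℕ) × NW :=
  runW gf gd p.1 p.2 ((0, 0), [])

lemma runW_comp {gf : I × Bool → ℕ × ℕ → NW}
    (hgf : Computable₂ gf) {gd : I × Bool → ℕ × ℕ} (hgd : Computable gd) :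
    Computable (runW0 gf gd) := by
  refine comp_foldl (f := fun p : List (I × Bool) × (ℕ × ℕ) => p.1) (g := fun _ => ((0, 0), []))
    (h := fun p (q : ((ℕ × ℕ) × NW) × (I × Bool)) => ((q.1.1.1 + (gd q.2).1, q.1.1.2 + (gd q.2).2),
      q.1.2 ++ gf q.2 (p.2.1 + q.1.1.2, p.2.2 + q.1.1.1))) Computable.fst (Computable.const _) ?_
  have ha : Computable₂ fun a b : ℕ => a + b := Primrec.nat_add.to_comp
  have c1 : Computable fun z : (List (I × Bool) × (ℕ × ℕ)) × (((ℕ × ℕ) × NW) × (I × Bool)) => z.2.1.1.1 :=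
    Computable.fst.comp (Computable.fst.comp (Computable.fst.comp Computable.snd))
  have c2 : Computable fun z : (List (I × Bool) × (ℕ × ℕ)) × (((ℕ × ℕ) × NW) × (I × Bool)) => z.2.1.1.2 :=
    Computable.snd.comp (Computable.fst.comp (Computable.fst.comp Computable.snd))
  have c3 : Computable fun z : (List (I × Bool) × (ℕ × ℕ)) × (((ℕ × ℕ) × NW) × (I × Bool)) => z.2.1.2 :=
    Computable.snd.comp (Computable.fst.comp Computable.snd)
  have c4 : Computable fun z : (List (I × Bool) × (ℕ × ℕ)) × (((ℕ × ℕ) × NW) × (I × Bool)) => z.2.2 :=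
    Computable.snd.comp Computable.snd
  have c5 : Computable fun z : (List (I × Bool) × (ℕ × ℕ)) × (((ℕ × ℕ) × NW) × (I × Bool)) => z.1.2.1 :=
    Computable.fst.comp (Computable.snd.comp Computable.fst)
  have c6 : Computable fun z : (List (I × Bool) × (ℕ × ℕ)) × (((ℕ × ℕ) × NW) × (I × Bool)) => z.1.2.2 :=
    Computable.snd.comp (Computable.snd.comp Computable.fst)
  have c7 := hgd.comp c4
  have c8 := hgf.comp c4 ((ha.comp c5 c2).pair (ha.comp c6 c1))
  exact ((((ha.comp c1 (Computable.fst.comp c7)).pair (ha.comp c2 (Computable.snd.comp c7))).pair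
    (Computable.list_append.comp c3 c8)) : Computable _)

set_option maxHeartbeats 400000 in
theorem W_sc (y : ℕ → V) (hy : Computable fun w => sg (evI y w)) (γ : I → W V) (gf : I × Bool → ℕ × ℕ → NW)
    (hgf : Computable₂ gf) (gd : I × Bool → ℕ × ℕ) (hgd : Computable gd)
    (h1 : ∀ a n, evI y (gf a n) = (ltr γ a).f ((n.1 : ℤ) - n.2))
    (h2 : ∀ a, ((gd a).1 : ℤ) - (gd a).2 = (ltr γ a).d)
    (R N : List (I × Bool) → ℕ) (hR : Computable R) (hN : Computable N)
    (h3 : ∀ w n, n < -(R w : ℤ) → (evI γ w).f n = 1)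
    (h4 : ∀ w n, (evI γ w).f n ≠ 1 → ∃ n, n < (N w : ℤ) - R w ∧ (evI γ w).f n ≠ 1) :
    Computable fun w => sg (evI γ w) := by
  have hrun := runW_comp hgf hgd
  have hl : Computable₂ fun a b : ℕ => decide (a < b) := (Primrec.nat_lt.decide : Primrec₂ _).to_comp
  let dd : List (I × Bool) → ℕ × ℕ := fun w => (runW0 gf gd (w, (0, 0))).1
  have c0 : Computable fun w : List (I × Bool) => (w, ((0 : ℕ), (0 : ℕ))) := Computable.id.pair (Computable.const _)
  have c1 : Computable fun w : List (I × Bool) => runW0 gf gd (w, (0, 0)) := hrun.comp c0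
  have hd : Computable dd := Computable.fst.comp c1
  let D : List (I × Bool) → ℕ → ℕ := fun w j => sg (evI y (runW0 gf gd (w, (j, R w))).2)
  have c2 : Computable fun p : List (I × Bool) × ℕ => (p.1, (p.2, R p.1)) := Computable.fst.pair
    (Computable.snd.pair (hR.comp Computable.fst))
  have c3 : Computable fun p : List (I × Bool) × ℕ => runW0 gf gd (p.1, (p.2, R p.1)) := hrun.comp c2
  have hD : Computable₂ D := hy.comp (Computable.snd.comp c3)
  have hF : Computable fun w => firstD (D w) (N w) := by
    refine Computable.nat_rec (h := fun w (p : ℕ × ℕ) => if p.2 = 1 then D w p.1 else p.2)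
      hN (Computable.const _) ?_
    exact comp_ite (comp_eqn (Computable.snd.comp Computable.snd) 1)
      (hD.comp Computable.fst (Computable.fst.comp Computable.snd)) (Computable.snd.comp Computable.snd)
  refine (comp_ite (c := fun w => (dd w).1 < (dd w).2) (f := fun _ => 0)
    (g := fun w => if (dd w).2 < (dd w).1 then 2 else firstD (D w) (N w))
    (hl.comp (Computable.fst.comp hd) (Computable.snd.comp hd)) (Computable.const 0)
    (comp_ite (hl.comp (Computable.snd.comp hd) (Computable.fst.comp hd)) (Computable.const 2) hF)).of_eq ?_
  intro w
  have e1 : ((dd w).1 : ℤ) - (dd w).2 = (evI γ w).d := by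
    have := (runW_spec y γ gf gd h1 h2 w (0, 0) ((0, 0), [])).2
    simpa [dd, runW0] using this
  have e2 : ∀ j : ℕ, evI y (runW0 gf gd (w, (j, R w))).2 = (evI γ w).f ((j : ℤ) - R w) := by
    intro j
    have := (runW_spec y γ gf gd h1 h2 w (j, R w) ((0, 0), [])).1
    simpa [evI_nil, runW0] using this
  have e3 : ∀ j, D w j = sg ((evI γ w).f ((j : ℤ) - R w)) := fun j => by rw [← e2]
  have e4 : ∀ j, D w j = 1 → (evI γ w).f ((j : ℤ) - R w) = 1 := fun j hj => by
    rw [e3] at hj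
    rcases sg_cases ((evI γ w).f ((j : ℤ) - R w)) with h | h | h
    · omega
    · exact h.2
    · omega
  rcases lt_trichotomy (dd w).1 (dd w).2 with h | h | h
  · rw [if_pos h, sg_lt]
    rw [W.lt_one]; left; omega
  · rw [if_neg (by omega), if_neg (by omega)]
    have hd0 : (evI γ w).d = 0 := by omega
    rcases firstD_spec (D w) (N w) with ⟨f1, f2⟩ | ⟨j, f0, f1, f2, f3⟩
    · have : evI γ w = 1 := by
        refine W.ext (funext fun n => ?_) hd0
        by_contra hne
        obtain ⟨n, g1, g2⟩ := h4 w n hne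
        apply g2
        by_cases hn : n < -(R w : ℤ)
        · exact h3 w n hn
        · have := e4 (n + R w).toNat (f2 _ (by omega))
          rwa [show (((n + R w).toNat : ℕ) : ℤ) - R w = n by omega] at this
      rw [this, sg_one, f1]
    · have g1 : ∀ m < ((j : ℤ) - R w), (evI γ w).f m = 1 := by
        intro m hm
        by_cases hn : m < -(R w : ℤ)
        · exact h3 w m hn
        · have := e4 (m + R w).toNat (f1 _ (by omega))
          rwa [show (((m + R w).toNat : ℕ) : ℤ) - R w = m by omega] at this
      rw [f3, e3]
      rw [e3] at f2
      rcases sg_cases ((evI γ w).f ((j : ℤ) - R w)) with h | h | h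
      · rw [h.1, sg_lt]
        rw [W.lt_one]; exact Or.inr ⟨hd0, _, g1, h.2⟩
      · exact absurd h.1 f2
      · rw [h.1, sg_gt]
        rw [W.one_lt]; exact Or.inr ⟨hd0, _, g1, h.2⟩
  · rw [if_neg (by omega), if_pos h, sg_gt]
    rw [W.one_lt]; left; omega

end
end LO

namespace LO
set_option linter.unusedSectionVars false

section A
variable {V : Type} [Group V]

/-- half-line supported element -/
def aa (v : V) : W V := ⟨fun n => if 0 ≤ n then v else 1, 0, 0, fun n hn => if_neg (by omega)⟩

lemma comm_aa (v : V) : aa v * W.t * (aa v)⁻¹ * W.t⁻¹ = W.delta v := by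
  ext n
  · simp only [W.mul_f, W.inv_f, W.mul_d, W.inv_d, W.delta_f, aa, W.t]
    rcases lt_trichotomy n 0 with h | h | h
    · simp [h.not_ge, h.ne, show ¬ (1 : ℤ) ≤ n by omega]
    · subst h; simp
    · simp [h.le, h.ne', show (1 : ℤ) ≤ n by omega]
  · simp [W.mul_d, W.inv_d, W.delta_d, aa]

/-- generators of the first wreath product -/
def yA (x : ℕ → V) (i : ℕ) : W V := if i % 2 = 0 then W.t else aa (x (i / 2))

lemma yA_even (x : ℕ → V) (i : ℕ) : yA x (2 * i) = W.t := by simp [yA]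
lemma yA_odd (x : ℕ → V) (i : ℕ) : yA x (2 * i + 1) = aa (x i) := by
  rw [yA, if_neg (by omega), show (2 * i + 1) / 2 = i by omega]

lemma yA_ltr (x : ℕ → V) (a : ℕ × Bool) : ((ltr (yA x) a).d ≤ 1 ∧ -1 ≤ (ltr (yA x) a).d) ∧
    (∀ n < 0, (ltr (yA x) a).f n = 1) ∧ (∀ n n', 0 ≤ n → 0 ≤ n' → (ltr (yA x) a).f n = (ltr (yA x) a).f n') := by
  obtain ⟨i, _ | _⟩ := a <;> simp only [ltr, yA, Bool.false_eq_true, if_false, if_true] <;> split_ifs <;>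
    simp only [W.inv_f, W.inv_d, W.t, aa, add_zero, inv_one, implies_true, and_true, neg_zero] <;>
    refine ⟨by norm_num, ?_⟩ <;> try (constructor)
  · intro n hn; simp [hn.not_ge]
  · intro n n' h h'; simp [h, h']
  · intro n hn; simp [hn.not_ge]
  · intro n n' h h'; simp [h, h']

lemma yA_low (x : ℕ → V) (w : NW) : ∀ n : ℤ, n < -(w.length : ℤ) → (evI (yA x) w).f n = 1 := by
  induction w with
  | nil => intro n _; rfl
  | cons a w ih =>
    intro n hn
    rw [List.length_cons] at hn; push_cast at hn
    obtain ⟨⟨h1, h2⟩, h3, h4⟩ := yA_ltr x a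
    rw [evI_cons, W.mul_f, h3 _ (by omega), ih _ (by omega), one_mul]

lemma yA_high (x : ℕ → V) (w : NW) : ∀ n n' : ℤ, (w.length : ℤ) ≤ n → (w.length : ℤ) ≤ n' →
    (evI (yA x) w).f n = (evI (yA x) w).f n' := by
  induction w with
  | nil => intro n n' _ _; rfl
  | cons a w ih =>
    intro n n' hn hn'
    rw [List.length_cons] at hn hn'; push_cast at hn hn'
    obtain ⟨⟨h1, h2⟩, h3, h4⟩ := yA_ltr x a
    rw [evI_cons, W.mul_f, W.mul_f, h4 n n' (by omega) (by omega), ih _ (n' - (ltr (yA x) a).d) (by omega) (by omega)]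

variable [LinearOrder V] [MulLeftMono V]

def gfA (a : ℕ × Bool) (n : ℕ × ℕ) : NW := if a.1 % 2 = 0 then [] else if n.1 < n.2 then [] else [(a.1 / 2, a.2)]
def gdA (a : ℕ × Bool) : ℕ × ℕ := if a.1 % 2 = 0 then (bif a.2 then (1, 0) else (0, 1)) else (0, 0)

theorem yA_sc (x : ℕ → V) (hx : Computable fun w => sg (evI x w)) : Computable fun w => sg (evI (yA x) w) := by
  have hl : Computable₂ fun a b : ℕ => decide (a < b) := (Primrec.nat_lt.decide : Primrec₂ _).to_comp
  have hm : Computable fun a : ℕ => a % 2 := (Primrec.nat_mod.comp Primrec.id (Primrec.const 2)).to_comp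
  have hd : Computable fun a : ℕ => a / 2 := (Primrec.nat_div.comp Primrec.id (Primrec.const 2)).to_comp
  refine W_sc x hx (yA x) gfA ?_ gdA ?_ ?_ ?_ (fun w => w.length) (fun w => w.length + w.length + 1) Computable.list_length ?_
    (yA_low x) ?_
  · have c1 : Computable fun p : (ℕ × Bool) × (ℕ × ℕ) => p.1.1 := Computable.fst.comp Computable.fst
    have c2 : Computable fun p : (ℕ × Bool) × (ℕ × ℕ) => p.1.2 := Computable.snd.comp Computable.fst
    have c3 : Computable fun p : (ℕ × Bool) × (ℕ × ℕ) => p.2.1 := Computable.fst.comp Computable.snd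
    have c4 : Computable fun p : (ℕ × Bool) × (ℕ × ℕ) => p.2.2 := Computable.snd.comp Computable.snd
    have c5 : Computable fun p : (ℕ × Bool) × (ℕ × ℕ) => [(p.1.1 / 2, p.1.2)] :=
      Computable.list_cons.comp ((hd.comp c1).pair c2) (Computable.const [])
    exact comp_ite (comp_eqn (hm.comp c1) 0) (Computable.const []) (comp_ite (hl.comp c3 c4) (Computable.const []) c5)
  · exact comp_ite (comp_eqn (hm.comp Computable.fst) 0) (Computable.cond Computable.snd (Computable.const (1, 0))
      (Computable.const (0, 1))) (Computable.const (0, 0))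
  · rintro ⟨i, b⟩ ⟨p, q⟩
    simp only [gfA, ltr, yA]
    split_ifs with h1 h2 h3 h4 h5
    · rfl
    · simp [evI_nil, W.inv_f, W.t]
    · simp [evI_nil, aa, h3]
    · simp [evI_nil, aa, h3, W.inv_f]
    · simp [evI_cons, evI_nil, aa, show q ≤ p by omega, ltr, h5]
    · simp [evI_cons, evI_nil, aa, show q ≤ p by omega, ltr, h5, W.inv_f]
  · rintro ⟨i, b⟩
    simp only [gdA, ltr, yA]
    cases b <;> split_ifs <;> simp_all [W.inv_d, W.t, aa]
  · exact Computable.succ.comp ((Primrec.nat_add.comp Primrec.list_length Primrec.list_length).to_comp)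
  · intro w n hn
    by_cases h : n ≤ w.length
    · exact ⟨n, by push_cast; omega, hn⟩
    · refine ⟨w.length, by push_cast; omega, ?_⟩
      rw [yA_high x w _ n le_rfl (by omega)]; exact hn

end A

section Bs
variable {V : Type} [Group V]

/-- sparse element carrying the whole sequence -/
def Phi (y : ℕ → V) : W V := ⟨fun n => if n = 2 ^ (Nat.log 2 n.toNat) then y (Nat.log 2 n.toNat) else 1, 0, 0,
  fun n hn => if_neg (by have : (0 : ℤ) < 2 ^ (Nat.log 2 n.toNat) := by positivity
                         omega)⟩

lemma Phi_pow (y : ℕ → V) (i : ℕ) : (Phi y).f (2 ^ i) = y i := by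
  have : Nat.log 2 (((2 : ℤ) ^ i).toNat) = i := by
    rw [show ((2 : ℤ) ^ i) = ((2 ^ i : ℕ) : ℤ) by push_cast; rfl, Int.toNat_natCast, Nat.log_pow (by norm_num)]
  simp [Phi, this]
lemma Phi_ne (y : ℕ → V) (n : ℤ) (h : (Phi y).f n ≠ 1) : ∃ i : ℕ, n = 2 ^ i := by
  by_contra! h2
  exact h (if_neg (h2 _))
lemma Phi_d (y : ℕ → V) : (Phi y).d = 0 := rfl

lemma two_pow_int_lt {i j : ℕ} (h : i < j) : (2 : ℤ) * 2 ^ i ≤ 2 ^ j := by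
  rw [← pow_succ']; exact pow_le_pow_right₀ (by norm_num) h

lemma Phi_far (y : ℕ → V) (L i : ℕ) (hi : 2 * L + 2 ≤ i) (D : ℤ) (hD : |D| ≤ L) :
    (Phi y).f (2 ^ i + D) = if D = 0 then y i else 1 := by
  split_ifs with h
  · rw [h, add_zero, Phi_pow]
  · by_contra hne
    obtain ⟨j, hj⟩ := Phi_ne y _ hne
    have h0 : (L : ℤ) < 2 ^ L := by exact_mod_cast Nat.lt_two_pow_self
    obtain ⟨i', rfl⟩ : ∃ i', i = i' + 1 := ⟨i - 1, by omega⟩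
    have h1 : (2 : ℤ) * 2 ^ L ≤ 2 ^ i' := two_pow_int_lt (by omega)
    rw [pow_succ] at hj
    rw [abs_le] at hD
    rcases lt_trichotomy j (i' + 1) with h2 | h2 | h2
    · have : (2 : ℤ) ^ j ≤ 2 ^ i' := pow_le_pow_right₀ (by norm_num) (by omega)
      omega
    · subst h2; rw [pow_succ] at hj; omega
    · have := two_pow_int_lt h2
      rw [pow_succ] at this
      omega

/-- the element detecting a commutator -/
lemma comm_Phi (x : ℕ → V) (i : ℕ) :
    ((W.t ^ 2 ^ (2 * i + 1))⁻¹ * Phi (yA x) * W.t ^ 2 ^ (2 * i + 1)) * ((W.t ^ 2 ^ (2 * i))⁻¹ * Phi (yA x) * W.t ^ 2 ^ (2 * i)) *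
    ((W.t ^ 2 ^ (2 * i + 1))⁻¹ * Phi (yA x) * W.t ^ 2 ^ (2 * i + 1))⁻¹ * ((W.t ^ 2 ^ (2 * i))⁻¹ * Phi (yA x) * W.t ^ 2 ^ (2 * i))⁻¹
    = W.delta (W.delta (x i)) := by
  refine W.ext (funext fun n => ?_) ?_
  · rw [W.comm_f (W.conj_t_d _ rfl _) (W.conj_t_d _ rfl _), W.conj_t _ rfl, W.conj_t _ rfl, W.delta_f]
    push_cast
    split_ifs with h
    · subst h
      rw [zero_add, zero_add, Phi_pow, Phi_pow, yA_odd, yA_even, comm_aa]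
    · by_cases h1 : (Phi (yA x)).f (n + 2 ^ (2 * i + 1)) = 1
      · rw [h1]; simp
      by_cases h2 : (Phi (yA x)).f (n + 2 ^ (2 * i)) = 1
      · rw [h2]; simp
      exfalso
      obtain ⟨j, hj⟩ := Phi_ne _ _ h1
      obtain ⟨l, hl⟩ := Phi_ne _ _ h2
      rw [pow_succ] at hj
      have h3 : (2 : ℤ) ^ j = 2 ^ l + 2 ^ (2 * i) := by omega
      have h5 : (0 : ℤ) < 2 ^ (2 * i) := by positivity
      have h6 : (0 : ℤ) < 2 ^ l := by positivity
      have h4 : l < j := by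
        by_contra h4
        have : (2 : ℤ) ^ j ≤ 2 ^ l := pow_le_pow_right₀ (by norm_num) (by omega)
        omega
      have h7 := two_pow_int_lt h4
      rcases lt_trichotomy l (2 * i) with h8 | h8 | h8
      · have h9 : 2 * i < j := by
          by_contra h9
          have : (2 : ℤ) ^ j ≤ 2 ^ (2 * i) := pow_le_pow_right₀ (by norm_num) (by omega)
          omega
        have := two_pow_int_lt h9
        have := two_pow_int_lt h8
        omega
      · rw [h8] at hl; omega
      · have := two_pow_int_lt h8
        omega
  · rw [W.comm_d, W.delta_d]

/-- generators of the second wreath product -/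
def gB (y : ℕ → V) (i : Fin 3) : W V := if i = 0 then W.t else if i = 1 then Phi y else 1

lemma ltr_gB (y : ℕ → V) (a : Fin 3 × Bool) : (|(ltr (gB y) a).d| ≤ 1 ∧ ∀ n, (ltr (gB y) a).f n = 1) ∨
    ((ltr (gB y) a).d = 0 ∧ ∃ e : ℤ, ∀ n, (ltr (gB y) a).f n = (Phi y).f n ^ e) := by
  obtain ⟨i, b⟩ := a
  fin_cases i <;> cases b <;> simp [ltr, gB, W.inv_f, W.inv_d, W.t, Phi_d, W.one_d, W.one_f]
  · exact Or.inr ⟨-1, fun n => by simp⟩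
  · exact Or.inr ⟨1, fun n => by simp⟩

lemma gB_near (y : ℕ → V) (w : KW) : ∀ n, (evI (gB y) w).f n ≠ 1 → ∃ i : ℕ, |n - 2 ^ i| ≤ w.length := by
  induction w with
  | nil => intro n hn; exact absurd rfl hn
  | cons a w ih =>
    intro n hn
    rw [evI_cons, W.mul_f] at hn
    rw [List.length_cons]; push_cast
    rcases ltr_gB y a with ⟨h1, h2⟩ | ⟨h1, e, h2⟩
    · rw [h2, one_mul] at hn
      obtain ⟨i, hi⟩ := ih _ hn
      refine ⟨i, ?_⟩
      rw [abs_le] at *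
      omega
    · rw [h1, sub_zero] at hn
      by_cases h3 : (evI (gB y) w).f n = 1
      · rw [h3, mul_one, h2] at hn
        obtain ⟨i, hi⟩ := Phi_ne y n fun h => hn (by rw [h, one_zpow])
        exact ⟨i, by rw [hi]; simp; omega⟩
      · obtain ⟨i, hi⟩ := ih _ h3
        exact ⟨i, by omega⟩

lemma gB_far (y : ℕ → V) (L : ℕ) (w : KW) : ∀ D : ℤ, |D| + w.length ≤ L → ∃ e : ℤ, ∀ i, 2 * L + 2 ≤ i →
    (evI (gB y) w).f (2 ^ i + D) = y i ^ e := by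
  induction w with
  | nil => intro D _; exact ⟨0, fun i _ => by simp [evI_nil, W.one_f]⟩
  | cons a w ih =>
    intro D hD
    rw [List.length_cons] at hD; push_cast at hD
    rcases ltr_gB y a with ⟨h1, h2⟩ | ⟨h1, e, h2⟩
    · obtain ⟨e, he⟩ := ih (D - (ltr (gB y) a).d) (by
        have := abs_sub D (ltr (gB y) a).d
        omega)
      refine ⟨e, fun i hi => ?_⟩
      rw [evI_cons, W.mul_f, h2, one_mul, add_sub_assoc, he i hi]
    · obtain ⟨e', he'⟩ := ih D (by omega)
      refine ⟨(if D = 0 then e else 0) + e', fun i hi => ?_⟩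
      rw [evI_cons, W.mul_f, h2, h1, sub_zero, he' i hi, Phi_far y L i hi D (by omega), zpow_add]
      split_ifs <;> simp

lemma t_zpow_d (e : ℤ) : ((W.t : W V) ^ e).d = e := by
  rcases e with n | n
  · simp only [Int.ofNat_eq_natCast, zpow_natCast, W.t_pow_d]
  · rw [zpow_negSucc, W.inv_d, W.t_pow_d]; rfl

end Bs

section Bc
variable {V : Type} [Group V] [LinearOrder V] [MulLeftMono V]

def gfB (a : Fin 3 × Bool) (n : ℕ × ℕ) : NW :=
  if a.1 = 1 then (if n.1 - n.2 = 2 ^ (Nat.log 2 (n.1 - n.2)) then [(Nat.log 2 (n.1 - n.2), a.2)] else []) else []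
def gdB (a : Fin 3 × Bool) : ℕ × ℕ := if a.1 = 0 then (bif a.2 then (1, 0) else (0, 1)) else (0, 0)

lemma pow2_prim : Primrec fun v : ℕ => 2 ^ v := by
  refine (Primrec.nat_rec₁ (f := fun _ n => n * 2) 1 (Primrec.nat_mul.comp Primrec.snd (Primrec.const 2))).of_eq fun n => ?_
  induction n with
  | zero => rfl
  | succ n ih => rw [pow_succ, ← ih]

lemma log2_prim : Primrec fun n : ℕ => Nat.log 2 n := by
  have h : PrimrecRel fun (n v : ℕ) => 2 ^ v ≤ n := Primrec.nat_le.comp (pow2_prim.comp Primrec.snd) Primrec.fst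
  refine (Primrec.nat_findGreatest (f := fun n => n) Primrec.id h).of_eq fun n => ?_
  rcases Nat.eq_zero_or_pos n with rfl | hn
  · simp
  · rw [Nat.findGreatest_eq_iff]
    refine ⟨Nat.log_le_self 2 n, fun _ => Nat.pow_log_le_self 2 hn.ne', fun m hm _ h2 => ?_⟩
    exact absurd (Nat.le_log_of_pow_le (by norm_num) h2) (by omega)

theorem gB_sc (x : ℕ → V) (hx : Computable fun w => sg (evI (yA x) w)) :
    Computable fun w => sg (evI (gB (yA x)) w) := by
  refine W_sc (yA x) hx (gB (yA x)) gfB ?_ gdB ?_ ?_ ?_ (fun w => w.length)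
    (fun w => 2 ^ (4 * w.length + 2) + w.length + w.length + 1) Computable.list_length ?_ ?_ ?_
  · refine comp_finite fun a => ?_
    have c1 : Computable fun n : ℕ × ℕ => n.1 - n.2 := Primrec.nat_sub.to_comp
    have c2 : Computable fun n : ℕ × ℕ => Nat.log 2 (n.1 - n.2) := log2_prim.to_comp.comp c1
    have c3 : Computable fun n : ℕ × ℕ => decide (n.1 - n.2 = 2 ^ (Nat.log 2 (n.1 - n.2))) :=
      (Primrec.eq.decide : Primrec₂ fun a b : ℕ => decide (a = b)).to_comp.comp c1 (pow2_prim.to_comp.comp c2)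
    have c4 : Computable fun n : ℕ × ℕ => [(Nat.log 2 (n.1 - n.2), a.2)] :=
      Computable.list_cons.comp (c2.pair (Computable.const _)) (Computable.const [])
    unfold gfB
    by_cases h : a.1 = 1
    · simp only [h, if_true]
      exact comp_ite c3 c4 (Computable.const [])
    · simp only [h, if_false]; exact Computable.const _
  · exact (Primrec.dom_finite _).to_comp
  · rintro ⟨i, b⟩ ⟨p, q⟩
    have e : ((p : ℤ) - q).toNat = p - q := by omega
    have e2 : ∀ m : ℕ, ((p : ℤ) - q = 2 ^ m) ↔ p - q = 2 ^ m := by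
      intro m
      have h1 : ((2 ^ m : ℕ) : ℤ) = 2 ^ m := by push_cast; rfl
      have h2 : 0 < 2 ^ m := by positivity
      rw [← h1]; omega
    fin_cases i
    · cases b <;> simp [gfB, ltr, gB, evI_nil, W.t, W.inv_f]
    · cases b
      · simp only [gfB, ltr, gB, W.inv_f, Phi, e, e2, Fin.mk_one, Fin.isValue, if_true, Bool.false_eq_true, if_false, one_ne_zero, add_zero]
        split_ifs <;> simp [evI_cons, evI_nil, ltr]
      · simp only [gfB, ltr, gB, Phi, e, e2, Fin.mk_one, Fin.isValue, if_true, if_false, one_ne_zero]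
        split_ifs <;> simp [evI_cons, evI_nil, ltr]
    · cases b <;> simp [gfB, ltr, gB, evI_nil, W.one_f]
  · rintro ⟨i, b⟩
    fin_cases i <;> cases b <;> simp [gdB, ltr, gB, W.t, W.inv_d, Phi_d, W.one_d]
  · have h1 : Primrec fun w : KW => w.length := Primrec.list_length
    have h2 : Primrec fun w : KW => 2 ^ (4 * w.length + 2) := pow2_prim.comp
      (Primrec.nat_add.comp (Primrec.nat_mul.comp (Primrec.const 4) h1) (Primrec.const 2))
    exact (Primrec.succ.comp (Primrec.nat_add.comp (Primrec.nat_add.comp h2 h1) h1)).to_comp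
  · intro w n hn
    by_contra h
    obtain ⟨i, hi⟩ := gB_near _ w n h
    have : (0 : ℤ) < 2 ^ i := by positivity
    rw [abs_le] at hi
    omega
  · intro w n hn
    obtain ⟨i, hi⟩ := gB_near _ w n hn
    have hi' := abs_le.1 hi
    by_cases hs : i ≤ 4 * w.length + 2
    · refine ⟨n, ?_, hn⟩
      have : (2 : ℤ) ^ i ≤ 2 ^ (4 * w.length + 2) := pow_le_pow_right₀ (by norm_num) hs
      push_cast
      omega
    · obtain ⟨e, he⟩ := gB_far (yA x) (2 * w.length) w (n - 2 ^ i) (by push_cast; omega)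
      have h1 := he i (by omega)
      rw [add_sub_cancel] at h1
      have he0 : e ≠ 0 := by
        rintro rfl
        rw [zpow_zero] at h1; exact hn h1
      refine ⟨2 ^ (4 * w.length + 2) + (n - 2 ^ i), ?_, ?_⟩
      · push_cast; omega
      · rw [he (4 * w.length + 2) (by omega), show 4 * w.length + 2 = 2 * (2 * w.length + 1) by ring, yA_even]
        intro h
        have := congrArg W.d h
        rw [t_zpow_d, W.one_d] at this
        exact he0 this

end Bc
end LO

namespace LO
set_option linter.unusedSectionVars false

/-! ### Adding a cofinal-from-below integer coordinate -/

@[ext] structure E (V : Type) where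
  v : V
  e : ℤ

namespace E
section
variable {V : Type} [Group V]
instance : Mul (E V) := ⟨fun a b => ⟨a.v * b.v, a.e + b.e⟩⟩
instance : One (E V) := ⟨⟨1, 0⟩⟩
instance : Inv (E V) := ⟨fun a => ⟨a.v⁻¹, -a.e⟩⟩
lemma mul_v (a b : E V) : (a * b).v = a.v * b.v := rfl
lemma mul_e (a b : E V) : (a * b).e = a.e + b.e := rfl
lemma one_v : (1 : E V).v = 1 := rfl
lemma one_e : (1 : E V).e = 0 := rfl
lemma inv_v (a : E V) : (a⁻¹).v = a.v⁻¹ := rfl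
lemma inv_e (a : E V) : (a⁻¹).e = -a.e := rfl
instance : Group (E V) := Group.ofLeftAxioms
  (fun a b c => by ext <;> simp [mul_v, mul_e, mul_assoc, add_assoc])
  (fun a => by ext <;> simp [mul_v, mul_e, one_v, one_e])
  (fun a => by ext <;> simp [mul_v, mul_e, one_v, one_e, inv_v, inv_e])
lemma eq_one (a : E V) : a = 1 ↔ a.v = 1 ∧ a.e = 0 := by
  rw [E.ext_iff, one_v, one_e]
/-- the inclusion of the first factor -/
def inl : V →* E V where
  toFun v := ⟨v, 0⟩
  map_one' := rfl
  map_mul' a b := by ext <;> simp [mul_v, mul_e]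
lemma inl_inj : Function.Injective (inl (V := V)) := fun a b h => congrArg E.v h
end
section
variable {V : Type} [Group V] [LinearOrder V] [MulLeftMono V]
/-- the positive cone -/
def P (a : E V) : Prop := 1 < a.v ∨ (a.v = 1 ∧ 0 < a.e)
lemma P_one : ¬ P (1 : E V) := by simp [P, one_v, one_e]
lemma P_mul (a b : E V) (ha : P a) (hb : P b) : P (a * b) := by
  unfold P at *
  rw [mul_v, mul_e]
  rcases ha with ha | ⟨ha, ha'⟩ <;> rcases hb with hb | ⟨hb, hb'⟩
  · exact Or.inl (one_lt_mul2 ha hb)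
  · rw [hb, mul_one]; exact Or.inl ha
  · rw [ha, one_mul]; exact Or.inl hb
  · rw [ha, hb, one_mul]; exact Or.inr ⟨rfl, by omega⟩
lemma P_tri (a : E V) (ha : a ≠ 1) : P a ∨ P a⁻¹ := by
  unfold P
  rw [Ne, eq_one] at ha
  rw [inv_v, inv_e, one_lt_inv2, inv_eq_one]
  rcases lt_trichotomy a.v 1 with h | h | h
  · tauto
  · have : a.e ≠ 0 := fun h' => ha ⟨h, h'⟩
    rcases lt_or_gt_of_ne this with h' | h'
    · right; right; exact ⟨h, by omega⟩
    · left; right; exact ⟨h, h'⟩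
  · tauto
noncomputable instance : LinearOrder (E V) := coneOrder P P_one P_mul P_tri
lemma lt_def (a b : E V) : a < b ↔ P (a⁻¹ * b) := Iff.rfl
instance : MulLeftMono (E V) := ⟨fun a b c h => by
  rcases eq_or_lt_of_le h with rfl | h
  · exact le_refl _
  · refine le_of_lt ((lt_def _ _).2 ?_)
    have := (lt_def _ _).1 h
    rwa [mul_inv_rev, mul_assoc, inv_mul_cancel_left]⟩
lemma one_lt (a : E V) : 1 < a ↔ 1 < a.v ∨ (a.v = 1 ∧ 0 < a.e) := by
  rw [lt_def, inv_one, one_mul]; rfl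
lemma lt_one (a : E V) : a < 1 ↔ a.v < 1 ∨ (a.v = 1 ∧ a.e < 0) := by
  rw [← one_lt_inv2, one_lt, inv_v, inv_e, one_lt_inv2, inv_eq_one]
  simp
end
end E

section gap
variable {V : Type} [Group V] [LinearOrder V] [MulLeftMono V]

lemma SS_E (a b : E V) : SS a b ↔ ((a.v < 1 ∨ (a.v = 1 ∧ a.e < 0)) ↔ (b.v < 1 ∨ (b.v = 1 ∧ b.e < 0))) ∧
    ((a.v = 1 ∧ a.e = 0) ↔ (b.v = 1 ∧ b.e = 0)) := by
  unfold SS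
  rw [E.lt_one, E.lt_one, E.eq_one, E.eq_one]

variable (k : Fin 3 → E V) (h0 : (k 0).e = 0) (h1 : (k 1).e = 0) (h2 : k 2 = ⟨1, 1⟩)
include h0 h1 h2

lemma EK_e_le (w : KW) : |(EK k w).e| ≤ w.length := by
  induction w with
  | nil => simp [EK_nil, E.one_e]
  | cons a w ih =>
    obtain ⟨i, b⟩ := a
    rw [EK_cons, E.mul_e, List.length_cons]
    have : |(cond b (k i) (k i)⁻¹).e| ≤ 1 := by
      fin_cases i <;> cases b <;> simp [E.inv_e, h0, h1, h2]
    push_cast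
    have := abs_add_le (cond b (k i) (k i)⁻¹).e (EK k w).e
    omega

lemma EK_eps (b : Bool) (n : ℕ) : EK k (List.replicate n (2, b)) = ⟨1, cond b (n : ℤ) (-n)⟩ := by
  induction n with
  | zero => cases b <;> simp [EK_nil, E.ext_iff, E.one_v, E.one_e]
  | succ n ih =>
    rw [List.replicate_succ, EK_cons, ih]
    cases b <;> simp [E.ext_iff, E.mul_v, E.mul_e, E.inv_v, E.inv_e, h2] <;> ring

lemma exists_word (m : ℕ) (w : KW) (hw : w.length ≤ m) (j : ℤ) (hj : |j| ≤ m + 1) :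
    ∃ v : KW, v.length ≤ 3 * m + 3 ∧ EK k v = ⟨(EK k w).v⁻¹, j⟩ := by
  have he := EK_e_le k h0 h1 h2 w
  rw [abs_le] at he hj
  set d := j + (EK k w).e with hd
  rcases le_total 0 d with h | h
  · refine ⟨FreeGroup.invRev w ++ List.replicate d.toNat (2, true), ?_, ?_⟩
    · rw [List.length_append, FreeGroup.invRev_length, List.length_replicate]; omega
    · rw [EK_append, EK_inv, EK_eps k h0 h1 h2]
      ext
      · simp [E.mul_v, E.inv_v]
      · simp only [E.mul_e, E.inv_e, cond_true]; omega
  · refine ⟨FreeGroup.invRev w ++ List.replicate (-d).toNat (2, false), ?_, ?_⟩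
    · rw [List.length_append, FreeGroup.invRev_length, List.length_replicate]; omega
    · rw [EK_append, EK_inv, EK_eps k h0 h1 h2]
      ext
      · simp [E.mul_v, E.inv_v]
      · simp only [E.mul_e, E.inv_e, cond_false]; omega

theorem gapE : GapP k := by
  intro m κ
  have hfin : ({w : KW | w.length ≤ m}).Finite := List.finite_length_le _ m
  have hE : ∀ w : KW, w.length ≤ m → -(m : ℤ) ≤ (EK k w).e ∧ (EK k w).e ≤ m := by
    intro w hw
    have := EK_e_le k h0 h1 h2 w
    rw [abs_le] at this
    omega
  by_cases c1 : ∃ w : KW, w.length ≤ m ∧ (EK k w).v * κ.v = 1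
  · obtain ⟨w0, hw0, e0⟩ := c1
    obtain ⟨v, hv, hv'⟩ := exists_word k h0 h1 h2 m w0 hw0 (max (-(m + 1 : ℤ)) (min κ.e (m + 1)))
      (by rw [abs_le]; omega)
    refine ⟨v, hv, fun w hw => ?_⟩
    rw [hv', SS_E]
    simp only [E.mul_v, E.mul_e]
    rw [inv_eq_of_mul_eq_one_right e0]
    have := hE w hw
    constructor
    · have : ((EK k w).e + max (-(m + 1 : ℤ)) (min κ.e (m + 1)) < 0) ↔ (EK k w).e + κ.e < 0 := by omega
      rw [this]
    · have : ((EK k w).e + max (-(m + 1 : ℤ)) (min κ.e (m + 1)) = 0) ↔ (EK k w).e + κ.e = 0 := by omega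
      rw [this]
  · push Not at c1
    have key : ∀ w : KW, 1 < (EK k w).v * κ.v ↔ (EK k w).v⁻¹ < κ.v := by
      intro w
      constructor
      · intro h; simpa using llt (EK k w).v⁻¹ h
      · intro h; simpa using llt (EK k w).v h
    have key2 : ∀ w : KW, (EK k w).v * κ.v < 1 ↔ κ.v < (EK k w).v⁻¹ := by
      intro w
      constructor
      · intro h; simpa using llt (EK k w).v⁻¹ h
      · intro h; simpa using llt (EK k w).v h
    by_cases c2 : ∃ w : KW, w.length ≤ m ∧ 1 < (EK k w).v * κ.v
    · obtain ⟨w1, hw1, e1⟩ := c2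
      obtain ⟨w0, ⟨hw0, e0⟩, hmax⟩ := Set.exists_max_image {w : KW | w.length ≤ m ∧ 1 < (EK k w).v * κ.v}
        (fun w => (EK k w).v⁻¹) (hfin.subset fun w hw => hw.1) ⟨w1, hw1, e1⟩
      obtain ⟨v, hv, hv'⟩ := exists_word k h0 h1 h2 m w0 hw0 (m + 1) (by rw [abs_le]; omega)
      refine ⟨v, hv, fun w hw => ?_⟩
      rw [hv', SS_E]
      simp only [E.mul_v, E.mul_e]
      have := hE w hw
      rcases lt_or_gt_of_ne (c1 w hw) with h | h
      · have h3 : (EK k w).v * (EK k w0).v⁻¹ < 1 := by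
          have := ((key _).1 e0).trans ((key2 _).1 h)
          simpa using llt (EK k w).v this
        simp [h, h.ne, h3, h3.ne]
      · have h3 : 1 ≤ (EK k w).v * (EK k w0).v⁻¹ := by
          have := hmax w ⟨hw, h⟩
          simpa using mul_le_mul_right this (EK k w).v
        simp only [h.not_gt, h.ne', h3.not_gt, false_or, false_and, iff_false, not_and]
        omega
    · push Not at c2
      obtain ⟨w0, hw0, hmin⟩ := Set.exists_min_image {w : KW | w.length ≤ m}
        (fun w => (EK k w).v⁻¹) hfin ⟨[], by simp⟩
      obtain ⟨v, hv, hv'⟩ := exists_word k h0 h1 h2 m w0 hw0 (-(m + 1)) (by rw [abs_le]; omega)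
      refine ⟨v, hv, fun w hw => ?_⟩
      rw [hv', SS_E]
      simp only [E.mul_v, E.mul_e]
      have := hE w hw
      have h := lt_of_le_of_ne (c2 w hw) (c1 w hw)
      have h3 : (EK k w).v * (EK k w0).v⁻¹ ≤ 1 := by
        have := hmin w hw
        simpa using mul_le_mul_right this (EK k w).v
      simp only [h, h.ne, true_or, iff_true, false_and, iff_false]
      rcases eq_or_lt_of_le h3 with h4 | h4
      · simp only [h4, true_and]; omega
      · simp [h4, h4.ne]
end gap

/-! ### Passing to the generated subgroup -/
section sub
variable {A : Type} [Group A] (y : Fin 3 → A)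

/-- the subgroup generated by `y` -/
abbrev KS : Subgroup A := (FreeGroup.lift y).range
/-- the generators of `KS y` -/
def kS (i : Fin 3) : KS y := ⟨y i, FreeGroup.of i, by simp⟩

lemma EK_kS (w : KW) : ((EK (kS y) w : KS y) : A) = EK y w := by
  induction w with
  | nil => rw [EK_nil, EK_nil]; rfl
  | cons a w ih =>
    obtain ⟨i, b⟩ := a
    rw [EK_cons, EK_cons, ← ih]
    cases b <;> rfl

lemma kS_surj (κ : KS y) : ∃ v, EK (kS y) v = κ := by
  obtain ⟨κ, g, rfl⟩ := κ
  refine ⟨g.toWord, Subtype.ext ?_⟩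
  rw [EK_kS, EK, FreeGroup.mk_toWord]

variable [LinearOrder A] [MulLeftMono A]
instance : MulLeftMono (KS y) := ⟨fun a b c h => mul_le_mul_right (α := A) (b := b.1) (c := c.1) h a.1⟩

lemma gap_kS (h : GapP y) : GapP (kS y) := by
  intro m κ
  obtain ⟨v, hv, H⟩ := h m κ.1
  refine ⟨v, hv, fun w hw => ?_⟩
  have := H w hw
  rw [← EK_kS y w, ← EK_kS y v] at this
  refine ⟨this.1, ?_⟩
  rw [Subtype.ext_iff, Subtype.ext_iff]
  exact this.2

lemma sg_kS (w : KW) : sg (EK (kS y) w) = sg (EK y w) := by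
  rcases sg_cases (EK y w) with ⟨h, h'⟩ | ⟨h, h'⟩ | ⟨h, h'⟩
  · rw [h]; apply sg_lt; change (EK (kS y) w).1 < 1; rwa [EK_kS]
  · rw [h, show EK (kS y) w = 1 from Subtype.ext (by rw [EK_kS, h']; rfl), sg_one]
  · rw [h]; apply sg_gt; change 1 < (EK (kS y) w).1; rwa [EK_kS]
end sub

/-! ### Sign computability in the extension -/
section esc
variable {V : Type} [Group V] [LinearOrder V] [MulLeftMono V]

/-- exponent sum of the last letter, as a pair -/
def cnt (w : KW) : ℕ × ℕ := w.foldr (fun a s => if a = (2, true) then (s.1 + 1, s.2) else if a = (2, false) then (s.1, s.2 + 1) else s) (0, 0)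

lemma cnt_comp : Computable cnt := by
  have p1 : Primrec fun p : KW × ((Fin 3 × Bool) × (ℕ × ℕ)) => p.2.1 := Primrec.fst.comp Primrec.snd
  have p2 : Primrec fun p : KW × ((Fin 3 × Bool) × (ℕ × ℕ)) => p.2.2 := Primrec.snd.comp Primrec.snd
  have e1 : Primrec fun p : KW × ((Fin 3 × Bool) × (ℕ × ℕ)) => (p.2.2.1 + 1, p.2.2.2) :=
    (Primrec.succ.comp (Primrec.fst.comp p2)).pair (Primrec.snd.comp p2)
  have e2 : Primrec fun p : KW × ((Fin 3 × Bool) × (ℕ × ℕ)) => (p.2.2.1, p.2.2.2 + 1) :=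
    (Primrec.fst.comp p2).pair (Primrec.succ.comp (Primrec.snd.comp p2))
  have c1 : PrimrecPred fun p : KW × ((Fin 3 × Bool) × (ℕ × ℕ)) => p.2.1 = (2, true) :=
    Primrec.eq.comp p1 (Primrec.const _)
  have c2 : PrimrecPred fun p : KW × ((Fin 3 × Bool) × (ℕ × ℕ)) => p.2.1 = (2, false) :=
    Primrec.eq.comp p1 (Primrec.const _)
  have := Primrec.list_foldr (f := fun w : KW => w) (g := fun _ : KW => ((0, 0) : ℕ × ℕ))
    (h := fun _ (p : (Fin 3 × Bool) × (ℕ × ℕ)) => if p.1 = (2, true) then (p.2.1 + 1, p.2.2)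
      else if p.1 = (2, false) then (p.2.1, p.2.2 + 1) else p.2) Primrec.id (Primrec.const _)
    (Primrec.ite c1 e1 (Primrec.ite c2 e2 p2))
  exact this.to_comp

/-- the three generators -/
def kE (g : Fin 3 → V) (i : Fin 3) : E V := ⟨g i, if i = 2 then 1 else 0⟩

lemma kE_v (g : Fin 3 → V) (w : KW) : (EK (kE g) w).v = EK g w := by
  induction w with
  | nil => rw [EK_nil, EK_nil]; rfl
  | cons a w ih =>
    obtain ⟨i, b⟩ := a
    rw [EK_cons, EK_cons, E.mul_v, ih]
    cases b <;> rfl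

lemma kE_e (g : Fin 3 → V) (w : KW) : (EK (kE g) w).e = (cnt w).1 - (cnt w).2 := by
  induction w with
  | nil => rw [EK_nil]; rfl
  | cons a w ih =>
    obtain ⟨i, b⟩ := a
    have : cnt ((i, b) :: w) = if (i, b) = (2, true) then ((cnt w).1 + 1, (cnt w).2) else if (i, b) = (2, false) then ((cnt w).1, (cnt w).2 + 1) else cnt w := rfl
    rw [EK_cons, E.mul_e, ih, this]
    fin_cases i <;> cases b <;> simp [kE, E.inv_e] <;> ring

theorem kE_sc (g : Fin 3 → V) (h : Computable fun w : KW => sg (EK g w)) :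
    Computable fun w : KW => sg (EK (kE g) w) := by
  have c1 : Computable fun w : KW => (cnt w).1 := Computable.fst.comp cnt_comp
  have c2 : Computable fun w : KW => (cnt w).2 := Computable.snd.comp cnt_comp
  have d1 : Computable fun w : KW => decide ((cnt w).1 < (cnt w).2) :=
    (Primrec.nat_lt.decide : Primrec₂ fun a b : ℕ => decide (a < b)).to_comp.comp c1 c2
  have d2 : Computable fun w : KW => decide ((cnt w).1 = (cnt w).2) :=
    (Primrec.eq.decide : Primrec₂ fun a b : ℕ => decide (a = b)).to_comp.comp c1 c2
  have c3 : Computable fun w : KW => if (cnt w).1 < (cnt w).2 then 0 else if (cnt w).1 = (cnt w).2 then 1 else 2 :=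
    comp_ite d1 (Computable.const 0) (comp_ite d2 (Computable.const 1) (Computable.const 2))
  refine (comp_sel h (Computable.const 0) c3 (Computable.const 2)).of_eq fun w => ?_
  have hv := kE_v g w
  have he := kE_e g w
  rcases sg_cases (EK g w) with ⟨h, h'⟩ | ⟨h, h'⟩ | ⟨h, h'⟩
  · rw [h, sg_lt ((E.lt_one _).2 (Or.inl (by rwa [hv])))]; rfl
  · rw [h]
    change (if (cnt w).1 < (cnt w).2 then 0 else if (cnt w).1 = (cnt w).2 then 1 else 2) = _
    rw [h'] at hv
    split_ifs with i1 i2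
    · exact (sg_lt ((E.lt_one _).2 (Or.inr ⟨hv, by omega⟩))).symm
    · rw [(E.eq_one _).2 ⟨hv, by omega⟩, sg_one]
    · exact (sg_gt ((E.one_lt _).2 (Or.inr ⟨hv, by omega⟩))).symm
  · rw [h, sg_gt ((E.one_lt _).2 (Or.inl (by rwa [hv])))]; rfl
end esc
end LO

namespace LO
set_option linter.unusedSectionVars false

/-! ### Words representing the embedded group -/
section emb
variable {K : Type} [Group K] [LinearOrder K] (k : Fin 3 → K)

/-- translate a word in the letters of `K` to the generators of the big group -/
def mapw (v : KW) : List (Fin 12 × Bool) := v.map fun a => (⟨9 + a.1.val, by omega⟩, a.2)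

lemma act_mapw (g : Equiv.Perm (Om K)) (r : ℤ) (hr : (0 - r) % 8 ≠ 0)
    (hg : ∀ κ : K, g * cc κ * g⁻¹ = kat (cls 0) κ * (kat (cls r) κ)⁻¹) (v : KW) :
    ∃ X : K, g * act k (mapw v) * g⁻¹ = kat (cls 0) (EK k v) * kat (cls r) X := by
  induction v with
  | nil => exact ⟨1, by simp [mapw, act_nil, EK_nil]⟩
  | cons a v ih =>
    obtain ⟨i, b⟩ := a
    obtain ⟨X, hX⟩ := ih
    have e0 : mapw ((i, b) :: v) = (⟨9 + i.val, by omega⟩, b) :: mapw v := rfl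
    have comm : ∀ κ κ' : K, kat (cls r) κ * kat (cls 0) κ' = kat (cls 0) κ' * kat (cls r) κ :=
      fun κ κ' => (kat_comm (cls_disj hr) κ' κ).eq.symm
    have e1 : ∃ Z : K, g * cond b (cc (k i)) (cc (k i))⁻¹ * g⁻¹ = kat (cls 0) (cond b (k i) (k i)⁻¹) * kat (cls r) Z := by
      cases b
      · refine ⟨k i, ?_⟩
        have : g * (cc (k i))⁻¹ * g⁻¹ = (g * cc (k i) * g⁻¹)⁻¹ := by group
        rw [cond_false, cond_false, this, hg, mul_inv_rev, inv_inv, ← map_inv, comm]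
      · exact ⟨(k i)⁻¹, by rw [cond_true, cond_true, hg, map_inv]⟩
    obtain ⟨Z, hZ⟩ := e1
    refine ⟨Z * X, ?_⟩
    rw [e0, act_cons, gens_c, EK_cons]
    have e2 : g * (cond b (cc (k i)) (cc (k i))⁻¹ * act k (mapw v)) * g⁻¹ =
      (g * cond b (cc (k i)) (cc (k i))⁻¹ * g⁻¹) * (g * act k (mapw v) * g⁻¹) := by group
    rw [e2, hZ, hX, map_mul, map_mul, mul_assoc, ← mul_assoc (kat (cls r) Z), comm]
    simp only [mul_assoc]

lemma comm_aux {A : Type} [Group A] {a b x y : A} (h1 : Commute x y) (h2 : Commute x b) (h3 : Commute x a) (h4 : Commute y a) :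
    (a * x) * (b * y) * (a * x)⁻¹ * (b * y)⁻¹ = a * b * a⁻¹ * b⁻¹ := by
  have e1 : x * (b * y) * x⁻¹ = b * y := by
    rw [← mul_assoc, h2.eq, mul_assoc b, h1.eq]; group
  have e2 : (a * x) * (b * y) * (a * x)⁻¹ * (b * y)⁻¹ = a * (x * (b * y) * x⁻¹) * a⁻¹ * y⁻¹ * b⁻¹ := by group
  have e3 : y * a⁻¹ * y⁻¹ = a⁻¹ := by rw [h4.inv_right.eq]; group
  have e4 : a * (b * y) * a⁻¹ * y⁻¹ * b⁻¹ = a * b * (y * a⁻¹ * y⁻¹) * b⁻¹ := by group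
  rw [e2, e1, e4, e3]

lemma exists_F : ∃ F : List (Fin 12 × Bool), act k F = liftP f1 := (mem_HH k).1 (TT_mem k f1_mem)

/-- the commutator word -/
def cw (F u v : List (Fin 12 × Bool)) : List (Fin 12 × Bool) :=
  u ++ (F ++ (v ++ FreeGroup.invRev F)) ++ FreeGroup.invRev u ++ FreeGroup.invRev (F ++ (v ++ FreeGroup.invRev F))

lemma act_cw (F : List (Fin 12 × Bool)) (hF : act k F = liftP f1) (u v : KW) :
    act k (cw F (mapw u) (mapw v)) = kat (cls 0) (EK k u * EK k v * (EK k u)⁻¹ * (EK k v)⁻¹) := by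
  obtain ⟨X, hX⟩ := act_mapw k 1 3 (by norm_num) (fun κ => by rw [one_mul, inv_one, mul_one]; rfl) u
  obtain ⟨Y, hY⟩ := act_mapw k (liftP f1) 5 (by norm_num) f1_cc v
  rw [one_mul, inv_one, mul_one] at hX
  unfold cw
  simp only [act_append, act_inv]
  rw [hF, ← mul_assoc (liftP f1), hY, hX, comm_aux, map_mul, map_mul, map_mul, map_inv, map_inv]
  · exact kat_comm (cls_disj (by norm_num)) _ _
  · exact kat_comm (cls_disj (by norm_num)) _ _
  · exact kat_comm (cls_disj (by norm_num)) _ _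
  · exact kat_comm (cls_disj (by norm_num)) _ _

lemma kat0_inj : Function.Injective (kat (K := K) (cls 0)) := by
  intro a b h
  have h0 : (0 : ℤ) ∈ cls 0 := mem_cls_self 0
  have := congrArg (fun σ : Equiv.Perm (Om K) => unplace (σ (place 0 1 [] []))) h
  simp only [kat_place h0, unplace_place, mul_one] at this
  simpa using this

/-- the words for the conjugates -/
def wi (p : ℕ) : KW := List.replicate p (0, false) ++ [(1, true)] ++ List.replicate p (0, true)

lemma EK_rep (i : Fin 3) (b : Bool) (p : ℕ) : EK k (List.replicate p (i, b)) = cond b (k i) (k i)⁻¹ ^ p := by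
  induction p with
  | zero => simp [EK_nil]
  | succ p ih => rw [List.replicate_succ, EK_cons, ih, pow_succ']

lemma EK_wi (p : ℕ) : EK k (wi p) = (k 0 ^ p)⁻¹ * k 1 * k 0 ^ p := by
  rw [wi, EK_append, EK_append, EK_rep, EK_rep, EK_one]
  simp

lemma rep_prim {α : Type} [Primcodable α] (a : α) : Primrec fun p : ℕ => List.replicate p a := by
  have h0 : Primrec₂ fun (_ : ℕ) (s : List α) => a :: s :=
    Primrec.list_cons.comp (Primrec.const a) Primrec.snd
  refine (Primrec.nat_rec₁ (f := fun _ s => a :: s) [] h0).of_eq fun n => ?_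
  induction n with
  | zero => rfl
  | succ n ih => rw [List.replicate_succ, ← ih]

lemma mapw_wi_prim : Primrec fun p : ℕ => mapw (wi p) := by
  have : Primrec fun p : ℕ => List.replicate p ((9, false) : Fin 12 × Bool) ++ [(10, true)] ++ List.replicate p ((9, true) : Fin 12 × Bool) :=
    Primrec.list_append.comp (Primrec.list_append.comp (rep_prim _) (Primrec.const _)) (rep_prim _)
  refine this.of_eq fun p => ?_
  simp [mapw, wi]

lemma invRev_prim {n : ℕ} : Primrec (fun l : List (Fin n × Bool) => FreeGroup.invRev l) :=
  (Primrec.list_reverse.comp (Primrec.list_map (f := fun l : List (Fin n × Bool) => l) (g := fun _ (a : Fin n × Bool) => (a.1, !a.2)) Primrec.id (Primrec.pair (Primrec.fst.comp Primrec.snd) (Primrec.not.comp (Primrec.snd.comp Primrec.snd)))))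

lemma cw_prim (F : List (Fin 12 × Bool)) {u v : ℕ → List (Fin 12 × Bool)} (hu : Primrec u) (hv : Primrec v) :
    Primrec fun i => cw F (u i) (v i) := by
  have h1 : Primrec fun i => F ++ (v i ++ FreeGroup.invRev F) :=
    Primrec.list_append.comp (Primrec.const _) (Primrec.list_append.comp hv (Primrec.const _))
  exact Primrec.list_append.comp (Primrec.list_append.comp (Primrec.list_append.comp hu h1) (invRev_prim.comp hu))
    (invRev_prim.comp h1)
end emb

/-! ### The forward direction -/
theorem forward (G : Type) [Group G] [LinearOrder G] [MulLeftMono G] (x : ℕ → G)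
    (hx : Subgroup.closure (Set.range x) = ⊤) (hc : Computable fun w => sg (evI x w)) :
    ∃ (H : Type) (_ : Group H) (m : ℕ) (π : FreeGroup (Fin m) →* H) (φ : G →* H),
        Function.Surjective π ∧ IsSimpleGroup H ∧ ComputableLeftOrderVia π ∧
        Function.Injective φ ∧ ComputableEmbedding x π φ := by
  set g : Fin 3 → W (W G) := gB (yA x) with hgdef
  set y : Fin 3 → E (W (W G)) := kE g with hy
  have y2 : y 2 = ⟨1, 1⟩ := by
    rw [hy, E.ext_iff]
    constructor
    · change g 2 = 1; rw [hgdef]; simp [gB]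
    · rfl
  have hk := kS_surj y
  have hgap : GapP (kS y) := gap_kS y (gapE y rfl rfl y2)
  have hs : Computable fun v : KW => sg (EK (kS y) v) := by
    refine (kE_sc g ?_).of_eq fun v => (sg_kS y v).symm
    exact (gB_sc x (yA_sc x hc)).of_eq fun v => by rw [EK_eq_evI]
  haveI hnt : Nontrivial (KS y) := by
    refine ⟨kS y 2, 1, fun h => ?_⟩
    have := congrArg (fun a : KS y => a.1.e) h
    change (y 2).e = 0 at this
    rw [y2] at this
    exact one_ne_zero this
  obtain ⟨l, hl, hlc⟩ := order_HH hk hgap hs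
  let ι0 : G →* E (W (W G)) := E.inl.comp (W.delta.comp W.delta)
  have ι0_inj : Function.Injective ι0 := E.inl_inj.comp (W.delta_inj.comp W.delta_inj)
  let cK : ℕ → KS y := fun i => EK (kS y) (wi (2 ^ (2 * i + 1))) * EK (kS y) (wi (2 ^ (2 * i))) *
    (EK (kS y) (wi (2 ^ (2 * i + 1))))⁻¹ * (EK (kS y) (wi (2 ^ (2 * i))))⁻¹
  have hcK : ∀ i, (cK i).1 = ι0 (x i) := by
    intro i
    have e1 : (cK i).1 = EK y (wi (2 ^ (2 * i + 1))) * EK y (wi (2 ^ (2 * i))) *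
      (EK y (wi (2 ^ (2 * i + 1))))⁻¹ * (EK y (wi (2 ^ (2 * i))))⁻¹ := by
      rw [← EK_kS y (wi (2 ^ (2 * i + 1))), ← EK_kS y (wi (2 ^ (2 * i)))]; rfl
    rw [e1]
    ext1
    · simp only [E.mul_v, E.inv_v, hy, kE_v]
      simp only [EK_wi]
      change _ = W.delta (W.delta (x i))
      rw [← comm_Phi x i]
      rfl
    · simp only [E.mul_e, E.inv_e]
      change _ = (0 : ℤ)
      ring
  have hmem : ∀ a : G, ι0 a ∈ KS y := by
    intro a
    have : (⊤ : Subgroup G) ≤ (KS y).comap ι0 := by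
      rw [← hx, Subgroup.closure_le]
      rintro _ ⟨i, rfl⟩
      change ι0 (x i) ∈ KS y
      rw [← hcK]; exact (cK i).2
    exact this (Subgroup.mem_top a)
  let ι : G →* KS y := ι0.codRestrict (KS y) hmem
  have hι : ∀ i, ι (x i) = cK i := fun i => Subtype.ext (hcK i).symm
  have ι_inj : Function.Injective ι := fun a b h => ι0_inj (congrArg Subtype.val h)
  obtain ⟨F, hF⟩ := exists_F (kS y)
  let φ0 : G →* Equiv.Perm (Om (KS y)) := (kat (cls 0)).comp ι
  let f : ℕ → List (Fin 12 × Bool) := fun i => cw F (mapw (wi (2 ^ (2 * i + 1)))) (mapw (wi (2 ^ (2 * i))))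
  have hf : ∀ i, act (kS y) (f i) = φ0 (x i) := by
    intro i
    change _ = kat (cls 0) (ι (x i))
    rw [hι]
    exact act_cw (kS y) F hF _ _
  have hmem2 : ∀ a : G, φ0 a ∈ HH (kS y) := by
    intro a
    have : (⊤ : Subgroup G) ≤ (HH (kS y)).comap φ0 := by
      rw [← hx, Subgroup.closure_le]
      rintro _ ⟨i, rfl⟩
      change φ0 (x i) ∈ HH (kS y)
      rw [← hf]; exact act_mem _ _
    exact this (Subgroup.mem_top a)
  refine ⟨HH (kS y), inferInstance, 12, (FreeGroup.lift (gens (kS y))).rangeRestrict,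
    φ0.codRestrict (HH (kS y)) hmem2, MonoidHom.rangeRestrict_surjective _, simple_HH hk, ⟨l, hl, hlc⟩, ?_, f, ?_, ?_⟩
  · intro a b h
    exact ι_inj (kat0_inj (congrArg Subtype.val h))
  · have h2 : Primrec fun i : ℕ => 2 * i := Primrec.nat_mul.comp (Primrec.const 2) Primrec.id
    have hp : Primrec fun i : ℕ => mapw (wi (2 ^ (2 * i))) := mapw_wi_prim.comp (pow2_prim.comp h2)
    have hq : Primrec fun i : ℕ => mapw (wi (2 ^ (2 * i + 1))) := mapw_wi_prim.comp (pow2_prim.comp (Primrec.succ.comp h2))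
    exact (cw_prim F hq hp).to_comp
  · intro i
    exact Subtype.ext (hf i)

lemma sign_to_sg {G : Type} [Group G] (l : LinearOrder G) (a : G) :
    @sg G _ l a = if orderSign l a = -1 then 0 else if orderSign l a = 0 then 1 else 2 := by
  unfold sg orderSign
  by_cases h1 : l.lt a 1
  · simp [h1]
  · by_cases h2 : a = 1
    · subst h2; simp
    · simp [h1, h2]

/-! ### The backward direction -/
/-- substitute words for letters -/
def subw {m : ℕ} (f : ℕ → List (Fin m × Bool)) (w : NW) : List (Fin m × Bool) :=
  w.foldr (fun a s => cond a.2 (f a.1) (FreeGroup.invRev (f a.1)) ++ s) []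

lemma subw_comp {m : ℕ} {f : ℕ → List (Fin m × Bool)} (hf : Computable f) : Computable (subw f) := by
  have c1 : Computable fun p : NW × ((ℕ × Bool) × List (Fin m × Bool)) => f p.2.1.1 :=
    hf.comp (Computable.fst.comp (Computable.fst.comp Computable.snd))
  have c2 : Computable fun p : NW × ((ℕ × Bool) × List (Fin m × Bool)) => FreeGroup.invRev (f p.2.1.1) :=
    invRev_prim.to_comp.comp c1
  have c3 : Computable fun p : NW × ((ℕ × Bool) × List (Fin m × Bool)) => p.2.1.2 :=
    Computable.snd.comp (Computable.fst.comp Computable.snd)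
  have c4 : Computable fun p : NW × ((ℕ × Bool) × List (Fin m × Bool)) => p.2.2 :=
    Computable.snd.comp Computable.snd
  have c5 : Computable fun p : NW × ((ℕ × Bool) × List (Fin m × Bool)) => cond p.2.1.2 (f p.2.1.1) (FreeGroup.invRev (f p.2.1.1)) :=
    Computable.cond c3 c1 c2
  have c6 : Computable₂ fun (_ : NW) (p : (ℕ × Bool) × List (Fin m × Bool)) => cond p.1.2 (f p.1.1) (FreeGroup.invRev (f p.1.1)) ++ p.2 :=
    Computable.list_append.comp c5 c4
  exact comp_foldr (f := fun w : NW => w) (g := fun _ => ([] : List (Fin m × Bool))) Computable.id (Computable.const _) c6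

lemma subw_spec {G H : Type} [Group G] [Group H] {m : ℕ} (π : FreeGroup (Fin m) →* H) (φ : G →* H) (x : ℕ → G)
    (f : ℕ → List (Fin m × Bool)) (hf : ∀ i, π (FreeGroup.mk (f i)) = φ (x i)) (w : NW) :
    π (FreeGroup.mk (subw f w)) = φ (evalWord x w) := by
  induction w with
  | nil => simp [subw, evalWord, ← FreeGroup.one_eq_mk]
  | cons a w ih =>
    obtain ⟨i, b⟩ := a
    have e1 : subw f ((i, b) :: w) = cond b (f i) (FreeGroup.invRev (f i)) ++ subw f w := rfl
    have e2 : evalWord x ((i, b) :: w) = (if b then x i else (x i)⁻¹) * evalWord x w := by simp [evalWord]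
    rw [e1, e2, ← FreeGroup.mul_mk, map_mul, map_mul, ih]
    cases b
    · simp [← FreeGroup.inv_mk, hf]
    · simp [hf]

theorem backward {G : Type} [Group G] (x : ℕ → G) {H : Type} [Group H] {m : ℕ} (π : FreeGroup (Fin m) →* H) (φ : G →* H)
    (hl : ComputableLeftOrderVia π) (hi : Function.Injective φ) (hc : ComputableEmbedding x π φ) :
    ComputableLeftOrderWrt x := by
  obtain ⟨l, hl, hlc⟩ := hl
  obtain ⟨f, hf, hf'⟩ := hc
  let L : LinearOrder G := @LinearOrder.lift' _ _ l φ hi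
  have hle : ∀ a b, L.le a b ↔ l.le (φ a) (φ b) := fun a b => Iff.rfl
  have hlt : ∀ a b, L.lt a b ↔ l.lt (φ a) (φ b) := fun a b => Iff.rfl
  refine ⟨L, fun a b c h => ?_, ?_⟩
  · rw [hle, map_mul, map_mul]; exact hl _ _ _ h
  · refine (hlc.comp (subw_comp hf)).of_eq fun w => ?_
    rw [subw_spec π φ x f hf']
    unfold orderSign
    have e1 : φ (evalWord x w) = 1 ↔ evalWord x w = 1 := by rw [← map_one φ, hi.eq_iff]
    have e2 : L.lt (evalWord x w) 1 ↔ l.lt (φ (evalWord x w)) 1 := by rw [hlt, map_one]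
    by_cases h1 : l.lt (φ (evalWord x w)) 1
    · rw [if_pos h1, if_pos (e2.2 h1)]
    · rw [if_neg h1, if_neg (fun h => h1 (e2.1 h))]
      simp only [e1]

theorem forward0 (G : Type) [Group G] (x : ℕ → G)
    (hx : Subgroup.closure (Set.range x) = ⊤) (h : ComputableLeftOrderWrt x) :
    ∃ (H : Type) (_ : Group H) (m : ℕ) (π : FreeGroup (Fin m) →* H) (φ : G →* H),
        Function.Surjective π ∧ IsSimpleGroup H ∧ ComputableLeftOrderVia π ∧
        Function.Injective φ ∧ ComputableEmbedding x π φ := by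
  obtain ⟨l, hl, hc⟩ := h
  letI := l
  haveI : MulLeftMono G := ⟨fun a b c h => hl a b c h⟩
  refine forward G x hx ?_
  have d1 : ∀ n : ℤ, Computable fun w : NW => decide (orderSign l (evalWord x w) = n) := fun n =>
    (Primrec.eq.decide : Primrec₂ fun a b : ℤ => decide (a = b)).to_comp.comp hc (Computable.const n)
  refine (comp_ite (d1 (-1)) (Computable.const 0) (comp_ite (d1 0) (Computable.const 1) (Computable.const 2))).of_eq fun w => ?_
  exact (sign_to_sg l _).symm
end LO

theorem computable_left_order_iff_computable_embedding_into_fg_simple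
    (G : Type) [Group G] [Countable G] (x : ℕ → G)
    (hx : Subgroup.closure (Set.range x) = ⊤) :
    ComputableLeftOrderWrt x ↔
      ∃ (H : Type) (_ : Group H) (m : ℕ) (π : FreeGroup (Fin m) →* H) (φ : G →* H),
        Function.Surjective π ∧ IsSimpleGroup H ∧ ComputableLeftOrderVia π ∧
        Function.Injective φ ∧ ComputableEmbedding x π φ := by
  constructor
  · exact LO.forward0 G x hx
  · rintro ⟨H, _, m, π, φ, -, -, hl, hi, hc⟩
    exact LO.backward x π φ hl hi hc
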